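/- (Fatou-type theorem for injectively elliptic first-order systems in UR domains.) Let n ≥ 2 and let Ω ⊆ ℝⁿ be a UR domain; set σ := ℋ^{n−1} restricted to ∂Ω. Let N, M ∈ ℕ and let (a_j^{αβ})_{1≤j≤n, 1≤α≤N, 1≤β≤M} be complex constants defining the homogeneous first-order system D = (∑_{j=1}^n a_j^{αβ} ∂_j); assume D is injectively elliptic, i.e., for every ξ ∈ ℝⁿ ∖ {0} the N×M matrix (∑_{j=1}^n a_j^{αβ} ξ_j) has trivial null space as a linear map ℂ^M → ℂ^N. Fix κ > 0 and p ∈ ((n−1)/n, ∞), and let u = (u_1,…,u_M) : Ω → ℂ^M be locally integrable with N_κ u ∈ L^p(∂Ω,σ) and Du = 0 in the sense of distributions in Ω, i.e., for every φ ∈ C_c^∞(Ω) and every α ∈ {1,…,N}: ∑_{j=1}^n ∑_{β=1}^M a_j^{αβ} ∫_Ω u_β ∂_j φ dℒⁿ = 0. Then: the κ-nontangential trace of u exists (in ℂ^M) at σ-a.e. point of ∂Ω; the trace function is σ-measurable, belongs to L^p(∂Ω,σ;ℂ^M), and its L^p(∂Ω,σ) norm is ≤ ‖N_κ u‖_{L^p(∂Ω,σ)};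 moreover, for every other aperture κ′ > 0 the κ′-nontangential trace of u also exists and agrees with the κ-nontangential trace at σ-a.e. point of ∂Ω. -/

import Mathlib

open MeasureTheory Metric Set Filter
open scoped ENNReal NNReal Topology

noncomputable section

abbrev Euc (n : ℕ) : Type := EuclideanSpace ℝ (Fin n)

variable {n : ℕ}

/-- The nontangential approach region `Γ_κ(x)` to `∂Ω` from within `Ω`. -/
def ntRegion (Ω : Set (Euc n)) (κ : ℝ) (x : Euc n) : Set (Euc n) :=
  {y | y ∈ Ω ∧ dist x y < (1 + κ) * infDist y (frontier Ω)}

/-- The one-sided collar neighborhood `O_ε` of `∂Ω`. -/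
def collar (Ω : Set (Euc n)) (ε : ℝ) : Set (Euc n) :=
  {y | y ∈ Ω ∧ infDist y (frontier Ω) < ε}

/-- Nontangential maximal function of `u` restricted to a set `S` (truncated version). -/
def ntMaxOn {E : Type*} [NormedAddCommGroup E] (Ω S : Set (Euc n)) (κ : ℝ)
    (u : Euc n → E) (x : Euc n) : ℝ≥0∞ :=
  essSup (fun y => (‖u y‖₊ : ℝ≥0∞)) (volume.restrict (ntRegion Ω κ x ∩ S))

/-- Nontangential maximal function `N_κ u`. -/
def ntMax {E : Type*} [NormedAddCommGroup E] (Ω : Set (Euc n)) (κ : ℝ)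
    (u : Euc n → E) (x : Euc n) : ℝ≥0∞ :=
  essSup (fun y => (‖u y‖₊ : ℝ≥0∞)) (volume.restrict (ntRegion Ω κ x))

/-- `u` has κ-nontangential trace `v` at the boundary point `x`. -/
def HasNTTrace {E : Type*} [NormedAddCommGroup E] (Ω : Set (Euc n)) (κ : ℝ)
    (u : Euc n → E) (x : Euc n) (v : E) : Prop :=
  x ∈ closure (ntRegion Ω κ x) ∧
  ∃ N : Set (Euc n), N ⊆ ntRegion Ω κ x ∧ volume N = 0 ∧
    Tendsto u (nhdsWithin x (ntRegion Ω κ x \ N)) (nhds v)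

/-- `Sig` is an Ahlfors regular set (of dimension `n-1`) with constant `C`. -/
def AhlforsRegularWith (n : ℕ) (Sig : Set (Euc n)) (C : ℝ) : Prop :=
  1 < C ∧ IsClosed Sig ∧ ∀ x ∈ Sig, ∀ r : ℝ, 0 < r →
    ENNReal.ofReal r < 2 * EMetric.diam Sig →
    ENNReal.ofReal (C⁻¹ * r ^ (n - 1)) ≤ μH[(n : ℝ) - 1] (Sig ∩ ball x r) ∧
      μH[(n : ℝ) - 1] (Sig ∩ ball x r) ≤ ENNReal.ofReal (C * r ^ (n - 1))

/-- The measure-theoretic (geometric measure theoretic) boundary `∂*Ω`. -/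
def mtBoundary (n : ℕ) (Ω : Set (Euc n)) : Set (Euc n) :=
  {x | 0 < limsup (fun r : ℝ => volume (Ω ∩ ball x r) / ENNReal.ofReal (r ^ n)) (𝓝[>] 0) ∧
       0 < limsup (fun r : ℝ => volume (Ωᶜ ∩ ball x r) / ENNReal.ofReal (r ^ n)) (𝓝[>] 0)}

/-- The nontangentially accessible boundary `∂_nta Ω`. -/
def ntaBoundary (n : ℕ) (Ω : Set (Euc n)) : Set (Euc n) :=
  {x | x ∈ frontier Ω ∧ ∀ κ : ℝ, 0 < κ → x ∈ closure (ntRegion Ω κ x)}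

/-- The Laplacian `Δu = ∑ ∂²u/∂x_j²`, via iterated Fréchet derivatives. -/
def laplacian (u : Euc n → ℝ) (x : Euc n) : ℝ :=
  ∑ i : Fin n, fderiv ℝ (fun z => fderiv ℝ u z (EuclideanSpace.single i 1)) x
    (EuclideanSpace.single i 1)

/-- `u` is harmonic on the open set `Ω`. -/
def HarmonicOn' (u : Euc n → ℝ) (Ω : Set (Euc n)) : Prop :=
  ContDiffOn ℝ 2 u Ω ∧ ∀ x ∈ Ω, laplacian u x = 0

/-- `w` is (continuous and) subharmonic on the open set `Ω`, via the sub-mean value property. -/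
def SubharmonicOn (w : Euc n → ℝ) (Ω : Set (Euc n)) : Prop :=
  ContinuousOn w Ω ∧ ∀ x ∈ Ω, ∀ r : ℝ, 0 < r → closedBall x r ⊆ Ω →
    w x ≤ ⨍ y in ball x r, w y

/-- `Sig` is a uniformly rectifiable (UR) set: closed, Ahlfors regular, with
Big Pieces of Lipschitz Images. -/
def IsURSet (n : ℕ) (Sig : Set (Euc n)) : Prop :=
  IsClosed Sig ∧ (∃ C : ℝ, AhlforsRegularWith n Sig C) ∧
  ∃ ε : ℝ, 0 < ε ∧ ∃ M₀ : ℝ≥0, ∀ x ∈ Sig, ∀ r : ℝ, 0 < r →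
    ENNReal.ofReal r < EMetric.diam Sig →
    ∃ Φ : EuclideanSpace ℝ (Fin (n - 1)) → Euc n, LipschitzWith M₀ Φ ∧
      ENNReal.ofReal (ε * r ^ (n - 1)) ≤
        μH[(n : ℝ) - 1] (Sig ∩ ball x r ∩ Φ '' ball (0 : EuclideanSpace ℝ (Fin (n - 1))) r)

end


open MeasureTheory Metric Set Filter
open scoped ENNReal NNReal Topology

/-! ### Part 1: interior estimates with error -/

noncomputable section
variable {n N M : ℕ}

/-- directional derivative along the `j`-th coordinate -/
def pd (j : Fin n) (φ : Euc n → ℝ) (x : Euc n) : ℝ := fderiv ℝ φ x (EuclideanSpace.single j 1)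

/-- smooth, compactly supported in `U` -/
structure IsTest (U : Set (Euc n)) (φ : Euc n → ℝ) : Prop where
  smooth : ContDiff ℝ (⊤ : ℕ∞) φ
  cpt : HasCompactSupport φ
  supp : tsupport φ ⊆ U

/-- The distributional pairing. -/
def PD (a : Fin n → Fin N → Fin M → ℂ) (X : Fin M → Euc n → ℂ) (φ : Euc n → ℝ) (α : Fin N) : ℂ :=
  ∑ j, ∑ β, a j α β * ∫ x, (pd j φ x : ℂ) * X β x

def SmallD (a : Fin n → Fin N → Fin M → ℂ) (X : Fin M → Euc n → ℂ) (x₀ : Euc n) (r ε : ℝ) : Prop :=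
  ∀ φ, IsTest (ball x₀ r) φ → ∀ B : ℝ, (∀ x, |φ x| ≤ B) → ∀ α, ‖PD a X φ α‖ ≤ ε * B

theorem symbol_lower (a : Fin n → Fin N → Fin M → ℂ)
    (hell : ∀ ξ : Euc n, ξ ≠ 0 → ∀ v : Fin M → ℂ,
      (∀ α : Fin N, ∑ β : Fin M, (∑ j : Fin n, a j α β * (ξ j : ℂ)) * v β = 0) → v = 0) :
    ∃ c > 0, ∀ (ξ : Euc n) (v : Fin M → ℂ), c * ‖ξ‖ * ‖v‖ ≤
      ∑ α, ‖∑ β : Fin M, (∑ j : Fin n, a j α β * (ξ j : ℂ)) * v β‖ := by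
  classical
  set G : Euc n × (Fin M → ℂ) → ℝ := fun q =>
    ∑ α, ‖∑ β : Fin M, (∑ j : Fin n, a j α β * (q.1 j : ℂ)) * q.2 β‖ with hG
  have hGc : Continuous G := by rw [hG]; fun_prop
  have hpos : ∀ q : Euc n × (Fin M → ℂ), q.1 ≠ 0 → q.2 ≠ 0 → 0 < G q := by
    intro q h1 h2
    by_contra h
    have h0 : G q = 0 := le_antisymm (not_lt.1 h) (Finset.sum_nonneg fun _ _ => norm_nonneg _)
    rw [hG] at h0
    have := (Finset.sum_eq_zero_iff_of_nonneg (fun _ _ => norm_nonneg _)).1 h0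
    exact h2 (hell q.1 h1 q.2 fun α => norm_eq_zero.1 (this α (Finset.mem_univ _)))
  set K : Set (Euc n × (Fin M → ℂ)) := sphere 0 1 ×ˢ sphere 0 1
  have hK : IsCompact K := (isCompact_sphere _ _).prod (isCompact_sphere _ _)
  have hscale : ∀ (ξ : Euc n) (v : Fin M → ℂ) (s t : ℝ), G (s • ξ, t • v) = |s| * |t| * G (ξ, v) := by
    intro ξ v s t
    simp only [hG, Finset.mul_sum]
    refine Finset.sum_congr rfl fun α _ => ?_
    have : ∑ β : Fin M, (∑ j : Fin n, a j α β * ((s • ξ) j : ℂ)) * (t • v) β =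
      ((s * t : ℝ) : ℂ) * ∑ β : Fin M, (∑ j : Fin n, a j α β * (ξ j : ℂ)) * v β := by
      simp only [Finset.mul_sum, Finset.sum_mul]
      refine Finset.sum_congr rfl fun β _ => Finset.sum_congr rfl fun j _ => ?_
      simp; ring
    simp only [this, norm_mul, Complex.norm_real, Real.norm_eq_abs]
  have hmin : ∃ c > 0, ∀ q ∈ K, c ≤ G q := by
    rcases K.eq_empty_or_nonempty with h | h
    · exact ⟨1, one_pos, by simp [h]⟩
    · obtain ⟨q, hq, hm⟩ := hK.exists_isMinOn h hGc.continuousOn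
      refine ⟨G q, hpos q ?_ ?_, fun q' hq' => hm hq'⟩
      · exact ne_zero_of_mem_unit_sphere (⟨q.1, hq.1⟩ : sphere (0 : Euc n) 1)
      · exact ne_zero_of_mem_unit_sphere (⟨q.2, hq.2⟩ : sphere (0 : Fin M → ℂ) 1)
  obtain ⟨c, hc, hcK⟩ := hmin
  refine ⟨c, hc, fun ξ v => ?_⟩
  show c * ‖ξ‖ * ‖v‖ ≤ G (ξ, v)
  by_cases h1 : ξ = 0
  · simp [h1, hG]
  by_cases h2 : v = 0
  · simp [h2, hG]
  have h1' := norm_pos_iff.2 h1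
  have h2' := norm_pos_iff.2 h2
  have := hcK (‖ξ‖⁻¹ • ξ, ‖v‖⁻¹ • v) ⟨by simp [norm_smul, h1'.ne'], by simp [norm_smul, h2'.ne']⟩
  rw [hscale, abs_of_pos (inv_pos.2 h1'), abs_of_pos (inv_pos.2 h2')] at this
  calc c * ‖ξ‖ * ‖v‖ ≤ (‖ξ‖⁻¹ * ‖v‖⁻¹ * G (ξ, v)) * ‖ξ‖ * ‖v‖ := by gcongr
    _ = G (ξ, v) := by field_simp

theorem IsTest.pd {U : Set (Euc n)} {φ : Euc n → ℝ} (h : IsTest U φ) (j : Fin n) : IsTest U (pd j φ) := by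
  have h1 : tsupport (_root_.pd j φ) ⊆ tsupport φ := by
    have := tsupport_fderiv_subset ℝ (f := φ)
    refine (closure_mono ?_).trans this
    intro x hx hx'
    apply hx
    simp [_root_.pd, hx']
  refine ⟨?_, h.cpt.mono' (subset_closure.trans h1), h1.trans h.supp⟩
  exact (h.smooth.fderiv_right (m := (⊤ : ℕ∞)) (by simp)).clm_apply contDiff_const

theorem IsTest.mono {U V : Set (Euc n)} {φ : Euc n → ℝ} (h : IsTest U φ) (hUV : U ⊆ V) : IsTest V φ :=
  ⟨h.smooth, h.cpt, h.supp.trans hUV⟩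

theorem IsTest.mul_smooth {U : Set (Euc n)} {φ g : Euc n → ℝ} (h : IsTest U φ)
    (hg : ContDiff ℝ (⊤ : ℕ∞) g) : IsTest U (fun x => φ x * g x) :=
  ⟨h.smooth.mul hg, h.cpt.mul_right, (tsupport_mul_subset_left).trans h.supp⟩

theorem IsTest.bdd {U : Set (Euc n)} {φ : Euc n → ℝ} (h : IsTest U φ) : ∃ B, 0 ≤ B ∧ ∀ x, |φ x| ≤ B := by
  obtain ⟨B, hB⟩ := h.smooth.continuous.bounded_above_of_compact_support h.cpt
  exact ⟨max B 0, le_max_right _ _, fun x => (hB x).trans (le_max_left _ _)⟩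

/-- the localized Fourier transform -/
def FA (η : Euc n → ℝ) (X : Fin M → Euc n → ℂ) (ξ : Euc n) : Fin M → ℂ := fun β =>
  ∫ x, (Complex.exp (-(2 * Real.pi * inner ℝ x ξ : ℝ) * Complex.I) * (η x : ℂ)) * X β x

theorem integrable_test_mul {g : Euc n → ℂ} (hg : Continuous g) (hgc : HasCompactSupport g)
    {X : Euc n → ℂ} (hX : AEStronglyMeasurable X volume) {Λ : ℝ} (hb : ∀ᵐ x, ‖X x‖ ≤ Λ) :
    Integrable (fun x => g x * X x) volume :=
  (hg.integrable_of_hasCompactSupport hgc).mul_bdd hX hb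

theorem FA_step (a : Fin n → Fin N → Fin M → ℂ) {η : Euc n → ℝ} (hη : IsTest (ball 0 1) η)
    {X : Fin M → Euc n → ℂ} (hX : ∀ β, AEStronglyMeasurable (X β) volume) {Λ ε B : ℝ}
    (hb : ∀ β, ∀ᵐ x, ‖X β x‖ ≤ Λ) (hD : SmallD a X 0 1 ε) (hB : ∀ x, |η x| ≤ B) (ξ : Euc n) (α : Fin N) :
    ‖∑ β, (∑ j, a j α β * (ξ j : ℂ)) * FA η X ξ β‖ ≤
      2 * (ε * B) + ∑ j, ∑ β, ‖a j α β‖ * ‖FA (pd j η) X ξ β‖ := by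
  set ct : Euc n → ℝ := fun x => Real.cos (2 * Real.pi * inner ℝ x ξ) with hct
  set st : Euc n → ℝ := fun x => Real.sin (2 * Real.pi * inner ℝ x ξ) with hst
  have hin : ContDiff ℝ (⊤ : ℕ∞) (fun x : Euc n => 2 * Real.pi * inner ℝ x ξ) :=
    contDiff_const.mul (contDiff_id.inner ℝ contDiff_const)
  have hcs : ContDiff ℝ (⊤ : ℕ∞) ct := Real.contDiff_cos.comp hin
  have hss : ContDiff ℝ (⊤ : ℕ∞) st := Real.contDiff_sin.comp hin
  have t1 := hη.mul_smooth hcs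
  have t2 := hη.mul_smooth hss
  have hin' : ∀ x : Euc n, HasFDerivAt (fun x : Euc n => 2 * Real.pi * inner ℝ x ξ)
      ((2 * Real.pi) • (innerSL ℝ ξ)) x := by
    intro x
    have := ((innerSL ℝ ξ).hasFDerivAt (x := x)).const_smul (2 * Real.pi)
    refine this.congr_of_eventuallyEq (Eventually.of_forall fun y => ?_)
    simp [real_inner_comm]
  have hηd : ∀ x, HasFDerivAt η (fderiv ℝ η x) x := fun x =>
    (hη.smooth.differentiable (by simp) x).hasFDerivAt
  have d1 : ∀ j x, pd j (fun x => η x * ct x) x = pd j η x * ct x - 2 * Real.pi * ξ j * (η x * st x) := by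
    intro j x
    have := (hηd x).mul ((hin' x).cos)
    unfold pd
    rw [show (fun x => η x * ct x) = η * ct from rfl, HasFDerivAt.fderiv this]
    simp [hct, hst, real_inner_comm, EuclideanSpace.inner_single_left, EuclideanSpace.inner_single_right]
    ring
  have d2 : ∀ j x, pd j (fun x => η x * st x) x = pd j η x * st x + 2 * Real.pi * ξ j * (η x * ct x) := by
    intro j x
    have := (hηd x).mul ((hin' x).sin)
    unfold pd
    rw [show (fun x => η x * st x) = η * st from rfl, HasFDerivAt.fderiv this]
    simp [hct, hst, real_inner_comm, EuclideanSpace.inner_single_left, EuclideanSpace.inner_single_right]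
    ring
  have hexp : ∀ x : Euc n, Complex.exp (-(2 * Real.pi * inner ℝ x ξ : ℝ) * Complex.I) =
      (ct x : ℂ) - Complex.I * (st x : ℂ) := by
    intro x
    rw [Complex.exp_mul_I, Complex.cos_neg, Complex.sin_neg, hct, hst]
    simp only [Complex.ofReal_cos, Complex.ofReal_sin]; ring
  have hI : ∀ (φ : Euc n → ℝ), IsTest (ball 0 1) φ → ∀ β, Integrable (fun x => (φ x : ℂ) * X β x) := by
    intro φ hφ β
    refine integrable_test_mul (by have := hφ.smooth.continuous; fun_prop) ?_ (hX β) (hb β)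
    exact hφ.cpt.comp_left (g := fun t : ℝ => (t : ℂ)) (by simp)
  have hFA : ∀ φ, IsTest (ball 0 1) φ → ∀ β, FA φ X ξ β =
      (∫ x, ((φ x * ct x : ℝ) : ℂ) * X β x) - Complex.I * ∫ x, ((φ x * st x : ℝ) : ℂ) * X β x := by
    intro φ hφ β
    rw [← integral_const_mul, ← integral_sub (hI _ (hφ.mul_smooth hcs) β)
      ((hI _ (hφ.mul_smooth hss) β).const_mul _)]
    refine integral_congr_ae (Eventually.of_forall fun x => ?_)
    simp only [hexp]; push_cast; ring
  have i1 : ∀ j β, ∫ x, (pd j (fun x => η x * ct x) x : ℂ) * X β x =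
      (∫ x, ((pd j η x * ct x : ℝ) : ℂ) * X β x) - 2 * Real.pi * ξ j * ∫ x, ((η x * st x : ℝ) : ℂ) * X β x := by
    intro j β
    rw [← integral_const_mul, ← integral_sub (hI _ ((hη.pd j).mul_smooth hcs) β)
      ((hI _ (hη.mul_smooth hss) β).const_mul _)]
    refine integral_congr_ae (Eventually.of_forall fun x => ?_)
    simp only [d1]; push_cast; ring
  have i2 : ∀ j β, ∫ x, (pd j (fun x => η x * st x) x : ℂ) * X β x =
      (∫ x, ((pd j η x * st x : ℝ) : ℂ) * X β x) + 2 * Real.pi * ξ j * ∫ x, ((η x * ct x : ℝ) : ℂ) * X β x := by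
    intro j β
    rw [← integral_const_mul, ← integral_add (hI _ ((hη.pd j).mul_smooth hss) β)
      ((hI _ (hη.mul_smooth hcs) β).const_mul _)]
    refine integral_congr_ae (Eventually.of_forall fun x => ?_)
    simp only [d2]; push_cast; ring
  have key : (2 * Real.pi * Complex.I) * ∑ β, (∑ j, a j α β * (ξ j : ℂ)) * FA η X ξ β =
      (∑ j, ∑ β, a j α β * FA (pd j η) X ξ β) -
      (PD a X (fun x => η x * ct x) α - Complex.I * PD a X (fun x => η x * st x) α) := by
    unfold PD
    simp only [i1, i2, Finset.mul_sum, Finset.sum_mul]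
    rw [← Finset.sum_sub_distrib, ← Finset.sum_sub_distrib, Finset.sum_comm]
    refine Finset.sum_congr rfl fun j _ => ?_
    rw [← Finset.sum_sub_distrib, ← Finset.sum_sub_distrib]
    refine Finset.sum_congr rfl fun β _ => ?_
    rw [hFA _ hη, hFA _ (hη.pd j)]
    linear_combination (-2 * Real.pi * a j α β * ξ j * ∫ x, ((η x * st x : ℝ) : ℂ) * X β x) * Complex.I_sq
  have b1 := hD _ t1 B (fun x => by
    rw [abs_mul]; exact (mul_le_of_le_one_right (abs_nonneg _) (Real.abs_cos_le_one _)).trans (hB x)) α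
  have b2 := hD _ t2 B (fun x => by
    rw [abs_mul]; exact (mul_le_of_le_one_right (abs_nonneg _) (Real.abs_sin_le_one _)).trans (hB x)) α
  have hpi : 1 ≤ ‖(2 * Real.pi * Complex.I : ℂ)‖ := by
    simp [abs_of_pos Real.pi_pos]; linarith [Real.pi_gt_three]
  calc _ ≤ ‖(2 * Real.pi * Complex.I : ℂ)‖ * ‖∑ β, (∑ j, a j α β * (ξ j : ℂ)) * FA η X ξ β‖ :=
        le_mul_of_one_le_left (norm_nonneg _) hpi
    _ = _ := by rw [← norm_mul, key]
    _ ≤ (∑ j, ∑ β, ‖a j α β‖ * ‖FA (pd j η) X ξ β‖) + (ε * B + ε * B) := by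
        refine (norm_sub_le _ _).trans (add_le_add ?_ ((norm_sub_le _ _).trans (add_le_add b1 (by simpa using b2))))
        refine (norm_sum_le _ _).trans (Finset.sum_le_sum fun j _ => ?_)
        refine (norm_sum_le _ _).trans (Finset.sum_le_sum fun β _ => (norm_mul _ _).le)
    _ = _ := by ring

end

open MeasureTheory Metric Set Filter
open scoped ENNReal NNReal Topology

noncomputable section
variable {n N M : ℕ}

/-- Standing data for a bounded approximately-null field on the unit ball. -/
structure NearNull (a : Fin n → Fin N → Fin M → ℂ) (X : Fin M → Euc n → ℂ) (Λ ε : ℝ) (x₀ : Euc n)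
    (r : ℝ) : Prop where
  meas : ∀ β, AEStronglyMeasurable (X β) volume
  Lnn : 0 ≤ Λ
  enn : 0 ≤ ε
  bound : ∀ β, ∀ᵐ x, ‖X β x‖ ≤ Λ
  small : SmallD a X x₀ r ε

theorem FA_bound {η : Euc n → ℝ} (hη : IsTest (ball 0 1) η)
    {X : Fin M → Euc n → ℂ} {Λ : ℝ} (hΛ : 0 ≤ Λ)
    (hb : ∀ β, ∀ᵐ x, ‖X β x‖ ≤ Λ) (ξ : Euc n) : ‖FA η X ξ‖ ≤ (∫ x, |η x|) * Λ := by
  refine (pi_norm_le_iff_of_nonneg (by positivity)).2 fun β => ?_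
  rw [← integral_mul_const]
  refine norm_integral_le_of_norm_le
    ((hη.smooth.continuous.integrable_of_hasCompactSupport hη.cpt).abs.mul_const _) ?_
  filter_upwards [hb β] with x hx
  rw [norm_mul, norm_mul, ← Complex.ofReal_neg, Complex.norm_exp_ofReal_mul_I, one_mul, Complex.norm_real]
  exact mul_le_mul_of_nonneg_left hx (abs_nonneg _)

theorem FA_decay (a : Fin n → Fin N → Fin M → ℂ) {c : ℝ} (hc : 0 < c)
    (hlow : ∀ (ξ : Euc n) (v : Fin M → ℂ), c * ‖ξ‖ * ‖v‖ ≤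
      ∑ α, ‖∑ β : Fin M, (∑ j : Fin n, a j α β * (ξ j : ℂ)) * v β‖) (k : ℕ) :
    ∀ η : Euc n → ℝ, IsTest (ball 0 1) η → ∃ C, 0 ≤ C ∧ ∀ X Λ ε, NearNull a X Λ ε 0 1 →
      ∀ ξ, ‖ξ‖ ^ k * ‖FA η X ξ‖ ≤ C * (Λ + ε * (1 + ‖ξ‖) ^ k) := by
  induction k with
  | zero =>
    intro η hη
    refine ⟨∫ x, |η x|, integral_nonneg fun _ => abs_nonneg _, fun X Λ ε h ξ => ?_⟩
    have := FA_bound hη h.Lnn h.bound ξ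
    have h2 := integral_nonneg (μ := volume) (f := fun x => |η x|) fun _ => abs_nonneg _
    have h3 := h.enn
    simp only [pow_zero, one_mul, mul_one]
    refine this.trans ?_
    gcongr
    linarith
  | succ k ih =>
    intro η hη
    obtain ⟨B, hB0, hB⟩ := hη.bdd
    choose C hC0 hC using fun j => ih (pd j η) (hη.pd j)
    set A : ℝ := ∑ α, ∑ j, ∑ β, ‖a j α β‖ * C j with hA
    have hA0 : 0 ≤ A := Finset.sum_nonneg fun α _ => Finset.sum_nonneg fun j _ =>
      Finset.sum_nonneg fun β _ => mul_nonneg (norm_nonneg _) (hC0 j)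
    refine ⟨(2 * N * B + A) / c, by positivity, fun X Λ ε h ξ => ?_⟩
    have hL := h.Lnn
    have he := h.enn
    set P := Λ + ε * (1 + ‖ξ‖) ^ k with hP
    have h1 : c * ‖ξ‖ * ‖FA η X ξ‖ ≤ ∑ α : Fin N, (2 * (ε * B) + ∑ j, ∑ β, ‖a j α β‖ * ‖FA (pd j η) X ξ β‖) :=
      (hlow ξ _).trans (Finset.sum_le_sum fun α _ => FA_step a hη h.meas h.bound h.small hB ξ α)
    have h2 : ‖ξ‖ ^ k * ∑ α : Fin N, (2 * (ε * B) + ∑ j, ∑ β, ‖a j α β‖ * ‖FA (pd j η) X ξ β‖) ≤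
        2 * N * B * (ε * ‖ξ‖ ^ k) + A * P := by
      have h3 : ‖ξ‖ ^ k * ∑ α : Fin N, (2 * (ε * B) + ∑ j, ∑ β, ‖a j α β‖ * ‖FA (pd j η) X ξ β‖) =
        2 * N * B * (ε * ‖ξ‖ ^ k) + ∑ α, ∑ j, ∑ β, ‖a j α β‖ * (‖ξ‖ ^ k * ‖FA (pd j η) X ξ β‖) := by
        rw [Finset.sum_add_distrib, mul_add]
        congr 1
        · simp; ring
        · simp only [Finset.mul_sum]
          exact Finset.sum_congr rfl fun _ _ => Finset.sum_congr rfl fun _ _ =>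
            Finset.sum_congr rfl fun _ _ => by ring
      rw [h3]
      gcongr
      rw [hA]; simp only [Finset.sum_mul]
      refine Finset.sum_le_sum fun α _ => Finset.sum_le_sum fun j _ => Finset.sum_le_sum fun β _ => ?_
      rw [mul_assoc]
      refine mul_le_mul_of_nonneg_left ?_ (norm_nonneg _)
      exact (mul_le_mul_of_nonneg_left (norm_le_pi_norm _ β) (by positivity)).trans (hC j X Λ ε h ξ)
    have h4 : ε * ‖ξ‖ ^ k ≤ Λ + ε * (1 + ‖ξ‖) ^ (k + 1) := by
      have : ‖ξ‖ ^ k ≤ (1 + ‖ξ‖) ^ (k + 1) := by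
        calc ‖ξ‖ ^ k ≤ (1 + ‖ξ‖) ^ k := by gcongr; linarith
          _ ≤ _ := pow_le_pow_right₀ (by linarith [norm_nonneg ξ]) (by simp)
      nlinarith [mul_le_mul_of_nonneg_left this he]
    have h5 : P ≤ Λ + ε * (1 + ‖ξ‖) ^ (k + 1) := by
      have : (1 + ‖ξ‖) ^ k ≤ (1 + ‖ξ‖) ^ (k + 1) :=
        pow_le_pow_right₀ (by linarith [norm_nonneg ξ]) (by simp)
      rw [hP]; gcongr
    rw [div_mul_eq_mul_div, le_div_iff₀ hc]
    calc _ = ‖ξ‖ ^ k * (c * ‖ξ‖ * ‖FA η X ξ‖) := by ring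
      _ ≤ _ := mul_le_mul_of_nonneg_left h1 (by positivity)
      _ ≤ _ := h2
      _ ≤ 2 * N * B * (Λ + ε * (1 + ‖ξ‖) ^ (k + 1)) + A * (Λ + ε * (1 + ‖ξ‖) ^ (k + 1)) := by gcongr
      _ = _ := by ring

theorem FA_decay' (a : Fin n → Fin N → Fin M → ℂ) {c : ℝ} (hc : 0 < c)
    (hlow : ∀ (ξ : Euc n) (v : Fin M → ℂ), c * ‖ξ‖ * ‖v‖ ≤
      ∑ α, ‖∑ β : Fin M, (∑ j : Fin n, a j α β * (ξ j : ℂ)) * v β‖) (k : ℕ)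
    {η : Euc n → ℝ} (hη : IsTest (ball 0 1) η) : ∃ C, 0 ≤ C ∧ ∀ X Λ ε, NearNull a X Λ ε 0 1 →
      ∀ ξ, ‖FA η X ξ‖ ≤ C * (Λ * ((1 + ‖ξ‖) ^ k)⁻¹ + ε) := by
  obtain ⟨C0, h0, hC0⟩ := FA_decay a hc hlow 0 η hη
  obtain ⟨C1, h1, hC1⟩ := FA_decay a hc hlow k η hη
  refine ⟨2 ^ k * (C0 + C1), by positivity, fun X Λ ε h ξ => ?_⟩
  have hL := h.Lnn
  have he := h.enn
  have a0 := hC0 X Λ ε h ξ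
  have a1 := hC1 X Λ ε h ξ
  have hx := norm_nonneg ξ
  set t := ‖ξ‖
  have hp : 0 < (1 + t) ^ k := by positivity
  have h2 : (1 + t) ^ k ≤ 2 ^ k * (1 + t ^ k) := by
    rcases le_total t 1 with h | h
    · calc (1 + t) ^ k ≤ 2 ^ k := by gcongr; linarith
        _ ≤ _ := le_mul_of_one_le_right (by positivity) (by have := pow_nonneg hx k; linarith)
    · calc (1 + t) ^ k ≤ (2 * t) ^ k := by gcongr; linarith
        _ = 2 ^ k * t ^ k := mul_pow _ _ _
        _ ≤ _ := by gcongr; linarith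
  have h3 : 1 ≤ (1 + t) ^ k := one_le_pow₀ (by linarith)
  simp only [pow_zero, one_mul, mul_one] at a0
  have h4 : C0 * (Λ + ε) ≤ C0 * (Λ + ε * (1 + t) ^ k) := by
    gcongr; exact le_mul_of_one_le_right he h3
  have h5 : (1 + t) ^ k * ‖FA η X ξ‖ ≤ 2 ^ k * (C0 + C1) * (Λ + ε * (1 + t) ^ k) := by
    calc _ ≤ 2 ^ k * (1 + t ^ k) * ‖FA η X ξ‖ := by gcongr
      _ = 2 ^ k * (‖FA η X ξ‖ + t ^ k * ‖FA η X ξ‖) := by ring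
      _ ≤ 2 ^ k * (C0 * (Λ + ε * (1 + t) ^ k) + C1 * (Λ + ε * (1 + t) ^ k)) := by
        gcongr; linarith
      _ = _ := by ring
  calc ‖FA η X ξ‖ = ((1 + t) ^ k)⁻¹ * ((1 + t) ^ k * ‖FA η X ξ‖) := by field_simp
    _ ≤ ((1 + t) ^ k)⁻¹ * (2 ^ k * (C0 + C1) * (Λ + ε * (1 + t) ^ k)) := by gcongr
    _ = _ := by field_simp

/-- mollified average -/
def Avg {F : Type*} [NormedAddCommGroup F] [NormedSpace ℝ F] (b : Euc n → ℝ) (X : Euc n → F)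
    (y : Euc n) (s : ℝ) : F :=
  ∫ z, b z • X (y + s • z)

theorem integral_affine {F : Type*} [NormedAddCommGroup F] [NormedSpace ℝ F] (g : Euc n → F)
    (y : Euc n) {s : ℝ} (hs : 0 < s) : ∫ x, g x = s ^ n • ∫ z, g (y + s • z) := by
  have h1 := Measure.integral_comp_smul_of_nonneg (volume : Measure (Euc n)) (fun x => g (y + x)) s
    (hR := hs.le)
  rw [h1, integral_add_left_eq_self (μ := volume) g y, smul_smul]
  simp [mul_inv_cancel₀ (pow_pos hs n).ne']

/-- rescaled bump -/
def bmp (b : Euc n → ℝ) (y : Euc n) (s : ℝ) (x : Euc n) : ℝ := (s ^ n)⁻¹ * b (s⁻¹ • (x - y))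

theorem Avg_eq {F : Type*} [NormedAddCommGroup F] [NormedSpace ℝ F] (b : Euc n → ℝ) (X : Euc n → F)
    (y : Euc n) {s : ℝ} (hs : 0 < s) : Avg b X y s = ∫ x, bmp b y s x • X x := by
  rw [integral_affine _ y hs, ← integral_smul]
  refine integral_congr_ae (Eventually.of_forall fun z => ?_)
  simp only [bmp, smul_smul, add_sub_cancel_left, inv_mul_cancel₀ hs.ne', one_smul]
  rw [← mul_assoc, mul_inv_cancel₀ (pow_pos hs n).ne', one_mul]

theorem bmp_test {b : Euc n → ℝ} (hb : IsTest (ball 0 1) b) (y : Euc n) {s : ℝ} (hs : 0 < s) :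
    IsTest (ball y s) (bmp b y s) := by
  have hcd : ContDiff ℝ (⊤ : ℕ∞) (fun x : Euc n => s⁻¹ • (x - y)) :=
    (contDiff_id.sub contDiff_const).const_smul _
  set K := (fun z : Euc n => y + s • z) '' tsupport b
  have hK : IsCompact K := hb.cpt.image (by fun_prop)
  have hsub : Function.support (bmp b y s) ⊆ K := by
    intro x hx
    refine ⟨s⁻¹ • (x - y), subset_closure fun h => hx (by simp [bmp, h]), ?_⟩
    simp [smul_smul, mul_inv_cancel₀ hs.ne']
  refine ⟨contDiff_const.mul (hb.smooth.comp hcd), HasCompactSupport.of_support_subset_isCompact hK hsub,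
    (closure_minimal hsub hK.isClosed).trans ?_⟩
  rintro _ ⟨z, hz, rfl⟩
  have := hb.supp hz
  simp only [mem_ball, sub_zero, dist_eq_norm, add_sub_cancel_left, norm_smul, Real.norm_eq_abs,
    abs_of_pos hs] at this ⊢
  nlinarith

end

open MeasureTheory Metric Set Filter
open scoped ENNReal NNReal Topology

noncomputable section
variable {n N M : ℕ}

/-- inverse Fourier transform of the rescaled bump -/
def HB (b : Euc n → ℝ) (y : Euc n) (s : ℝ) (ξ : Euc n) : ℂ :=
  ∫ z, Complex.exp ((2 * Real.pi * inner ℝ (y + s • z) ξ : ℝ) * Complex.I) * (b z : ℂ)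

theorem HB_facts {b : Euc n → ℝ} (hb : IsTest (ball 0 1) b) (y : Euc n) {s : ℝ} (hs : 0 < s) :
    Integrable (HB b y s) ∧ ∀ f : Euc n → ℂ, Integrable f →
      ∫ x, (bmp b y s x : ℂ) * f x =
        ∫ ξ, (∫ x, Complex.exp (-(2 * Real.pi * inner ℝ x ξ : ℝ) * Complex.I) * f x) * HB b y s ξ := by
  have ht := bmp_test hb y hs
  set ψ : Euc n → ℂ := fun x => (bmp b y s x : ℂ) with hψ
  have hψc : HasCompactSupport ψ := ht.cpt.comp_left (g := fun t : ℝ => (t : ℂ)) (by simp)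
  have hψs : ContDiff ℝ (⊤ : ℕ∞) ψ := Complex.ofRealCLM.contDiff.comp ht.smooth
  set Ψ : SchwartzMap (Euc n) ℂ := hψc.toSchwartzMap hψs with hΨ
  have hcoe : (Ψ : Euc n → ℂ) = ψ := rfl
  have hHB : HB b y s = (FourierTransformInv.fourierInv Ψ : SchwartzMap (Euc n) ℂ) := by
    rw [SchwartzMap.fourierInv_coe]
    ext ξ
    rw [Real.fourierInv_eq', integral_affine _ y hs, ← integral_smul, HB]
    refine integral_congr_ae (Eventually.of_forall fun z => ?_)
    simp only [hcoe, hψ, bmp, smul_smul, add_sub_cancel_left, inv_mul_cancel₀ hs.ne', one_smul]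
    rw [Complex.real_smul, smul_eq_mul]
    have : ((s : ℂ) ^ n) ≠ 0 := by exact_mod_cast (pow_pos hs n).ne'
    push_cast
    field_simp
  refine ⟨hHB ▸ SchwartzMap.integrable _, fun f hf => ?_⟩
  have hI : Integrable (HB b y s) := hHB ▸ SchwartzMap.integrable _
  have h1 := VectorFourier.integral_fourierIntegral_smul_eq_flip (μ := volume) (ν := volume)
    (e := Real.fourierChar) (L := innerₗ (Euc n)) Real.continuous_fourierChar
    (by exact continuous_inner) hf hI
  have h2 : VectorFourier.fourierIntegral Real.fourierChar volume (innerₗ (Euc n)).flip (HB b y s) = ψ := by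
    rw [flip_innerₗ ]
    have : FourierTransform.fourier (FourierTransformInv.fourierInv Ψ) = Ψ :=
      FourierTransform.fourier_fourierInv_eq Ψ
    have h3 : (FourierTransform.fourier (FourierTransformInv.fourierInv Ψ) : SchwartzMap (Euc n) ℂ) = ψ := by
      rw [this, hcoe]
    rw [SchwartzMap.fourier_coe, ← hHB] at h3
    exact h3
  rw [h2] at h1
  simp only [smul_eq_mul] at h1
  rw [show ∫ x, (bmp b y s x : ℂ) * f x = ∫ x, f x * ψ x from by
    refine integral_congr_ae (Eventually.of_forall fun z => mul_comm _ _), ← h1]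
  refine integral_congr_ae (Eventually.of_forall fun ξ => ?_)
  have := Real.fourier_eq' f ξ
  simp only
  congr 1
  refine this.trans (integral_congr_ae (Eventually.of_forall fun x => ?_))
  simp

theorem HB_zero {b : Euc n → ℝ} (y : Euc n) (s : ℝ) (ξ : Euc n) :
    ‖HB b y s ξ‖ = ‖HB b 0 1 (s • ξ)‖ := by
  have : HB b y s ξ = Complex.exp ((2 * Real.pi * inner ℝ y ξ : ℝ) * Complex.I) * HB b 0 1 (s • ξ) := by
    unfold HB
    rw [← integral_const_mul]
    refine integral_congr_ae (Eventually.of_forall fun z => ?_)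
    simp only [inner_add_left, inner_smul_left, inner_smul_right, zero_add, one_smul]
    rw [← mul_assoc, ← Complex.exp_add]
    congr 2
    simp; ring
  rw [this, norm_mul, Complex.norm_exp_ofReal_mul_I, one_mul]

theorem HB_L1 {b : Euc n → ℝ} (y : Euc n) {s : ℝ} (hs : 0 < s) :
    ∫ ξ, ‖HB b y s ξ‖ = (s ^ n)⁻¹ * ∫ ξ, ‖HB b 0 1 ξ‖ := by
  simp only [HB_zero y s]
  rw [Measure.integral_comp_smul_of_nonneg (volume : Measure (Euc n)) (fun ξ => ‖HB b 0 1 ξ‖) s (hR := hs.le)]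
  simp

theorem HB_diff {b : Euc n → ℝ} (hb : IsTest (ball 0 1) b) (y y' : Euc n) (s s' : ℝ) (ξ : Euc n) :
    ‖HB b y s ξ - HB b y' s' ξ‖ ≤ (2 * Real.pi * ‖ξ‖ * (‖y - y'‖ + |s - s'|)) * ∫ z, |b z| := by
  have hbi : Integrable b := hb.smooth.continuous.integrable_of_hasCompactSupport hb.cpt
  have hI : ∀ (y : Euc n) (s : ℝ), Integrable fun z =>
      Complex.exp ((2 * Real.pi * inner ℝ (y + s • z) ξ : ℝ) * Complex.I) * (b z : ℂ) := by
    intro y s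
    refine hbi.ofReal.bdd_mul (c := 1) (by fun_prop) (Eventually.of_forall fun z => ?_)
    rw [Complex.norm_exp_ofReal_mul_I]
  unfold HB
  rw [← integral_sub (hI _ _) (hI _ _), ← integral_const_mul]
  refine norm_integral_le_of_norm_le (hbi.abs.const_mul _) (Eventually.of_forall fun z => ?_)
  rw [← sub_mul, norm_mul, Complex.norm_real, Real.norm_eq_abs]
  by_cases hz : z ∈ ball (0 : Euc n) 1
  · refine mul_le_mul_of_nonneg_right ?_ (abs_nonneg _)
    set A := 2 * Real.pi * inner ℝ (y + s • z) ξ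
    set A' := 2 * Real.pi * inner ℝ (y' + s' • z) ξ
    have h1 : Complex.exp ((A : ℝ) * Complex.I) - Complex.exp ((A' : ℝ) * Complex.I) =
        Complex.exp ((A' : ℝ) * Complex.I) * (Complex.exp (Complex.I * ((A - A' : ℝ) : ℂ)) - 1) := by
      rw [mul_sub, ← Complex.exp_add]; congr 2
      · push_cast; ring
      · ring
    rw [h1, norm_mul, Complex.norm_exp_ofReal_mul_I, one_mul]
    refine (Real.norm_exp_I_mul_ofReal_sub_one_le).trans ?_
    have h2 : A - A' = 2 * Real.pi * inner ℝ ((y - y') + (s - s') • z) ξ := by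
      simp only [A, A', inner_add_left, inner_sub_left, inner_smul_left]; simp; ring
    rw [h2, norm_mul, Real.norm_eq_abs, abs_of_pos (by positivity), mul_assoc (2 * Real.pi)]
    refine mul_le_mul_of_nonneg_left ?_ (by positivity)
    refine (norm_inner_le_norm _ _).trans ?_
    rw [mul_comm]
    refine mul_le_mul_of_nonneg_left ((norm_add_le _ _).trans ?_) (norm_nonneg _)
    rw [norm_smul, Real.norm_eq_abs]
    simp only [mem_ball, dist_zero_right] at hz
    have := abs_nonneg (s - s')
    nlinarith
  · have : b z = 0 := image_eq_zero_of_notMem_tsupport fun h => hz (hb.supp h)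
    simp [this]

theorem exists_cut (n : ℕ) : ∃ η : Euc n → ℝ, IsTest (ball 0 1) η ∧ (∀ x, ‖x‖ ≤ 1/2 → η x = 1) := by
  let f : ContDiffBump (0 : Euc n) := ⟨1/2, 3/4, by norm_num, by norm_num⟩
  refine ⟨f, ⟨f.contDiff, f.hasCompactSupport, ?_⟩, fun x hx => f.one_of_mem_closedBall (by simpa [f] using hx)⟩
  rw [f.tsupport_eq]
  exact closedBall_subset_ball (by norm_num)

/-- unit-scale interior estimate with error -/
theorem interior_unit (a : Fin n → Fin N → Fin M → ℂ)
    (hell : ∀ ξ : Euc n, ξ ≠ 0 → ∀ v : Fin M → ℂ,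
      (∀ α : Fin N, ∑ β : Fin M, (∑ j : Fin n, a j α β * (ξ j : ℂ)) * v β = 0) → v = 0)
    {b : Euc n → ℝ} (hb : IsTest (ball 0 1) b) :
    ∃ C, 0 ≤ C ∧ ∀ X Λ ε, NearNull a X Λ ε 0 1 → ∀ (y y' : Euc n) (s s' : ℝ), 0 < s → 0 < s' →
      ‖y‖ + s ≤ 1/2 → ‖y'‖ + s' ≤ 1/2 → ∀ β,
      ‖Avg b (X β) y s - Avg b (X β) y' s'‖ ≤
        C * (Λ * (‖y - y'‖ + |s - s'|) + ε * ((s ^ n)⁻¹ + (s' ^ n)⁻¹)) := by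
  obtain ⟨c, hc, hlow⟩ := symbol_lower a hell
  obtain ⟨η, hη, hη1⟩ := exists_cut n
  obtain ⟨C, hC0, hC⟩ := FA_decay' a hc hlow (n + 2) hη
  have hJ : Integrable (fun ξ : Euc n => ((1 + ‖ξ‖) ^ (n + 1))⁻¹) := by
    have := integrable_one_add_norm (E := Euc n) (μ := volume) (r := (n : ℝ) + 1) (by simp)
    refine this.congr (Eventually.of_forall fun ξ => ?_)
    have h0 : 0 ≤ 1 + ‖ξ‖ := by positivity
    simp only
    rw [Real.rpow_neg h0]
    congr 1
    exact_mod_cast Real.rpow_natCast (1 + ‖ξ‖) (n + 1)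
  set J := ∫ ξ : Euc n, ((1 + ‖ξ‖) ^ (n + 1))⁻¹ with hJd
  have hJ0 : 0 ≤ J := integral_nonneg fun ξ => by positivity
  set K1 := ∫ z, |b z| with hK1
  have hK10 : 0 ≤ K1 := integral_nonneg fun ξ => abs_nonneg _
  set K2 := ∫ ξ, ‖HB b 0 1 ξ‖ with hK2
  have hK20 : 0 ≤ K2 := integral_nonneg fun ξ => norm_nonneg _
  refine ⟨C * (2 * Real.pi * J * K1 + K2), by positivity, ?_⟩
  intro X Λ ε h y y' s s' hs hs' hys hys' β
  have hL := h.Lnn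
  have he := h.enn
  have hfi : Integrable (fun x => (η x : ℂ) * X β x) :=
    integrable_test_mul (by have := hη.smooth.continuous; fun_prop)
      (hη.cpt.comp_left (g := fun t : ℝ => (t : ℂ)) (by simp)) (h.meas β) (h.bound β)
  have hrep : ∀ (y : Euc n) (s : ℝ), 0 < s → ‖y‖ + s ≤ 1/2 → Avg b (X β) y s = ∫ ξ, FA η X ξ β * HB b y s ξ := by
    intro y s hs hys
    have h1 := (HB_facts hb y hs).2 _ hfi
    rw [Avg_eq _ _ _ hs]
    have h2 : ∫ x, bmp b y s x • X β x = ∫ x, (bmp b y s x : ℂ) * ((η x : ℂ) * X β x) := by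
      refine integral_congr_ae (Eventually.of_forall fun x => ?_)
      simp only [Complex.real_smul]
      by_cases hx : x ∈ ball y s
      · have : η x = 1 := hη1 x (by
          have h3 : ‖x - y‖ < s := by simpa [dist_eq_norm] using hx
          have := norm_add_le (x - y) y
          rw [sub_add_cancel] at this
          linarith)
        simp [this]
      · have : bmp b y s x = 0 := image_eq_zero_of_notMem_tsupport fun h => hx ((bmp_test hb y hs).supp h)
        simp [this]
    rw [h2, h1]
    refine integral_congr_ae (Eventually.of_forall fun x => ?_)
    simp only [FA, mul_assoc]
  have hi := (HB_facts hb y hs).1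
  have hi' := (HB_facts hb y' hs').1
  have hFAm : Continuous fun ξ => FA η X ξ β := by
    have := VectorFourier.fourierIntegral_continuous (V := Euc n) (W := Euc n) (μ := volume)
      (e := Real.fourierChar) (L := innerₗ (Euc n)) Real.continuous_fourierChar
      (by exact continuous_inner) hfi
    refine this.congr fun ξ => ?_
    have h3 := Real.fourier_eq' (fun x => (η x : ℂ) * X β x) ξ
    refine h3.trans (integral_congr_ae (Eventually.of_forall fun x => ?_))
    simp [mul_assoc]
  have hFAb : ∀ ξ, ‖FA η X ξ β‖ ≤ C * (Λ * ((1 + ‖ξ‖) ^ (n + 2))⁻¹ + ε) := fun ξ =>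
    (norm_le_pi_norm _ β).trans (hC X Λ ε h ξ)
  have hbig : ∀ ξ, ‖FA η X ξ β‖ ≤ C * (Λ + ε) := fun ξ => (hFAb ξ).trans (by
    gcongr
    refine mul_le_of_le_one_right hL (inv_le_one_of_one_le₀ (one_le_pow₀ (by linarith [norm_nonneg ξ]))))
  have hP : ∀ {g : Euc n → ℂ}, Integrable g → Integrable fun ξ => FA η X ξ β * g ξ := fun hg =>
    hg.bdd_mul (c := C * (Λ + ε)) hFAm.aestronglyMeasurable (Eventually.of_forall hbig)
  rw [hrep y s hs hys, hrep y' s' hs' hys', ← integral_sub (hP hi) (hP hi')]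
  set δ := ‖y - y'‖ + |s - s'| with hδ
  have hδ0 : 0 ≤ δ := by positivity
  calc _ ≤ ∫ ξ : Euc n, (C * (Λ * (2 * Real.pi * δ * K1)) * ((1 + ‖ξ‖) ^ (n + 1))⁻¹ +
        C * ε * (‖HB b y s ξ‖ + ‖HB b y' s' ξ‖)) := by
        refine norm_integral_le_of_norm_le ((hJ.const_mul _).add ((hi.norm.add hi'.norm).const_mul _))
          (Eventually.of_forall fun ξ => ?_)
        rw [← mul_sub, norm_mul]
        have e1 := HB_diff hb y y' s s' ξ
        have e2 := norm_sub_le (HB b y s ξ) (HB b y' s' ξ)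
        have e3 : ((1 + ‖ξ‖) ^ (n + 2))⁻¹ * ‖ξ‖ ≤ ((1 + ‖ξ‖) ^ (n + 1))⁻¹ := by
          rw [inv_mul_le_iff₀ (by positivity), pow_succ _ (n + 1), mul_comm ((1 + ‖ξ‖) ^ (n + 1)), mul_assoc,
            mul_inv_cancel₀ (by positivity)]
          linarith
        set Q := ‖HB b y s ξ - HB b y' s' ξ‖
        calc _ ≤ C * (Λ * ((1 + ‖ξ‖) ^ (n + 2))⁻¹ + ε) * Q :=
              mul_le_mul_of_nonneg_right (hFAb ξ) (norm_nonneg _)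
          _ = C * Λ * ((1 + ‖ξ‖) ^ (n + 2))⁻¹ * Q + C * ε * Q := by ring
          _ ≤ C * Λ * ((1 + ‖ξ‖) ^ (n + 2))⁻¹ * ((2 * Real.pi * ‖ξ‖ * δ) * K1) +
              C * ε * (‖HB b y s ξ‖ + ‖HB b y' s' ξ‖) := by gcongr
          _ = C * Λ * (2 * Real.pi * δ * K1) * (((1 + ‖ξ‖) ^ (n + 2))⁻¹ * ‖ξ‖) +
              C * ε * (‖HB b y s ξ‖ + ‖HB b y' s' ξ‖) := by ring
          _ ≤ C * Λ * (2 * Real.pi * δ * K1) * ((1 + ‖ξ‖) ^ (n + 1))⁻¹ +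
              C * ε * (‖HB b y s ξ‖ + ‖HB b y' s' ξ‖) := by gcongr
          _ = _ := by ring
    _ = C * (Λ * (2 * Real.pi * δ * K1)) * J + C * ε * (((s ^ n)⁻¹ + (s' ^ n)⁻¹) * K2) := by
        have hsum : Integrable (fun ξ => ‖HB b y s ξ‖ + ‖HB b y' s' ξ‖) := hi.norm.add hi'.norm
        rw [integral_add (hJ.const_mul _) (hsum.const_mul _), integral_const_mul,
          integral_const_mul, integral_add hi.norm hi'.norm, HB_L1 y hs, HB_L1 y' hs']
        ring
    _ ≤ _ := by
        have e1 : 0 ≤ C * K2 * (Λ * δ) := by positivity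
        have e2 : 0 ≤ C * (2 * Real.pi * J * K1) * (ε * ((s ^ n)⁻¹ + (s' ^ n)⁻¹)) := by positivity
        nlinarith

theorem pd_comp_affine {φ : Euc n → ℝ} (hφ : Differentiable ℝ φ) (x₀ : Euc n) (t : ℝ) (j : Fin n) (x : Euc n) :
    pd j (fun x => φ (t • (x - x₀))) x = t * pd j φ (t • (x - x₀)) := by
  have h1 : HasFDerivAt (fun x : Euc n => t • (x - x₀)) (t • ContinuousLinearMap.id ℝ (Euc n)) x :=
    ((hasFDerivAt_id x).sub_const x₀).const_smul t
  have h2 := ((hφ (t • (x - x₀))).hasFDerivAt).comp x h1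
  unfold pd
  rw [show (fun x => φ (t • (x - x₀))) = φ ∘ (fun x => t • (x - x₀)) from rfl, h2.fderiv]
  simp

theorem test_rescale {φ : Euc n → ℝ} (hφ : IsTest (ball 0 1) φ) (x₀ : Euc n) {r : ℝ} (hr : 0 < r) :
    IsTest (ball x₀ r) (fun x => φ (r⁻¹ • (x - x₀))) := by
  have := bmp_test hφ x₀ hr
  have h2 : (fun x => φ (r⁻¹ • (x - x₀))) = fun x => bmp φ x₀ r x * r ^ n := by
    ext x
    have : r ^ n ≠ 0 := (pow_pos hr n).ne'
    simp only [bmp]; field_simp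
  rw [h2]
  exact this.mul_smooth contDiff_const

theorem qmp_affine (x₀ : Euc n) {r : ℝ} (hr : 0 < r) :
    Measure.QuasiMeasurePreserving (fun z : Euc n => x₀ + r • z) volume volume := by
  have h1 : Measure.QuasiMeasurePreserving (fun z : Euc n => r • z) volume volume := by
    refine ⟨by fun_prop, ?_⟩
    rw [Measure.map_addHaar_smul _ hr.ne']
    exact Measure.smul_absolutelyContinuous
  exact (measurePreserving_add_left volume x₀).quasiMeasurePreserving.comp h1

theorem NearNull.rescale (hn : 1 ≤ n) {a : Fin n → Fin N → Fin M → ℂ} {X : Fin M → Euc n → ℂ} {Λ ε r : ℝ}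
    {x₀ : Euc n} (hr : 0 < r) (h : NearNull a X Λ (ε * r ^ (n - 1)) x₀ r) :
    NearNull a (fun β z => X β (x₀ + r • z)) Λ ε 0 1 := by
  have hq := qmp_affine x₀ hr
  have hrn : 0 < r ^ (n - 1) := by positivity
  refine ⟨fun β => (h.meas β).comp_quasiMeasurePreserving hq, h.Lnn, ?_, fun β => hq.ae (h.bound β), ?_⟩
  · exact nonneg_of_mul_nonneg_left h.enn hrn
  intro φ hφ B hB α
  have h1 := h.small _ (test_rescale hφ x₀ hr) B (fun x => hB _) α
  have h2 : PD a X (fun x => φ (r⁻¹ • (x - x₀))) α =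
      ((r ^ (n - 1) : ℝ) : ℂ) * PD a (fun β z => X β (x₀ + r • z)) φ α := by
    unfold PD
    simp only [Finset.mul_sum]
    refine Finset.sum_congr rfl fun j _ => Finset.sum_congr rfl fun β _ => ?_
    rw [integral_affine _ x₀ hr, mul_left_comm]
    congr 1
    rw [← integral_const_mul, ← integral_smul]
    refine integral_congr_ae (Eventually.of_forall fun z => ?_)
    simp only [pd_comp_affine (hφ.smooth.differentiable (by simp)), add_sub_cancel_left, smul_smul,
      inv_mul_cancel₀ hr.ne', one_smul, Complex.real_smul]
    obtain ⟨k, rfl⟩ : ∃ k, n = k + 1 := ⟨n - 1, by omega⟩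
    have : (r : ℂ) ≠ 0 := by exact_mod_cast hr.ne'
    simp only [Nat.add_sub_cancel]
    push_cast
    rw [pow_succ]
    field_simp
  rw [h2, norm_mul, Complex.norm_real, Real.norm_eq_abs, abs_of_pos hrn] at h1
  have : r ^ (n - 1) * ‖PD a (fun β z => X β (x₀ + r • z)) φ α‖ ≤ r ^ (n - 1) * (ε * B) := by linarith
  exact le_of_mul_le_mul_left this hrn

/-- interior estimate with error, at scale `r` -/
theorem interior_est (hn : 1 ≤ n) (a : Fin n → Fin N → Fin M → ℂ)
    (hell : ∀ ξ : Euc n, ξ ≠ 0 → ∀ v : Fin M → ℂ,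
      (∀ α : Fin N, ∑ β : Fin M, (∑ j : Fin n, a j α β * (ξ j : ℂ)) * v β = 0) → v = 0)
    {b : Euc n → ℝ} (hb : IsTest (ball 0 1) b) :
    ∃ C, 0 ≤ C ∧ ∀ X Λ ε x₀ r, 0 < r → NearNull a X Λ (ε * r ^ (n - 1)) x₀ r →
      ∀ (x x' : Euc n) (s s' : ℝ), 0 < s → 0 < s' →
      dist x x₀ + s ≤ r/2 → dist x' x₀ + s' ≤ r/2 → ∀ β,
      ‖Avg b (X β) x s - Avg b (X β) x' s'‖ ≤
        C * (Λ * ((dist x x' + |s - s'|) / r) + ε * ((r / s) ^ n + (r / s') ^ n)) := by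
  obtain ⟨C, hC0, hC⟩ := interior_unit a hell hb
  refine ⟨C, hC0, fun X Λ ε x₀ r hr h x x' s s' hs hs' hx hx' β => ?_⟩
  have hno : ∀ v w : Euc n, ‖r⁻¹ • (v - w)‖ = dist v w / r := by
    intro v w
    rw [norm_smul, Real.norm_eq_abs, abs_of_pos (inv_pos.2 hr), dist_eq_norm]; ring
  have h1 := hC _ Λ ε (h.rescale hn hr) (r⁻¹ • (x - x₀)) (r⁻¹ • (x' - x₀)) (s / r) (s' / r)
    (by positivity) (by positivity)
    (by rw [hno, ← add_div, div_le_iff₀ hr]; linarith) (by rw [hno, ← add_div, div_le_iff₀ hr]; linarith) β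
  have hA : ∀ (x : Euc n) (s : ℝ), Avg b (fun z => X β (x₀ + r • z)) (r⁻¹ • (x - x₀)) (s / r) = Avg b (X β) x s := by
    intro x s
    unfold Avg
    refine integral_congr_ae (Eventually.of_forall fun z => ?_)
    simp only [smul_add, smul_smul, mul_inv_cancel₀ hr.ne', one_smul, mul_div_cancel₀ _ hr.ne']
    congr 2
    abel
  rw [hA, hA, ← smul_sub, sub_sub_sub_cancel_right, hno, ← sub_div, abs_div, abs_of_pos hr] at h1
  refine h1.trans (le_of_eq ?_)
  simp only [div_pow, inv_div]
  ring

end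

open MeasureTheory Metric Set Filter
open scoped ENNReal NNReal Topology Convolution

/-! ### Part 2: Lipschitz test functions -/
noncomputable section
variable {n : ℕ}

theorem clm_eq_sum (L : Euc n →L[ℝ] ℝ) (w : Euc n) : L w = ∑ j, w j * L (EuclideanSpace.single j 1) := by
  have : w = ∑ j, w j • EuclideanSpace.single j (1 : ℝ) := by
    have := (EuclideanSpace.basisFun (Fin n) ℝ).sum_repr w
    simpa using this.symm
  conv_lhs => rw [this]
  simp

theorem fderiv_mollify {ψ : Euc n → ℝ} {L : ℝ≥0} (hψ : LipschitzWith L ψ) (ρ : ContDiffBump (0 : Euc n))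
    (x e : Euc n) :
    fderiv ℝ (ρ.normed volume ⋆[ContinuousLinearMap.lsmul ℝ ℝ, volume] ψ) x e =
      (ρ.normed volume ⋆[ContinuousLinearMap.lsmul ℝ ℝ, volume] (fun y => lineDeriv ℝ ψ y e)) x := by
  have hc := ρ.hasCompactSupport_normed (μ := volume)
  have hs : ContDiff ℝ 1 (ρ.normed volume) := ρ.contDiff_normed
  have hl : LocallyIntegrable ψ volume := hψ.continuous.locallyIntegrable
  rw [(hc.hasFDerivAt_convolution_left (ContinuousLinearMap.lsmul ℝ ℝ) hs hl x).fderiv]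
  obtain ⟨D, hD⟩ : ∃ D, LipschitzWith D (ρ.normed volume) :=
    hs.lipschitzWith_of_hasCompactSupport hc (by simp)
  have hex : ConvolutionExistsAt (fderiv ℝ (ρ.normed volume)) ψ x
      ((ContinuousLinearMap.lsmul ℝ ℝ).precompL (Euc n)) volume :=
    (hc.fderiv ℝ).convolutionExists_left _ (hs.continuous_fderiv (by simp)) hl x
  have h1 : ((fderiv ℝ (ρ.normed volume)) ⋆[(ContinuousLinearMap.lsmul ℝ ℝ).precompL (Euc n), volume] ψ) x e =
      ∫ t, fderiv ℝ (ρ.normed volume) t e * ψ (x - t) := by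
    rw [convolution_def, ContinuousLinearMap.integral_apply hex]
    simp
  rw [h1, convolution_def]
  have hg : LipschitzWith L (fun t => ψ (x - t)) := by
    refine LipschitzWith.of_dist_le_mul fun p q => ?_
    simpa only [dist_sub_left] using hψ.dist_le_mul (x - p) (x - q)
  have h2 := hg.integral_lineDeriv_mul_eq (μ := volume) hD hc e
  have h3 : ∀ t, lineDeriv ℝ (ρ.normed volume) t (-e) = - fderiv ℝ (ρ.normed volume) t e := by
    intro t
    rw [(hs.differentiable (by simp) t).lineDeriv_eq_fderiv, map_neg]
  have h4 : ∀ t, lineDeriv ℝ (fun t => ψ (x - t)) t e = - lineDeriv ℝ ψ (x - t) e := by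
    intro t
    unfold lineDeriv
    have : (fun s : ℝ => ψ (x - (t + s • e))) = fun s => (fun s => ψ (x - t + s • e)) (-s) := by
      ext s; simp only; congr 1; simp; abel
    have h5 := deriv_comp_neg (fun s : ℝ => ψ (x - t + s • e)) (0 : ℝ)
    rw [this, h5]; simp
  simp only [h3, h4, neg_mul, integral_neg] at h2
  rw [neg_inj] at h2
  rw [← h2]
  simp [mul_comm]

/-- weakly divergence free field -/
def DivFree (Ω : Set (Euc n)) (W : Euc n → Euc n) : Prop :=
  ∀ φ, IsTest Ω φ → ∫ x in Ω, fderiv ℝ φ x (W x) = 0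

theorem DivFree.lipschitz {Ω : Set (Euc n)} (hΩ : IsOpen Ω) {W : Euc n → Euc n}
    (hW : LocallyIntegrableOn W Ω volume) (hdiv : DivFree Ω W) {ψ : Euc n → ℝ} {L : ℝ≥0}
    (hψ : LipschitzWith L ψ) (hc : HasCompactSupport ψ) (hs : tsupport ψ ⊆ Ω) :
    ∫ x in Ω, fderiv ℝ ψ x (W x) = 0 := by
  obtain ⟨δ, hδ, hδΩ⟩ := hc.isCompact.exists_cthickening_subset_open hΩ hs
  set K := cthickening δ (tsupport ψ)
  have hK : IsCompact K := hc.isCompact.cthickening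
  let ρ : ℕ → ContDiffBump (0 : Euc n) := fun i =>
    ⟨δ / 2 / (i + 1), δ / (i + 1), by positivity, by rw [div_lt_div_iff_of_pos_right (by positivity)]; linarith⟩
  set Ψ : ℕ → Euc n → ℝ := fun i => (ρ i).normed volume ⋆[ContinuousLinearMap.lsmul ℝ ℝ, volume] ψ
  have hρ0 : Tendsto (fun i => (ρ i).rOut) atTop (𝓝 0) := by
    have := tendsto_const_div_atTop_nhds_zero_nat δ
    have := (tendsto_add_atTop_iff_nat 1).2 this
    simpa [ρ] using this
  have hρδ : ∀ i, (ρ i).rOut ≤ δ := fun i => div_le_self hδ.le (by linarith [Nat.cast_nonneg (α := ℝ) i])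
  have hsupp : ∀ i, Function.support (Ψ i) ⊆ K := by
    intro i
    refine (support_convolution_subset _).trans ?_
    rintro _ ⟨p, hp, q, hq, rfl⟩
    rw [(ρ i).support_normed_eq, mem_ball, dist_zero_right] at hp
    refine mem_cthickening_of_dist_le _ q _ _ (subset_closure hq) ?_
    simp only [dist_eq_norm, add_sub_cancel_right]; linarith [hρδ i]
  have htest : ∀ i, IsTest Ω (Ψ i) := fun i =>
    ⟨((ρ i).hasCompactSupport_normed).contDiff_convolution_left _ (ρ i).contDiff_normed
        hψ.continuous.locallyIntegrable,
      HasCompactSupport.of_support_subset_isCompact hK (hsupp i),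
      (closure_minimal (hsupp i) hK.isClosed).trans hδΩ⟩
  have hld : ∀ e : Euc n, LocallyIntegrable (fun y => lineDeriv ℝ ψ y e) volume := by
    intro e
    refine (locallyIntegrable_const (L * ‖e‖)).mono
      (measurable_lineDeriv hψ.continuous).aestronglyMeasurable (Eventually.of_forall fun x => ?_)
    exact (norm_lineDeriv_le_of_lipschitz ℝ hψ).trans (le_abs_self _)
  have hlim : ∀ j : Fin n, ∀ᵐ x, Tendsto (fun i => fderiv ℝ (Ψ i) x (EuclideanSpace.single j 1)) atTop
      (𝓝 (lineDeriv ℝ ψ x (EuclideanSpace.single j 1))) := by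
    intro j
    have := ContDiffBump.ae_convolution_tendsto_right_of_locallyIntegrable (μ := volume) (K := 2) hρ0
      (Eventually.of_forall fun i => by simp only [ρ]; apply le_of_eq; field_simp)
      (hld (EuclideanSpace.single j 1))
    filter_upwards [this] with x hx
    simpa only [Ψ, fderiv_mollify hψ] using hx
  have hbd : ∀ i x e, |fderiv ℝ (Ψ i) x e| ≤ L * ‖e‖ := by
    intro i x e
    have hL : LipschitzWith L (Ψ i) := by
      refine LipschitzWith.of_dist_le_mul fun x y => ?_
      have hintg : ∀ x, Integrable fun t => (ρ i).normed volume t * ψ (x - t) := by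
        intro x
        refine Continuous.integrable_of_hasCompactSupport ?_ ((ρ i).hasCompactSupport_normed.mul_right)
        exact (ρ i).continuous_normed.mul (hψ.continuous.comp (by fun_prop))
      simp only [Ψ, convolution_def, ContinuousLinearMap.lsmul_apply, smul_eq_mul, dist_eq_norm]
      rw [← integral_sub (hintg x) (hintg y)]
      calc _ ≤ ∫ t, (ρ i).normed volume t * (L * ‖x - y‖) := by
            refine norm_integral_le_of_norm_le ((ρ i).integrable_normed.mul_const _)
              (Eventually.of_forall fun t => ?_)
            rw [← mul_sub, norm_mul, Real.norm_of_nonneg ((ρ i).nonneg_normed t)]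
            refine mul_le_mul_of_nonneg_left ?_ ((ρ i).nonneg_normed t)
            have := hψ.dist_le_mul (x - t) (y - t)
            simpa [dist_eq_norm] using this
        _ = _ := by rw [integral_mul_const, (ρ i).integral_normed, one_mul]
    exact (ContinuousLinearMap.le_opNorm _ e).trans
      (mul_le_mul_of_nonneg_right (norm_fderiv_le_of_lipschitz ℝ hL) (norm_nonneg _))
  have hWm : AEStronglyMeasurable W (volume.restrict Ω) := hW.aestronglyMeasurable
  have hWK : IntegrableOn W K volume := hW.integrableOn_compact_subset hδΩ hK
  have hdom : Integrable (K.indicator fun x => L * ‖W x‖) (volume.restrict Ω) :=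
    ((integrable_indicator_iff hK.measurableSet).2 (hWK.norm.const_mul _)).restrict
  have hT := tendsto_integral_of_dominated_convergence (μ := volume.restrict Ω)
    (F := fun i x => fderiv ℝ (Ψ i) x (W x)) (f := fun x => fderiv ℝ ψ x (W x)) _
    (fun i => ?_) hdom (fun i => Eventually.of_forall fun x => ?_) ?_
  · have h0 : ∀ i, ∫ x in Ω, fderiv ℝ (Ψ i) x (W x) = 0 := fun i => hdiv _ (htest i)
    simp only [h0] at hT
    exact tendsto_nhds_unique hT tendsto_const_nhds
  · have : Continuous (fderiv ℝ (Ψ i)) := (htest i).smooth.continuous_fderiv (by simp)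
    exact (isBoundedBilinearMap_apply (𝕜 := ℝ)).continuous.comp_aestronglyMeasurable
      (this.aestronglyMeasurable.prodMk hWm)
  · by_cases hx : x ∈ K
    · simp only [indicator_of_mem hx]; exact hbd i x _
    · have : fderiv ℝ (Ψ i) x = 0 := by
        refine image_eq_zero_of_notMem_tsupport fun h => hx ?_
        exact closure_minimal (hsupp i) hK.isClosed (tsupport_fderiv_subset ℝ h)
      simp [this, hx]
  · have hA : ∀ᵐ x, ∀ j : Fin n, Tendsto (fun i => fderiv ℝ (Ψ i) x (EuclideanSpace.single j 1)) atTop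
      (𝓝 (lineDeriv ℝ ψ x (EuclideanSpace.single j 1))) := ae_all_iff.2 hlim
    refine ae_restrict_of_ae ?_
    filter_upwards [hA, hψ.ae_differentiableAt (μ := volume)] with x hx hd
    rw [show (fun i => fderiv ℝ (Ψ i) x (W x)) = fun i => ∑ j, W x j *
      fderiv ℝ (Ψ i) x (EuclideanSpace.single j 1) from funext fun i => clm_eq_sum _ _, clm_eq_sum]
    refine tendsto_finsetSum _ fun j _ => (Tendsto.const_mul _ ?_)
    rw [← hd.lineDeriv_eq_fderiv]
    exact hx j

end

open MeasureTheory Metric Set Filter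
open scoped ENNReal NNReal Topology

/-! ### Part 3: geometry, sawtooth cutoffs -/
noncomputable section
variable {n : ℕ}

/-- Quantitative boundary geometry. -/
structure Geo (Ω : Set (Euc n)) (σ : Measure (Euc n)) (D c C : ℝ) : Prop where
  hn : 2 ≤ n
  op : IsOpen Ω
  hD : 0 < D
  hc : 0 < c
  hC : 0 < C
  null : σ (frontier Ω)ᶜ = 0
  lo : ∀ x ∈ frontier Ω, ∀ r, 0 < r → r < D → ENNReal.ofReal (c * r ^ (n - 1)) ≤ σ (ball x r)
  hi : ∀ x ∈ frontier Ω, ∀ r, 0 < r → r < D → σ (ball x r) ≤ ENNReal.ofReal (C * r ^ (n - 1))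

/-- distance to the complement -/
def dl (Ω : Set (Euc n)) (y : Euc n) : ℝ := infDist y Ωᶜ

theorem dl_nonneg (Ω : Set (Euc n)) (y : Euc n) : 0 ≤ dl Ω y := infDist_nonneg

theorem dl_lip (Ω : Set (Euc n)) : LipschitzWith 1 (dl Ω) := lipschitz_infDist_pt _

theorem dl_zero {Ω : Set (Euc n)} {y : Euc n} (hy : y ∉ Ω) : dl Ω y = 0 := infDist_zero_of_mem hy

theorem frontier_not_mem {Ω : Set (Euc n)} (hΩ : IsOpen Ω) {x : Euc n} (hx : x ∈ frontier Ω) : x ∉ Ω := by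
  rw [hΩ.frontier_eq] at hx; exact hx.2

theorem dl_pos {Ω : Set (Euc n)} (hΩ : IsOpen Ω) {x : Euc n} (hx : x ∈ frontier Ω) {y : Euc n} (hy : y ∈ Ω) :
    0 < dl Ω y := by
  have hne : (Ωᶜ).Nonempty := ⟨x, frontier_not_mem hΩ hx⟩
  exact (hΩ.isClosed_compl.notMem_iff_infDist_pos hne).1 (by simpa using hy)

theorem exists_near {Ω : Set (Euc n)} (hΩ : IsOpen Ω) {x : Euc n} (hx : x ∈ frontier Ω) {y : Euc n} (hy : y ∈ Ω) :
    ∃ z ∈ frontier Ω, dist y z = dl Ω y := by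
  obtain ⟨z, hz, h⟩ := exists_mem_frontier_infDist_compl_eq_dist hy
    (fun h => frontier_not_mem hΩ hx (by rw [h]; trivial))
  exact ⟨z, hz, h.symm⟩

theorem dl_le {Ω : Set (Euc n)} {x y : Euc n} (hx : x ∉ Ω) : dl Ω y ≤ dist y x :=
  infDist_le_dist_of_mem hx

theorem dl_eq {Ω : Set (Euc n)} (hΩ : IsOpen Ω) {x : Euc n} (hx : x ∈ frontier Ω) {y : Euc n} (hy : y ∈ Ω) :
    infDist y (frontier Ω) = dl Ω y := by
  apply le_antisymm
  · obtain ⟨z, hz, h⟩ := exists_near hΩ hx hy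
    rw [← h]; exact infDist_le_dist_of_mem hz
  · exact infDist_le_infDist_of_subset (fun z hz => frontier_not_mem hΩ hz) ⟨x, hx⟩

def chi (Ω F : Set (Euc n)) (κ : ℝ) (y : Euc n) : ℝ :=
  min (max ((1 + κ) * dl Ω y - infDist y F) 0) (κ / 2 * dl Ω y) / (κ / 2 * dl Ω y)

def Aset (Ω F : Set (Euc n)) (κ : ℝ) : Set (Euc n) :=
  {y | y ∈ Ω ∧ (1 + κ / 2) * dl Ω y ≤ infDist y F ∧ infDist y F ≤ (1 + κ) * dl Ω y}

def om (Ω F : Set (Euc n)) (κ : ℝ) : Measure (Euc n) :=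
  (volume.restrict (Aset Ω F κ)).withDensity (fun y => ENNReal.ofReal (dl Ω y)⁻¹)

theorem continuous_dl (Ω : Set (Euc n)) : Continuous (dl Ω) := (dl_lip Ω).continuous

theorem measurable_Aset {Ω : Set (Euc n)} (hΩ : IsOpen Ω) (F : Set (Euc n)) (κ : ℝ) :
    MeasurableSet (Aset Ω F κ) := by
  have h1 := continuous_dl Ω
  have h2 : Continuous (fun y => infDist y F) := continuous_infDist_pt F
  have e1 : IsClosed {y | (1 + κ / 2) * dl Ω y ≤ infDist y F} := isClosed_le (by fun_prop) (by fun_prop)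
  have e2 : IsClosed {y | infDist y F ≤ (1 + κ) * dl Ω y} := isClosed_le (by fun_prop) (by fun_prop)
  exact hΩ.measurableSet.inter (e1.measurableSet.inter e2.measurableSet)

theorem vol_ball (x : Euc n) {r : ℝ} (hr : 0 < r) :
    volume (ball x r) = ENNReal.ofReal (r ^ n) * volume (ball (0 : Euc n) 1) := by
  simpa using Measure.addHaar_ball_of_pos (volume : Measure (Euc n)) x hr

theorem om_finite {Ω : Set (Euc n)} {σ : Measure (Euc n)} {D c C : ℝ} (G : Geo Ω σ D c C)
    {F : Set (Euc n)} {κ : ℝ} (hκ : 0 < κ) (hκ1 : κ ≤ 1) {x : Euc n} (hx : x ∈ frontier Ω) {ρ : ℝ}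
    (hρ : 0 < ρ) (hρD : 4 * ρ < D) : om Ω F κ (ball x ρ) < ⊤ := by
  have hΩ := G.op
  have hn := G.hn
  set m : Euc n → ℝ := fun y => infDist y F with hm
  have hmc : Continuous m := continuous_infDist_pt F
  have hdc := continuous_dl Ω
  have hml : ∀ y z, m y ≤ m z + dist y z := fun y z => infDist_le_infDist_add_dist
  set τ := σ.restrict (ball x (3 * ρ)) with hτ
  have hτf : τ univ < ⊤ := by
    rw [hτ, Measure.restrict_apply_univ]
    exact (G.hi x hx _ (by linarith) (by linarith)).trans_lt ENNReal.ofReal_lt_top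
  have : IsFiniteMeasure τ := ⟨hτf⟩
  set k : Euc n → Euc n → ℝ≥0∞ := fun y z =>
    {q : Euc n × Euc n | 0 < m q.2 ∧ dist q.1 q.2 < 16 / κ * m q.2}.indicator
      (fun q => ENNReal.ofReal ((m q.2 ^ n)⁻¹)) (y, z) with hk
  have hkset : MeasurableSet {q : Euc n × Euc n | 0 < m q.2 ∧ dist q.1 q.2 < 16 / κ * m q.2} := by
    have e1 : IsOpen {q : Euc n × Euc n | 0 < m q.2} := isOpen_lt (by fun_prop) (by fun_prop)
    have e2 : IsOpen {q : Euc n × Euc n | dist q.1 q.2 < 16 / κ * m q.2} := isOpen_lt (by fun_prop) (by fun_prop)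
    exact e1.measurableSet.inter e2.measurableSet
  have hkm : Measurable (Function.uncurry k) := by
    refine Measurable.indicator ?_ hkset
    exact ENNReal.measurable_ofReal.comp (((hmc.measurable.comp measurable_snd).pow_const n).inv)
  set q := c * (κ / 4) ^ (n - 1) with hq
  have hq0 : 0 < q := by have := G.hc; positivity
  -- pointwise bound
  have hpt : ∀ y ∈ Aset Ω F κ ∩ ball x ρ, ENNReal.ofReal (dl Ω y)⁻¹ ≤
      ENNReal.ofReal (4 ^ n / q) * ∫⁻ z, k y z ∂τ := by
    rintro y ⟨⟨hyΩ, hy1, hy2⟩, hyρ⟩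
    obtain ⟨w, hw, hwd⟩ := exists_near hΩ hx hyΩ
    have hδ := dl_pos hΩ hx hyΩ
    have hδρ : dl Ω y < ρ := (dl_le (frontier_not_mem hΩ hx)).trans_lt hyρ
    set δ := dl Ω y
    have hlo := G.lo w hw (κ / 4 * δ) (by positivity) (by nlinarith)
    have hsub : ∀ z ∈ ball w (κ / 4 * δ), z ∈ ball x (3 * ρ) ∧
        ENNReal.ofReal ((4 ^ n * δ ^ n)⁻¹) ≤ k y z := by
      intro z hz
      rw [mem_ball] at hz
      have hyz : dist y z < δ + κ / 4 * δ := by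
        have := dist_triangle y w z
        rw [dist_comm w z] at this; linarith
      have hyx : dist y x < ρ := hyρ
      have hκδ : κ * δ ≤ δ := by nlinarith
      have h1 : κ / 4 * δ ≤ m z := by
        have := hml y z
        simp only [hm] at this hy1 ⊢
        nlinarith
      have h2 : m z ≤ 4 * δ := by
        have := hml z y
        rw [dist_comm z y] at this
        simp only [hm] at this ⊢
        nlinarith
      have hmpos : 0 < m z := lt_of_lt_of_le (by positivity) h1
      refine ⟨?_, ?_⟩
      · rw [mem_ball]
        have := dist_triangle z y x
        rw [dist_comm z y] at this; nlinarith
      · have hmem : (y, z) ∈ {q : Euc n × Euc n | 0 < m q.2 ∧ dist q.1 q.2 < 16 / κ * m q.2} := by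
          refine ⟨hmpos, ?_⟩
          have : 16 / κ * (κ / 4 * δ) ≤ 16 / κ * m z := by gcongr
          have h3 : 16 / κ * (κ / 4 * δ) = 4 * δ := by field_simp; ring
          simp only
          linarith
        simp only [hk, indicator_of_mem hmem]
        refine ENNReal.ofReal_le_ofReal (inv_anti₀ (by positivity) ?_)
        rw [← mul_pow]; gcongr
    have hI : ENNReal.ofReal ((4 ^ n * δ ^ n)⁻¹) * ENNReal.ofReal (c * (κ / 4 * δ) ^ (n - 1)) ≤ ∫⁻ z, k y z ∂τ := by
      calc _ ≤ ENNReal.ofReal ((4 ^ n * δ ^ n)⁻¹) * τ (ball w (κ / 4 * δ)) := by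
            gcongr
            rw [hτ, Measure.restrict_apply isOpen_ball.measurableSet,
              inter_eq_self_of_subset_left fun z hz => (hsub z hz).1]
            exact hlo
        _ = ∫⁻ z in ball w (κ / 4 * δ), ENNReal.ofReal ((4 ^ n * δ ^ n)⁻¹) ∂τ := by
            rw [setLIntegral_const]
        _ ≤ ∫⁻ z in ball w (κ / 4 * δ), k y z ∂τ :=
            setLIntegral_mono' isOpen_ball.measurableSet fun z hz => (hsub z hz).2
        _ ≤ _ := setLIntegral_le_lintegral _ _
    refine le_trans (le_of_eq ?_) (mul_le_mul_right hI _)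
    have hc := G.hc
    rw [← ENNReal.ofReal_mul (by positivity), ← ENNReal.ofReal_mul (by positivity)]
    congr 1
    obtain ⟨p, rfl⟩ : ∃ p, n = p + 1 := ⟨n - 1, by omega⟩
    simp only [hq, Nat.add_sub_cancel, mul_pow, pow_succ]
    field_simp
  have hom : om Ω F κ (ball x ρ) = ∫⁻ y in Aset Ω F κ ∩ ball x ρ, ENNReal.ofReal (dl Ω y)⁻¹ := by
    rw [om, withDensity_apply _ isOpen_ball.measurableSet, Measure.restrict_restrict isOpen_ball.measurableSet,
      inter_comm]
  rw [hom]
  calc _ ≤ ∫⁻ y in Aset Ω F κ ∩ ball x ρ, ENNReal.ofReal (4 ^ n / q) * ∫⁻ z, k y z ∂τ :=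
        setLIntegral_mono' ((measurable_Aset hΩ F κ).inter isOpen_ball.measurableSet) hpt
    _ ≤ ∫⁻ y, ENNReal.ofReal (4 ^ n / q) * ∫⁻ z, k y z ∂τ := setLIntegral_le_lintegral _ _
    _ = ENNReal.ofReal (4 ^ n / q) * ∫⁻ y, (∫⁻ z, k y z ∂τ) := lintegral_const_mul' _ _ ENNReal.ofReal_ne_top
    _ = ENNReal.ofReal (4 ^ n / q) * ∫⁻ z, (∫⁻ y, k y z) ∂τ := by
        rw [lintegral_lintegral_swap hkm.aemeasurable]
    _ ≤ ENNReal.ofReal (4 ^ n / q) * ∫⁻ z, ENNReal.ofReal ((16 / κ) ^ n) * volume (ball (0 : Euc n) 1) ∂τ := by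
        gcongr with z
        by_cases hz : 0 < m z
        · calc ∫⁻ y, k y z ≤ ∫⁻ y, (ball z (16 / κ * m z)).indicator (fun _ => ENNReal.ofReal ((m z ^ n)⁻¹)) y := by
                refine lintegral_mono fun y => ?_
                simp only [hk]
                by_cases h : (y, z) ∈ {q : Euc n × Euc n | 0 < m q.2 ∧ dist q.1 q.2 < 16 / κ * m q.2}
                · rw [indicator_of_mem h, indicator_of_mem (by exact h.2)]
                · rw [indicator_of_notMem h]; exact zero_le
            _ = _ := by
                rw [lintegral_indicator isOpen_ball.measurableSet, setLIntegral_const,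
                  vol_ball z (by positivity), ← mul_assoc, ← ENNReal.ofReal_mul (by positivity)]
                congr 2
                rw [mul_pow]; field_simp
            _ ≤ _ := le_rfl
        · have : ∀ y, k y z = 0 := fun y => by
            simp only [hk]; exact indicator_of_notMem (fun h => hz h.1) _
          simp [this]
    _ < ⊤ := by
        rw [lintegral_const]
        exact ENNReal.mul_lt_top ENNReal.ofReal_lt_top (ENNReal.mul_lt_top
          (ENNReal.mul_lt_top ENNReal.ofReal_lt_top measure_ball_lt_top) hτf)

end

open MeasureTheory Metric Set Filter
open scoped ENNReal NNReal Topology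

/-! ### Part 4: the divergence estimate for sawtooth cutoffs -/
noncomputable section
variable {n : ℕ}

theorem min_div_lip {a a' b b' : ℝ} (hb : 0 < b) (hb' : 0 < b') (h' : |a'| ≤ b') :
    |a / b - a' / b'| ≤ (|a - a'| + |b - b'|) / b := by
  have : a / b - a' / b' = ((a - a') - (a' / b') * (b - b')) / b := by field_simp; ring
  rw [this, abs_div, abs_of_pos hb]
  gcongr
  refine (abs_sub _ _).trans ?_
  rw [abs_mul]
  have : |a' / b'| ≤ 1 := by rw [abs_div, abs_of_pos hb']; exact div_le_one_of_le₀ h' hb'.le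
  nlinarith [abs_nonneg (b - b')]

def zN (κ ε d m : ℝ) : ℝ := min (max ((1 + κ) * d - m) 0) (κ / 2 * max d ε)
def zX (κ ε d m : ℝ) : ℝ := zN κ ε d m / (κ / 2 * max d ε)
def zK (ε d : ℝ) : ℝ := min (max (d / ε - 1) 0) 1

def zeta (Ω F : Set (Euc n)) (κ ε : ℝ) (y : Euc n) : ℝ :=
  zX κ ε (dl Ω y) (infDist y F) * zK ε (dl Ω y)

theorem zX_mem {κ ε d m : ℝ} (hκ : 0 < κ) (hε : 0 < ε) : 0 ≤ zX κ ε d m ∧ zX κ ε d m ≤ 1 := by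
  have hb : 0 < κ / 2 * max d ε := mul_pos (by linarith) (lt_max_of_lt_right hε)
  constructor
  · exact div_nonneg (le_min (le_max_right _ _) hb.le) hb.le
  · exact div_le_one_of_le₀ (min_le_right _ _) hb.le

theorem zK_mem (ε d : ℝ) : 0 ≤ zK ε d ∧ zK ε d ≤ 1 :=
  ⟨le_min (le_max_right _ _) zero_le_one, min_le_right _ _⟩

theorem abs_max_sub_max_const (a b c : ℝ) : |max a c - max b c| ≤ |a - b| := by
  exact abs_max_sub_max_le_abs a b c

theorem zX_lip {κ ε d m d' m' t : ℝ} (hκ : 0 < κ) (hκ1 : κ ≤ 1) (hε : 0 < ε) (hd : |d - d'| ≤ t)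
    (hm : |m - m'| ≤ t) : |zX κ ε d m - zX κ ε d' m'| ≤ 8 / κ / max d ε * t := by
  have ht : 0 ≤ t := (abs_nonneg _).trans hd
  have hb : 0 < κ / 2 * max d ε := mul_pos (by linarith) (lt_max_of_lt_right hε)
  have hb' : 0 < κ / 2 * max d' ε := mul_pos (by linarith) (lt_max_of_lt_right hε)
  have hbb : |κ / 2 * max d ε - κ / 2 * max d' ε| ≤ t / 2 := by
    rw [← mul_sub, abs_mul, abs_of_pos (by linarith : (0:ℝ) < κ / 2)]
    have := abs_max_sub_max_const d d' ε
    nlinarith [abs_nonneg (max d ε - max d' ε)]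
  have haa : |zN κ ε d m - zN κ ε d' m'| ≤ 3 * t := by
    refine (abs_min_sub_min_le_max _ _ _ _).trans (max_le ?_ (hbb.trans (by linarith)))
    refine (abs_max_sub_max_const _ _ _).trans ?_
    have : (1 + κ) * d - m - ((1 + κ) * d' - m') = (1 + κ) * (d - d') - (m - m') := by ring
    rw [this]
    refine (abs_sub _ _).trans ?_
    rw [abs_mul, abs_of_pos (by linarith : 0 < 1 + κ)]
    nlinarith [abs_nonneg (d - d')]
  have hab : |zN κ ε d' m'| ≤ κ / 2 * max d' ε := by
    unfold zN
    rw [abs_of_nonneg (le_min (le_max_right _ _) hb'.le)]; exact min_le_right _ _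
  refine (min_div_lip hb hb' hab).trans ?_
  have h4 : 8 / κ / max d ε * t = 4 * t / (κ / 2 * max d ε) := by
    have : max d ε ≠ 0 := (lt_max_of_lt_right hε).ne'
    field_simp; ring
  rw [h4]
  gcongr
  linarith

theorem zK_lip {ε d d' t : ℝ} (hε : 0 < ε) (hd : |d - d'| ≤ t) : |zK ε d - zK ε d'| ≤ 1 / ε * t := by
  refine (abs_min_sub_min_le_max _ _ _ _).trans ?_
  rw [sub_self, abs_zero]
  have ht : 0 ≤ t := (abs_nonneg _).trans hd
  refine max_le ((abs_max_sub_max_const _ _ _).trans ?_) (by positivity)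
  have : d / ε - 1 - (d' / ε - 1) = 1 / ε * (d - d') := by ring
  rw [this, abs_mul, abs_of_pos (by positivity)]
  gcongr

theorem abs_dl_sub (Ω : Set (Euc n)) (x y : Euc n) : |dl Ω x - dl Ω y| ≤ ‖x - y‖ := by
  simpa [Real.dist_eq, dist_eq_norm] using (dl_lip Ω).dist_le_mul x y
theorem abs_inf_sub (F : Set (Euc n)) (x y : Euc n) : |infDist x F - infDist y F| ≤ ‖x - y‖ := by
  simpa [Real.dist_eq, dist_eq_norm] using (lipschitz_infDist_pt F).dist_le_mul x y

theorem zeta_mem (Ω F : Set (Euc n)) {κ ε : ℝ} (hκ : 0 < κ) (hε : 0 < ε) (y : Euc n) :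
    0 ≤ zeta Ω F κ ε y ∧ zeta Ω F κ ε y ≤ 1 := by
  have h1 := zX_mem (d := dl Ω y) (m := infDist y F) hκ hε
  have h2 := zK_mem ε (dl Ω y)
  exact ⟨mul_nonneg h1.1 h2.1, mul_le_one₀ h1.2 h2.1 h2.2⟩

theorem zeta_lip (Ω F : Set (Euc n)) {κ ε : ℝ} (hκ : 0 < κ) (hκ1 : κ ≤ 1) (hε : 0 < ε) (x y : Euc n) :
    |zeta Ω F κ ε x - zeta Ω F κ ε y| ≤ (8 / κ + 1) / ε * ‖x - y‖ := by
  have h1 := zX_lip hκ hκ1 hε (abs_dl_sub Ω x y) (abs_inf_sub F x y)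
  have h2 := zK_lip hε (abs_dl_sub Ω x y)
  have h3 := zX_mem (d := dl Ω x) (m := infDist x F) hκ hε
  have h4 := zK_mem ε (dl Ω y)
  have h5 : 8 / κ / max (dl Ω x) ε * ‖x - y‖ ≤ 8 / κ / ε * ‖x - y‖ := by
    gcongr; exact le_max_right _ _
  unfold zeta
  set A := zX κ ε (dl Ω x) (infDist x F)
  set B := zK ε (dl Ω x)
  set A' := zX κ ε (dl Ω y) (infDist y F)
  set B' := zK ε (dl Ω y)
  have e : A * B - A' * B' = A * (B - B') + (A - A') * B' := by ring
  have e2 : (8 / κ + 1) / ε * ‖x - y‖ = 1 / ε * ‖x - y‖ + 8 / κ / ε * ‖x - y‖ := by ring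
  rw [e, e2]
  refine (abs_add_le _ _).trans (add_le_add ?_ ?_)
  · rw [abs_mul, abs_of_nonneg h3.1]
    nlinarith [abs_nonneg (B - B')]
  · rw [abs_mul, abs_of_nonneg h4.1]
    nlinarith [abs_nonneg (A - A')]

theorem zeta_zero (Ω F : Set (Euc n)) {κ ε : ℝ} (hε : 0 < ε) {y : Euc n} (h : dl Ω y ≤ ε) :
    zeta Ω F κ ε y = 0 := by
  have : zK ε (dl Ω y) = 0 := by
    unfold zK
    rw [max_eq_right, min_eq_left zero_le_one]
    rw [sub_nonpos]; exact div_le_one_of_le₀ h hε.le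
  rw [zeta, this, mul_zero]

theorem zeta_zero' (Ω F : Set (Euc n)) {κ ε : ℝ} (hκ : 0 < κ) (hε : 0 < ε) {y : Euc n}
    (h : (1 + κ) * dl Ω y ≤ infDist y F) :
    zeta Ω F κ ε y = 0 := by
  have hb : 0 < κ / 2 * max (dl Ω y) ε := mul_pos (by linarith) (lt_max_of_lt_right hε)
  have : zX κ ε (dl Ω y) (infDist y F) = 0 := by
    unfold zX zN
    rw [max_eq_right (by linarith), min_eq_left hb.le, zero_div]
  rw [zeta, this, zero_mul]

theorem zK_one {ε d : ℝ} (hε : 0 < ε) (h : 2 * ε ≤ d) : zK ε d = 1 := by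
  unfold zK
  apply min_eq_right
  apply le_max_of_le_left
  have : 2 ≤ d / ε := by rw [le_div_iff₀ hε]; exact h
  linarith

theorem zeta_chi (Ω F : Set (Euc n)) {κ ε : ℝ} (hε : 0 < ε) {y : Euc n} (h : 2 * ε ≤ dl Ω y) :
    zeta Ω F κ ε y = chi Ω F κ y := by
  rw [zeta, zK_one hε h, mul_one, zX, zN, chi, max_eq_left (a := dl Ω y) (by linarith)]

theorem zeta_one (Ω F : Set (Euc n)) {κ ε : ℝ} (hκ : 0 < κ) (hε : 0 < ε) {y : Euc n} (h : 2 * ε ≤ dl Ω y)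
    (h2 : infDist y F ≤ (1 + κ / 2) * dl Ω y) : zeta Ω F κ ε y = 1 := by
  have hd : 0 < dl Ω y := by linarith
  rw [zeta_chi Ω F hε h, chi, min_eq_right, div_self (by positivity)]
  exact le_max_of_le_left (by linarith)

theorem fderiv_zeta_zero (Ω F : Set (Euc n)) {κ ε : ℝ} (hκ : 0 < κ) (hε : 0 < ε) {y : Euc n}
    (h : (1 + κ) * dl Ω y < infDist y F) : fderiv ℝ (zeta Ω F κ ε) y = 0 := by
  have h1 := continuous_dl Ω
  have h2 : Continuous (fun y => infDist y F) := continuous_infDist_pt F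
  have : zeta Ω F κ ε =ᶠ[𝓝 y] fun _ => (0 : ℝ) := by
    have hO : IsOpen {y | (1 + κ) * dl Ω y < infDist y F} := isOpen_lt (by fun_prop) (by fun_prop)
    filter_upwards [hO.mem_nhds h] with z hz using zeta_zero' Ω F hκ hε hz.le
  rw [this.fderiv_eq]; simp

theorem fderiv_zeta_zero' (Ω F : Set (Euc n)) {κ ε : ℝ} (hκ : 0 < κ) (hε : 0 < ε) {y : Euc n}
    (h0 : 2 * ε < dl Ω y)
    (h : infDist y F < (1 + κ / 2) * dl Ω y) : fderiv ℝ (zeta Ω F κ ε) y = 0 := by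
  have h1 := continuous_dl Ω
  have h2 : Continuous (fun y => infDist y F) := continuous_infDist_pt F
  have : zeta Ω F κ ε =ᶠ[𝓝 y] fun _ => (1 : ℝ) := by
    have hO : IsOpen {y | infDist y F < (1 + κ / 2) * dl Ω y} := isOpen_lt (by fun_prop) (by fun_prop)
    have hO2 : IsOpen {y | 2 * ε < dl Ω y} := isOpen_lt (by fun_prop) (by fun_prop)
    filter_upwards [hO.mem_nhds h, hO2.mem_nhds h0] with z hz hz' using zeta_one Ω F hκ hε hz'.le hz.le
  rw [this.fderiv_eq]; simp

theorem fderiv_zeta_le (Ω F : Set (Euc n)) {κ ε : ℝ} (hκ : 0 < κ) (hκ1 : κ ≤ 1) (hε : 0 < ε) (y : Euc n) :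
    ‖fderiv ℝ (zeta Ω F κ ε) y‖ ≤ (8 / κ + 1) / ε := by
  refine norm_fderiv_le_of_lip' ℝ (by positivity) (Eventually.of_forall fun x => ?_)
  rw [Real.norm_eq_abs]
  exact zeta_lip Ω F hκ hκ1 hε x y

theorem fderiv_zeta_le' (Ω F : Set (Euc n)) {κ ε : ℝ} (hκ : 0 < κ) (hκ1 : κ ≤ 1) (hε : 0 < ε) {y : Euc n}
    (h0 : 2 * ε < dl Ω y) : ‖fderiv ℝ (zeta Ω F κ ε) y‖ ≤ (8 / κ + 1) * (dl Ω y)⁻¹ := by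
  have h1 := continuous_dl Ω
  have hd : 0 < dl Ω y := by linarith
  have hO2 : IsOpen {y | 2 * ε < dl Ω y} := isOpen_lt (by fun_prop) (by fun_prop)
  refine norm_fderiv_le_of_lip' ℝ (by positivity) ?_
  filter_upwards [hO2.mem_nhds h0] with x hx
  rw [Real.norm_eq_abs, abs_sub_comm, norm_sub_rev]
  have := zX_lip hκ hκ1 hε (abs_dl_sub Ω y x) (abs_inf_sub F y x)
  rw [zeta, zeta, zK_one hε h0.le, zK_one hε (le_of_lt hx), mul_one, mul_one]
  refine this.trans ?_
  rw [max_eq_left (by linarith), div_eq_mul_inv]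
  gcongr
  linarith

theorem fderiv_zeta_W {Ω F : Set (Euc n)} {κ ε : ℝ} (hκ : 0 < κ) (hκ1 : κ ≤ 1) (hε : 0 < ε) {y : Euc n}
    (hy : y ∈ Ω) {w : Euc n} {Λ : ℝ} (hΛ : 0 ≤ Λ)
    (hw : infDist y F ≤ (1 + κ) * dl Ω y → ‖w‖ ≤ Λ) :
    ‖fderiv ℝ (zeta Ω F κ ε) y w‖ ≤ (8 / κ + 1) * Λ * ({y | dl Ω y ≤ 2 * ε}.indicator (fun _ => 1 / ε) y +
      (Aset Ω F κ).indicator (fun y => (dl Ω y)⁻¹) y) := by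
  have hd := dl_nonneg Ω y
  have hA : 0 ≤ (Aset Ω F κ).indicator (fun y => (dl Ω y)⁻¹) y :=
    indicator_nonneg (fun y _ => inv_nonneg.2 (dl_nonneg Ω y)) _
  have hB : 0 ≤ {y | dl Ω y ≤ 2 * ε}.indicator (fun _ => 1 / ε) y :=
    indicator_nonneg (fun y _ => by positivity) _
  have hR : 0 ≤ (8 / κ + 1) * Λ * ({y | dl Ω y ≤ 2 * ε}.indicator (fun _ => 1 / ε) y +
      (Aset Ω F κ).indicator (fun y => (dl Ω y)⁻¹) y) := by positivity
  rcases lt_or_ge ((1 + κ) * dl Ω y) (infDist y F) with h | h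
  · rw [fderiv_zeta_zero Ω F hκ hε h]; simpa using hR
  have hw := hw h
  rcases le_or_gt (dl Ω y) (2 * ε) with h2 | h2
  · have h3 := fderiv_zeta_le Ω F hκ hκ1 hε y
    refine (ContinuousLinearMap.le_opNorm _ _).trans ?_
    rw [indicator_of_mem (by exact h2)]
    calc _ ≤ (8 / κ + 1) / ε * Λ := by gcongr
      _ = (8 / κ + 1) * Λ * (1 / ε + 0) := by ring
      _ ≤ _ := by gcongr
  · rcases lt_or_ge (infDist y F) ((1 + κ / 2) * dl Ω y) with h4 | h4
    · rw [fderiv_zeta_zero' Ω F hκ hε h2 h4]; simpa using hR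
    have h3 := fderiv_zeta_le' Ω F hκ hκ1 hε h2
    refine (ContinuousLinearMap.le_opNorm _ _).trans ?_
    rw [indicator_of_mem (s := Aset Ω F κ) (by exact ⟨hy, h4, h⟩)]
    calc _ ≤ (8 / κ + 1) * (dl Ω y)⁻¹ * Λ := by gcongr
      _ = (8 / κ + 1) * Λ * (0 + (dl Ω y)⁻¹) := by ring
      _ ≤ _ := by gcongr
end

open MeasureTheory Metric Set Filter
open scoped ENNReal NNReal Topology

noncomputable section
variable {n : ℕ}

theorem boundary_layer {Ω : Set (Euc n)} {σ : Measure (Euc n)} {D c C : ℝ} (G : Geo Ω σ D c C)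
    {x : Euc n} (hx : x ∈ frontier Ω) {ρ : ℝ}
    (hρ : 0 < ρ) (hρD : 4 * ρ < D) {φ : Euc n → ℝ} (hφ : IsTest (ball x ρ) φ) {η : ℝ} (hη : 0 < η) :
    ∃ ε₀ > 0, ∀ ε, 0 < ε → ε < ε₀ →
      ENNReal.ofReal (1 / ε) * ∫⁻ y in Ω ∩ {y | dl Ω y ≤ 2 * ε}, ENNReal.ofReal |φ y| ≤
      ENNReal.ofReal (2 ^ (n + 1) / c) * volume (ball (0 : Euc n) 1) *
        ((∫⁻ y, ENNReal.ofReal |φ y| ∂σ) + ENNReal.ofReal η * σ (ball x (2 * ρ))) := by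
  have hΩ := G.op
  have hn := G.hn
  have hc := G.hc
  obtain ⟨δ, hδ, hδφ⟩ := Metric.uniformContinuous_iff.1
    (hφ.cpt.uniformContinuous_of_continuous hφ.smooth.continuous) η hη
  refine ⟨min (δ / 4) (ρ / 4), by positivity, fun ε hε hε0 => ?_⟩
  have hε1 : 4 * ε < δ := by have := hε0.trans_le (min_le_left _ _); linarith
  have hε2 : 4 * ε < ρ := by have := hε0.trans_le (min_le_right _ _); linarith
  set τ := σ.restrict (ball x (2 * ρ)) with hτ
  have hτf : τ univ < ⊤ := by
    rw [hτ, Measure.restrict_apply_univ]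
    exact (G.hi x hx _ (by linarith) (by linarith)).trans_lt ENNReal.ofReal_lt_top
  have : IsFiniteMeasure τ := ⟨hτf⟩
  set g : Euc n → ℝ≥0∞ := fun z => ENNReal.ofReal |φ z| + ENNReal.ofReal η with hg
  have hgm : Measurable g := by
    have := hφ.smooth.continuous.measurable
    exact (ENNReal.measurable_ofReal.comp this.abs).add measurable_const
  have hOp : IsOpen {q : Euc n × Euc n | dist q.1 q.2 < 4 * ε} := isOpen_lt (by fun_prop) (by fun_prop)
  set k : Euc n → Euc n → ℝ≥0∞ := fun y z =>
    {q : Euc n × Euc n | dist q.1 q.2 < 4 * ε}.indicator (fun q => g q.2) (y, z) with hk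
  have hkm : Measurable (Function.uncurry k) :=
    Measurable.indicator (hgm.comp measurable_snd) hOp.measurableSet
  set Lc := ENNReal.ofReal (1 / (c * (2 * ε) ^ (n - 1))) with hLc
  have hpt : ∀ y ∈ Ω ∩ {y | dl Ω y ≤ 2 * ε}, ENNReal.ofReal |φ y| ≤ Lc * ∫⁻ z, k y z ∂τ := by
    rintro y ⟨hyΩ, hy2⟩
    by_cases hyρ : y ∈ ball x ρ
    swap
    · have : φ y = 0 := by
        by_contra h
        exact hyρ (hφ.supp (subset_tsupport _ h))
      simp [this]
    obtain ⟨w, hw, hwd⟩ := exists_near hΩ hx hyΩ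
    rw [mem_setOf_eq, ← hwd] at hy2
    have hlo := G.lo w hw (2 * ε) (by positivity) (by linarith)
    have hyx : dist y x < ρ := hyρ
    have hsub : ∀ z ∈ ball w (2 * ε), z ∈ ball x (2 * ρ) ∧ ENNReal.ofReal |φ y| ≤ k y z := by
      intro z hz
      rw [mem_ball] at hz
      have hyz : dist y z < 4 * ε := by
        have := dist_triangle y w z
        rw [dist_comm w z] at this; linarith
      refine ⟨?_, ?_⟩
      · rw [mem_ball]
        have := dist_triangle z y x
        rw [dist_comm z y] at this; linarith
      · simp only [hk]
        rw [indicator_of_mem (by exact hyz)]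
        simp only [hg]
        rw [← ENNReal.ofReal_add (abs_nonneg _) hη.le]
        apply ENNReal.ofReal_le_ofReal
        have := hδφ (hyz.trans hε1)
        rw [Real.dist_eq] at this
        have := abs_sub_abs_le_abs_sub (φ y) (φ z)
        linarith
    have hI : ENNReal.ofReal |φ y| * ENNReal.ofReal (c * (2 * ε) ^ (n - 1)) ≤ ∫⁻ z, k y z ∂τ := by
      calc _ ≤ ENNReal.ofReal |φ y| * τ (ball w (2 * ε)) := by
            gcongr
            rw [hτ, Measure.restrict_apply isOpen_ball.measurableSet,
              inter_eq_self_of_subset_left fun z hz => (hsub z hz).1]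
            exact hlo
        _ = ∫⁻ z in ball w (2 * ε), ENNReal.ofReal |φ y| ∂τ := by
            rw [setLIntegral_const]
        _ ≤ ∫⁻ z in ball w (2 * ε), k y z ∂τ :=
            setLIntegral_mono' isOpen_ball.measurableSet fun z hz => (hsub z hz).2
        _ ≤ _ := setLIntegral_le_lintegral _ _
    refine le_trans (le_of_eq ?_) (mul_le_mul_right hI _)
    rw [← ENNReal.ofReal_mul (by positivity), ← ENNReal.ofReal_mul (by positivity)]
    congr 1
    field_simp
  have hms : MeasurableSet (Ω ∩ {y | dl Ω y ≤ 2 * ε}) :=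
    hΩ.measurableSet.inter (isClosed_le (continuous_dl Ω) continuous_const).measurableSet
  calc _ ≤ ENNReal.ofReal (1 / ε) * ∫⁻ y in Ω ∩ {y | dl Ω y ≤ 2 * ε}, Lc * ∫⁻ z, k y z ∂τ := by
        exact mul_le_mul_right (setLIntegral_mono' hms hpt) _
    _ ≤ ENNReal.ofReal (1 / ε) * ∫⁻ y, Lc * ∫⁻ z, k y z ∂τ := by
        exact mul_le_mul_right (setLIntegral_le_lintegral _ _) _
    _ = ENNReal.ofReal (1 / ε) * (Lc * ∫⁻ y, (∫⁻ z, k y z ∂τ)) := by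
        rw [lintegral_const_mul' _ _ ENNReal.ofReal_ne_top]
    _ = ENNReal.ofReal (1 / ε) * (Lc * ∫⁻ z, (∫⁻ y, k y z) ∂τ) := by
        rw [lintegral_lintegral_swap hkm.aemeasurable]
    _ = ENNReal.ofReal (1 / ε) * (Lc * ∫⁻ z, (ENNReal.ofReal ((4 * ε) ^ n) * volume (ball (0 : Euc n) 1)) * g z ∂τ) := by
        congr 2
        refine lintegral_congr fun z => ?_
        have : ∀ y, k y z = (ball z (4 * ε)).indicator (fun _ => g z) y := fun y => by
          simp only [hk, indicator, mem_setOf_eq, mem_ball]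
        simp only [this]
        rw [lintegral_indicator isOpen_ball.measurableSet, setLIntegral_const,
                  vol_ball z (by positivity), mul_comm]
    _ = ENNReal.ofReal (2 ^ (n + 1) / c) * volume (ball (0 : Euc n) 1) * ∫⁻ z, g z ∂τ := by
        rw [lintegral_const_mul _ hgm, hLc, ← mul_assoc, ← mul_assoc, ← mul_assoc,
          ← ENNReal.ofReal_mul (by positivity), ← ENNReal.ofReal_mul (by positivity)]
        congr 3
        obtain ⟨p, rfl⟩ : ∃ p, n = p + 1 := ⟨n - 1, by omega⟩
        have h4 : (4 : ℝ) = 2 * 2 := by norm_num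
        simp only [Nat.add_sub_cancel, h4, mul_pow, pow_succ]
        field_simp
    _ ≤ _ := by
        gcongr
        rw [hg, lintegral_add_right _ measurable_const, lintegral_const, hτ, Measure.restrict_apply_univ]
        gcongr
        exact Measure.restrict_le_self

theorem div_est {Ω : Set (Euc n)} {σ : Measure (Euc n)} {D c C : ℝ} (G : Geo Ω σ D c C)
    {F : Set (Euc n)} {κ : ℝ} (hκ : 0 < κ) (hκ1 : κ ≤ 1) {W : Euc n → Euc n}
    (hW : LocallyIntegrableOn W Ω volume) (hdiv : DivFree Ω W) {Λ : ℝ} (hΛ : 0 ≤ Λ)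
    (hWb : ∀ᵐ y, y ∈ Ω → infDist y F ≤ (1 + κ) * dl Ω y → ‖W y‖ ≤ Λ)
    {x : Euc n} (hx : x ∈ frontier Ω) {ρ : ℝ} (hρ : 0 < ρ) (hρD : 4 * ρ < D) :
    ∃ K : ℝ, 0 ≤ K ∧ ∀ φ, IsTest (ball x ρ) φ →
      ENNReal.ofReal |∫ y in Ω, chi Ω F κ y * fderiv ℝ φ y (W y)| ≤
        ENNReal.ofReal K * ∫⁻ y, ENNReal.ofReal |φ y| ∂(σ + om Ω F κ) := by
  have hΩ := G.op
  have hn := G.hn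
  have hc := G.hc
  set V := (volume (ball (0 : Euc n) 1)) with hV
  have hVt : V ≠ ⊤ := measure_ball_lt_top.ne
  set C1 := (8 / κ + 1) * Λ with hC1
  set K2 := 2 ^ (n + 1) / c * V.toReal with hK2
  have hC10 : 0 ≤ C1 := by positivity
  have hK20 : 0 ≤ K2 := by positivity
  refine ⟨C1 * (K2 + 1), by positivity, fun φ hφ => ?_⟩
  have hWm : AEStronglyMeasurable W (volume.restrict Ω) := hW.aestronglyMeasurable
  have hWb' : ∀ᵐ y ∂(volume.restrict Ω), y ∈ Ω ∧ (infDist y F ≤ (1 + κ) * dl Ω y → ‖W y‖ ≤ Λ) := by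
    filter_upwards [ae_restrict_of_ae hWb, ae_restrict_mem hΩ.measurableSet] with y h1 h2 using ⟨h2, h1 h2⟩
  have hdφ : Continuous (fderiv ℝ φ) := hφ.smooth.continuous_fderiv (by simp)
  have hdφc : HasCompactSupport (fderiv ℝ φ) := hφ.cpt.fderiv ℝ
  have hdφi : Integrable (fun y => ‖fderiv ℝ φ y‖ * Λ) (volume.restrict Ω) :=
    ((hdφ.norm.integrable_of_hasCompactSupport hdφc.norm).mul_const Λ).restrict
  have hz : ∀ ε, 0 < ε → LipschitzWith (Real.toNNReal ((8 / κ + 1) / ε)) (zeta Ω F κ ε) := fun ε hε => by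
    refine LipschitzWith.of_dist_le_mul fun a b => ?_
    rw [Real.coe_toNNReal _ (by positivity), Real.dist_eq, dist_eq_norm]
    exact zeta_lip Ω F hκ hκ1 hε a b
  set f : ℝ → Euc n → ℝ := fun ε y => zeta Ω F κ ε y * fderiv ℝ φ y (W y) with hf
  have hbil : ∀ {L : Euc n → (Euc n →L[ℝ] ℝ)}, AEStronglyMeasurable L (volume.restrict Ω) →
      AEStronglyMeasurable (fun y => L y (W y)) (volume.restrict Ω) := fun h1 =>
    (isBoundedBilinearMap_apply (𝕜 := ℝ)).continuous.comp_aestronglyMeasurable (h1.prodMk hWm)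
  have hfm : ∀ ε, 0 < ε → AEStronglyMeasurable (f ε) (volume.restrict Ω) := fun ε hε =>
    (hz ε hε).continuous.aestronglyMeasurable.mul (hbil hdφ.aestronglyMeasurable)
  have hfb : ∀ ε, 0 < ε → ∀ᵐ y ∂(volume.restrict Ω), ‖f ε y‖ ≤ ‖fderiv ℝ φ y‖ * Λ := fun ε hε => by
    filter_upwards [hWb'] with y ⟨hy, hyb⟩
    simp only [hf]
    rcases le_or_gt (infDist y F) ((1 + κ) * dl Ω y) with h | h
    · have := hyb h
      rw [norm_mul]
      have h1 := zeta_mem Ω F hκ hε y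
      have h2 : ‖zeta Ω F κ ε y‖ ≤ 1 := by rw [Real.norm_eq_abs, abs_of_nonneg h1.1]; exact h1.2
      calc _ ≤ 1 * (‖fderiv ℝ φ y‖ * Λ) := by
            gcongr
            refine (ContinuousLinearMap.le_opNorm _ _).trans ?_
            gcongr
        _ = _ := one_mul _
    · rw [zeta_zero' Ω F hκ hε h.le, zero_mul, norm_zero]; positivity
  have hfi : ∀ ε, 0 < ε → Integrable (f ε) (volume.restrict Ω) := fun ε hε =>
    hdφi.mono' (hfm ε hε) (hfb ε hε)
  -- the estimate for positive ε
  have hest : ∀ ε, 0 < ε → ENNReal.ofReal |∫ y in Ω, f ε y| ≤ ENNReal.ofReal C1 *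
      (ENNReal.ofReal (1 / ε) * (∫⁻ y in Ω ∩ {y | dl Ω y ≤ 2 * ε}, ENNReal.ofReal |φ y|) +
        ∫⁻ y, ENNReal.ofReal |φ y| ∂(om Ω F κ)) := by
    intro ε hε
    set ζ := zeta Ω F κ ε with hζ
    have hζc : Continuous ζ := (hz ε hε).continuous
    -- test function
    have hψc : HasCompactSupport (fun y => φ y * ζ y) := hφ.cpt.mul_right
    obtain ⟨B, hB0, hB⟩ := hφ.bdd
    obtain ⟨Lφ, hLφ⟩ := hdφ.bounded_above_of_compact_support hdφc
    have hLφ0 : 0 ≤ Lφ := (norm_nonneg _).trans (hLφ 0)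
    have hφl : LipschitzWith Lφ.toNNReal φ := by
      refine lipschitzWith_of_nnnorm_fderiv_le (𝕜 := ℝ) (hφ.smooth.differentiable (by simp)) fun y => ?_
      rw [← NNReal.coe_le_coe, coe_nnnorm, Real.coe_toNNReal _ hLφ0]; exact hLφ y
    have hψl : LipschitzWith (Lφ + B * ((8 / κ + 1) / ε)).toNNReal (fun y => φ y * ζ y) := by
      refine LipschitzWith.of_dist_le_mul fun p q => ?_
      rw [Real.coe_toNNReal _ (by positivity), Real.dist_eq]
      have h1 := hφl.dist_le_mul p q
      rw [Real.coe_toNNReal _ hLφ0, Real.dist_eq] at h1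
      have h2 := (hz ε hε).dist_le_mul p q
      rw [Real.coe_toNNReal _ (by positivity), Real.dist_eq] at h2
      have h3 := zeta_mem Ω F hκ hε p
      have h3' : |ζ p| ≤ 1 := by rw [abs_of_nonneg h3.1]; exact h3.2
      have e : φ p * ζ p - φ q * ζ q = (φ p - φ q) * ζ p + φ q * (ζ p - ζ q) := by ring
      rw [e, add_mul]
      refine (abs_add_le _ _).trans (add_le_add ?_ ?_)
      · rw [abs_mul]
        calc _ ≤ |φ p - φ q| * 1 := by gcongr
          _ ≤ _ := by rw [mul_one]; exact h1
      · rw [abs_mul, mul_assoc]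
        exact mul_le_mul (hB q) h2 (abs_nonneg _) hB0
    have hψs : tsupport (fun y => φ y * ζ y) ⊆ Ω := by
      have hcl : IsClosed {y | ε ≤ dl Ω y} := isClosed_le continuous_const (continuous_dl Ω)
      have : tsupport (fun y => φ y * ζ y) ⊆ {y | ε ≤ dl Ω y} := by
        refine closure_minimal (fun y hy => ?_) hcl
        by_contra h
        simp only [mem_setOf_eq, not_le] at h
        apply hy
        simp only
        rw [hζ, zeta_zero Ω F hε h.le, mul_zero]
      intro y hy
      have h2 : ε ≤ dl Ω y := this hy
      by_contra h
      rw [dl_zero h] at h2; linarith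
    have hz0 := DivFree.lipschitz hΩ hW hdiv hψl hψc hψs
    have hdiff : ∀ᵐ y ∂(volume.restrict Ω), DifferentiableAt ℝ ζ y :=
      ae_restrict_of_ae (hz ε hε).ae_differentiableAt
    set g : Euc n → ℝ := fun y => φ y * fderiv ℝ ζ y (W y) with hg
    have hgb : ∀ᵐ y ∂(volume.restrict Ω), ‖g y‖ ≤ |φ y| * (C1 * ({y | dl Ω y ≤ 2 * ε}.indicator (fun _ => 1 / ε) y +
      (Aset Ω F κ).indicator (fun y => (dl Ω y)⁻¹) y)) := by
      filter_upwards [hWb'] with y ⟨hy, hyb⟩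
      simp only [hg]
      rw [norm_mul, Real.norm_eq_abs]
      gcongr
      exact fderiv_zeta_W hκ hκ1 hε hy hΛ hyb
    have hgi : Integrable g (volume.restrict Ω) := by
      have : Integrable (fun y => |φ y| * ((8 / κ + 1) / ε * Λ)) (volume.restrict Ω) :=
        ((hφ.smooth.continuous.abs.integrable_of_hasCompactSupport hφ.cpt.abs).mul_const _).restrict
      refine this.mono' (hφ.smooth.continuous.aestronglyMeasurable.mul
        (hbil (measurable_fderiv ℝ ζ).aestronglyMeasurable)) ?_
      filter_upwards [hWb'] with y ⟨hy, hyb⟩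
      simp only [hg]
      rw [norm_mul, Real.norm_eq_abs]
      gcongr
      rcases le_or_gt (infDist y F) ((1 + κ) * dl Ω y) with h | h
      · refine (ContinuousLinearMap.le_opNorm _ _).trans ?_
        gcongr
        · exact fderiv_zeta_le Ω F hκ hκ1 hε y
        · exact hyb h
      · rw [hζ, fderiv_zeta_zero Ω F hκ hε h]; simp; positivity
    have hsum : ∫ y in Ω, f ε y = - ∫ y in Ω, g y := by
      rw [eq_neg_iff_add_eq_zero, ← integral_add (hfi ε hε) hgi, ← hz0]
      refine integral_congr_ae ?_
      filter_upwards [hdiff] with y hy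
      have := (hφ.smooth.differentiable (by simp) y).hasFDerivAt.mul hy.hasFDerivAt
      erw [this.fderiv]
      simp [hf, hg, ← hζ]
      ring
    rw [hsum, abs_neg, ← Real.norm_eq_abs]
    have hAm := measurable_Aset hΩ F κ
    have hSm : MeasurableSet {y | dl Ω y ≤ 2 * ε} := (isClosed_le (continuous_dl Ω) continuous_const).measurableSet
    have hom : ∫⁻ y, ENNReal.ofReal |φ y| ∂(om Ω F κ) =
        ∫⁻ y in Ω, (Aset Ω F κ).indicator (fun y => ENNReal.ofReal |φ y| * ENNReal.ofReal (dl Ω y)⁻¹) y := by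
      have hdm : Measurable (fun y => ENNReal.ofReal (dl Ω y)⁻¹) :=
        ENNReal.measurable_ofReal.comp (continuous_dl Ω).measurable.inv
      have hφm : Measurable (fun y => ENNReal.ofReal |φ y|) :=
        ENNReal.measurable_ofReal.comp hφ.smooth.continuous.measurable.abs
      rw [om, lintegral_withDensity_eq_lintegral_mul _ hdm hφm, lintegral_indicator hAm,
        Measure.restrict_restrict hAm, inter_eq_self_of_subset_left (fun y hy => hy.1)]
      exact lintegral_congr fun y => by simp only [Pi.mul_apply]; rw [mul_comm]
    have hbd : ENNReal.ofReal (1 / ε) * (∫⁻ y in Ω ∩ {y | dl Ω y ≤ 2 * ε}, ENNReal.ofReal |φ y|) =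
        ∫⁻ y in Ω, {y | dl Ω y ≤ 2 * ε}.indicator (fun y => ENNReal.ofReal (1 / ε) * ENNReal.ofReal |φ y|) y := by
      rw [lintegral_indicator hSm, Measure.restrict_restrict hSm, inter_comm,
        lintegral_const_mul' _ _ ENNReal.ofReal_ne_top]
    rw [hom, hbd, ← lintegral_add_left, ← lintegral_const_mul' _ _ ENNReal.ofReal_ne_top]
    · refine (ENNReal.ofReal_le_ofReal (norm_integral_le_lintegral_norm _)).trans ?_
      refine ENNReal.ofReal_toReal_le.trans ?_
      refine lintegral_mono_ae ?_
      filter_upwards [hgb] with y hy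
      refine (ENNReal.ofReal_le_ofReal hy).trans ?_
      by_cases h1 : y ∈ {y | dl Ω y ≤ 2 * ε} <;> by_cases h2 : y ∈ Aset Ω F κ <;>
        simp only [indicator_of_mem, indicator_of_notMem, h1, h2, not_false_eq_true, add_zero, zero_add, mul_zero,
          ENNReal.ofReal_zero, le_refl]
      · have := dl_nonneg Ω y
        rw [← ENNReal.ofReal_mul (by positivity), ← ENNReal.ofReal_mul (by positivity),
          ← ENNReal.ofReal_add (by positivity) (by positivity), ← ENNReal.ofReal_mul (by positivity)]
        apply ENNReal.ofReal_le_ofReal; apply le_of_eq; ring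
      · rw [← ENNReal.ofReal_mul (by positivity), ← ENNReal.ofReal_mul (by positivity)]
        apply ENNReal.ofReal_le_ofReal; apply le_of_eq; ring
      · rw [← ENNReal.ofReal_mul (by positivity), ← ENNReal.ofReal_mul (by positivity)]
        apply ENNReal.ofReal_le_ofReal; apply le_of_eq; ring
    · refine Measurable.indicator ?_ hSm
      exact (ENNReal.measurable_ofReal.comp hφ.smooth.continuous.measurable.abs).const_mul _
  -- limit
  have hlim : Tendsto (fun ε => ∫ y in Ω, f ε y) (𝓝[>] 0)
      (𝓝 (∫ y in Ω, chi Ω F κ y * fderiv ℝ φ y (W y))) := by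
    refine tendsto_integral_filter_of_dominated_convergence (fun y => ‖fderiv ℝ φ y‖ * Λ) ?_ ?_ hdφi ?_
    · filter_upwards [self_mem_nhdsWithin] with ε hε using hfm ε hε
    · filter_upwards [self_mem_nhdsWithin] with ε hε using hfb ε hε
    · filter_upwards [ae_restrict_mem hΩ.measurableSet] with y hy
      have hd := dl_pos hΩ hx hy
      refine tendsto_const_nhds.congr' ?_
      filter_upwards [self_mem_nhdsWithin, mem_nhdsWithin_of_mem_nhds (Iio_mem_nhds (half_pos hd))] with ε hε hε2
      simp only [hf]
      rw [zeta_chi Ω F hε]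
      have : ε < dl Ω y / 2 := hε2
      linarith
  set I := ∫ y in Ω, chi Ω F κ y * fderiv ℝ φ y (W y) with hI
  have hlimE : Tendsto (fun ε => ENNReal.ofReal |∫ y in Ω, f ε y|) (𝓝[>] 0) (𝓝 (ENNReal.ofReal |I|)) :=
    (ENNReal.continuous_ofReal.tendsto _).comp hlim.abs
  have hσB : σ (ball x (2 * ρ)) ≠ ⊤ :=
    ((G.hi x hx _ (by linarith) (by linarith)).trans_lt ENNReal.ofReal_lt_top).ne
  have key : ∀ η : ℝ, 0 < η → ENNReal.ofReal |I| ≤ ENNReal.ofReal C1 *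
      (ENNReal.ofReal (2 ^ (n + 1) / c) * V *
        ((∫⁻ y, ENNReal.ofReal |φ y| ∂σ) + ENNReal.ofReal η * σ (ball x (2 * ρ))) +
        ∫⁻ y, ENNReal.ofReal |φ y| ∂(om Ω F κ)) := by
    intro η hη
    obtain ⟨ε₀, hε₀, hb⟩ := boundary_layer G hx hρ hρD hφ hη
    refine le_of_tendsto hlimE ?_
    filter_upwards [self_mem_nhdsWithin, mem_nhdsWithin_of_mem_nhds (Iio_mem_nhds hε₀)] with ε hε hε2
    refine (hest ε hε).trans ?_
    exact mul_le_mul_right (add_le_add_left (hb ε hε hε2) _) _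
  have hlim2 : Tendsto (fun η : ℝ => ENNReal.ofReal C1 *
      (ENNReal.ofReal (2 ^ (n + 1) / c) * V *
        ((∫⁻ y, ENNReal.ofReal |φ y| ∂σ) + ENNReal.ofReal η * σ (ball x (2 * ρ))) +
        ∫⁻ y, ENNReal.ofReal |φ y| ∂(om Ω F κ))) (𝓝[>] 0) (𝓝 (ENNReal.ofReal C1 *
      (ENNReal.ofReal (2 ^ (n + 1) / c) * V *
        ((∫⁻ y, ENNReal.ofReal |φ y| ∂σ) + ENNReal.ofReal 0 * σ (ball x (2 * ρ))) +
        ∫⁻ y, ENNReal.ofReal |φ y| ∂(om Ω F κ)))) := by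
    have h0 : Tendsto (fun η : ℝ => ENNReal.ofReal η) (𝓝[>] 0) (𝓝 (ENNReal.ofReal 0)) :=
      (ENNReal.continuous_ofReal.tendsto _).mono_left nhdsWithin_le_nhds
    refine ENNReal.Tendsto.const_mul (Tendsto.add (ENNReal.Tendsto.const_mul
      (Tendsto.add tendsto_const_nhds (ENNReal.Tendsto.mul_const h0 (Or.inr hσB))) (Or.inr ?_))
      tendsto_const_nhds) (Or.inr ENNReal.ofReal_ne_top)
    exact ENNReal.mul_ne_top ENNReal.ofReal_ne_top hVt
  have := ge_of_tendsto hlim2 (by filter_upwards [self_mem_nhdsWithin] with η hη using key η hη)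
  refine this.trans ?_
  rw [lintegral_add_measure, ENNReal.ofReal_mul hC10, mul_assoc (ENNReal.ofReal C1)]
  refine mul_le_mul_right ?_ _
  rw [ENNReal.ofReal_zero, zero_mul, add_zero, mul_add]
  have e1 : ENNReal.ofReal (2 ^ (n + 1) / c) * V = ENNReal.ofReal K2 := by
    rw [hK2, ENNReal.ofReal_mul (by positivity), ENNReal.ofReal_toReal hVt]
  rw [e1]
  gcongr
  · linarith
  · rw [ENNReal.ofReal_add hK20 zero_le_one, ENNReal.ofReal_one]
    calc _ = 1 * (∫⁻ y, ENNReal.ofReal |φ y| ∂(om Ω F κ)) := (one_mul _).symm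
      _ ≤ _ := by gcongr; exact le_add_self
end

open MeasureTheory Metric Set Filter
open scoped ENNReal NNReal Topology

/-! ### Part 5: local representation of the boundary functional -/
noncomputable section
variable {n : ℕ}

theorem exists_repr {V H : Type*} [AddCommGroup V] [Module ℝ V] [NormedAddCommGroup H] [InnerProductSpace ℝ H]
    [CompleteSpace H] (J : V →ₗ[ℝ] H) (T : V →ₗ[ℝ] ℝ) (K : ℝ) (h : ∀ v, |T v| ≤ K * ‖J v‖) :
    ∃ g : H, ∀ v, T v = inner ℝ g (J v) := by
  obtain ⟨s, hs⟩ := J.rangeRestrict.exists_rightInverse_of_surjective J.range_rangeRestrict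
  have hs' : ∀ w : J.range, J (s w) = w := fun w => by
    have := congrArg (fun f => ((f w : J.range) : H)) hs
    simpa using this
  let L : J.range →L[ℝ] ℝ := LinearMap.mkContinuous (T ∘ₗ s) K (fun w => by
    have := h (s w)
    rw [hs'] at this
    simpa using this)
  obtain ⟨Le, hLe, -⟩ := _root_.exists_extension_norm_eq J.range L
  refine ⟨(InnerProductSpace.toDual ℝ H).symm Le, fun v => ?_⟩
  rw [InnerProductSpace.toDual_symm_apply]
  have h1 := hLe ⟨J v, v, rfl⟩
  rw [h1]
  have h2 := h (v - s ⟨J v, v, rfl⟩)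
  rw [map_sub, map_sub, hs', sub_self, norm_zero, mul_zero] at h2
  have h3 := abs_nonpos_iff.1 h2
  show T v = T (s _)
  linarith

theorem IsTest.add {U : Set (Euc n)} {φ ψ : Euc n → ℝ} (hφ : IsTest U φ) (hψ : IsTest U ψ) :
    IsTest U (φ + ψ) :=
  ⟨hφ.smooth.add hψ.smooth, hφ.cpt.add hψ.cpt, (tsupport_add φ ψ).trans (union_subset hφ.supp hψ.supp)⟩

theorem IsTest.smul {U : Set (Euc n)} {φ : Euc n → ℝ} (hφ : IsTest U φ) (c : ℝ) :
    IsTest U (c • φ) :=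
  ⟨hφ.smooth.const_smul c, hφ.cpt.smul_left (f := fun _ => c),
    (tsupport_smul_subset_right (fun _ => c) φ).trans hφ.supp⟩

theorem isTest_zero (U : Set (Euc n)) : IsTest U 0 :=
  ⟨contDiff_const, HasCompactSupport.zero, by simp [tsupport]⟩

def testSub (U : Set (Euc n)) : Submodule ℝ (Euc n → ℝ) where
  carrier := {φ | IsTest U φ}
  add_mem' := fun h1 h2 => h1.add h2
  zero_mem' := isTest_zero U
  smul_mem' := fun c _ h => h.smul c

theorem IsTest.memLp {U : Set (Euc n)} {φ : Euc n → ℝ} (hφ : IsTest U φ) (μ : Measure (Euc n))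
    [IsFiniteMeasure μ] (p : ℝ≥0∞) : MemLp φ p μ := by
  obtain ⟨B, -, hB⟩ := hφ.bdd
  exact MemLp.of_bound hφ.smooth.continuous.aestronglyMeasurable B (Eventually.of_forall hB)

def testJ (U : Set (Euc n)) (μ : Measure (Euc n)) [IsFiniteMeasure μ] : testSub U →ₗ[ℝ] Lp ℝ 2 μ where
  toFun φ := (IsTest.memLp φ.2 μ 2).toLp φ.1
  map_add' φ ψ := MemLp.toLp_add _ _
  map_smul' c φ := MemLp.toLp_const_smul c _

/-- representation by an integrable density -/
theorem exists_density {U : Set (Euc n)} (μ : Measure (Euc n)) [IsFiniteMeasure μ] (T : testSub U →ₗ[ℝ] ℝ)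
    (K : ℝ) (hK : 0 ≤ K) (h : ∀ φ, ENNReal.ofReal |T φ| ≤ ENNReal.ofReal K * ∫⁻ y, ENNReal.ofReal |φ.1 y| ∂μ) :
    ∃ g : Euc n → ℝ, Integrable g μ ∧ ∀ φ, T φ = ∫ y, g y * φ.1 y ∂μ := by
  obtain ⟨g, hg⟩ := exists_repr (testJ U μ) T (K * (μ univ ^ (1 / 2 : ℝ)).toReal) (fun φ => by
    have h1 := h φ
    have hm := IsTest.memLp φ.2 μ 2
    have e1 : ∫⁻ y, ENNReal.ofReal |φ.1 y| ∂μ = eLpNorm φ.1 1 μ := by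
      rw [eLpNorm_one_eq_lintegral_enorm]
      refine lintegral_congr fun y => ?_
      rw [← Real.norm_eq_abs, ofReal_norm_eq_enorm]
    have h2 := eLpNorm_le_eLpNorm_mul_rpow_measure_univ (p := 1) (q := 2) (μ := μ) (f := φ.1)
      (by norm_num) hm.1
    have e2 : (1 / (1:ℝ≥0∞).toReal - 1 / (2:ℝ≥0∞).toReal) = (1 / 2 : ℝ) := by norm_num
    rw [e2] at h2
    rw [e1] at h1
    have h3 := h1.trans (mul_le_mul_right h2 _)
    have hμ : μ univ ^ (1 / 2 : ℝ) ≠ ⊤ := ENNReal.rpow_ne_top_of_nonneg (by norm_num) (measure_ne_top _ _)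
    have h4 := ENNReal.toReal_mono (ENNReal.mul_ne_top ENNReal.ofReal_ne_top (ENNReal.mul_ne_top hm.2.ne hμ)) h3
    rw [ENNReal.toReal_ofReal (abs_nonneg _), ENNReal.toReal_mul, ENNReal.toReal_mul, ENNReal.toReal_ofReal hK] at h4
    have e3 : ‖testJ U μ φ‖ = (eLpNorm φ.1 2 μ).toReal := Lp.norm_toLp _ hm
    rw [e3]
    linarith)
  refine ⟨g, (Lp.memLp g).integrable (by norm_num), fun φ => ?_⟩
  rw [hg, L2.inner_def]
  refine integral_congr_ae ?_
  have hm := IsTest.memLp φ.2 μ 2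
  filter_upwards [hm.coeFn_toLp] with y hy
  have : (testJ U μ φ : Euc n → ℝ) y = φ.1 y := hy
  rw [this]
  simp [mul_comm]

def LocRep (σ : Measure (Euc n)) (T : (Euc n → ℝ) → ℝ) (x : Euc n) (γ : ℝ) : Prop :=
  ∀ η > 0, ∃ r₀ > 0, ∀ r, 0 < r → r < r₀ → ∀ φ, IsTest (ball x r) φ → ∀ B, (∀ y, |φ y| ≤ B) →
    |T φ - γ * ∫ y, φ y ∂σ| ≤ η * B * r ^ (n - 1)

theorem om_sing {Ω : Set (Euc n)} (hΩ : IsOpen Ω) (F : Set (Euc n)) (κ : ℝ) :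
    om Ω F κ (frontier Ω) = 0 := by
  refine (withDensity_absolutelyContinuous _ _ : om Ω F κ ≪ _) ?_
  rw [Measure.restrict_apply isClosed_frontier.measurableSet]
  have : frontier Ω ∩ Aset Ω F κ = ∅ := by
    ext y; simp only [mem_inter_iff, mem_empty_iff_false, iff_false]
    rintro ⟨h1, h2⟩; exact frontier_not_mem hΩ h1 h2.1
  rw [this, measure_empty]

theorem loc_rep {Ω : Set (Euc n)} {σ : Measure (Euc n)} {D c C : ℝ} (G : Geo Ω σ D c C)
    {F : Set (Euc n)} {κ : ℝ} (hκ : 0 < κ) (hκ1 : κ ≤ 1)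
    {x₁ : Euc n} (hx : x₁ ∈ frontier Ω) {ρ : ℝ} (hρ : 0 < ρ) (hρD : 4 * ρ < D) (T : (Euc n → ℝ) → ℝ)
    (hadd : ∀ φ ψ, IsTest (ball x₁ ρ) φ → IsTest (ball x₁ ρ) ψ → T (φ + ψ) = T φ + T ψ)
    (hsmul : ∀ φ (t : ℝ), IsTest (ball x₁ ρ) φ → T (t • φ) = t * T φ) (K : ℝ) (hK : 0 ≤ K)
    (hT : ∀ φ, IsTest (ball x₁ ρ) φ → ENNReal.ofReal |T φ| ≤
        ENNReal.ofReal K * ∫⁻ y, ENNReal.ofReal |φ y| ∂(σ + om Ω F κ)) :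
    ∀ᵐ x ∂(σ.restrict (ball x₁ ρ)), ∃ γ, LocRep σ T x γ := by
  have hΩ := G.op
  set U := ball x₁ ρ with hU
  have hUm : MeasurableSet U := isOpen_ball.measurableSet
  set s1 := σ.restrict U with hs1
  set s2 := (om Ω F κ).restrict U with hs2
  have hf1 : s1 univ < ⊤ := by
    rw [hs1, Measure.restrict_apply_univ]
    exact (G.hi x₁ hx _ (by linarith) (by linarith)).trans_lt ENNReal.ofReal_lt_top
  have hf2 : s2 univ < ⊤ := by
    rw [hs2, Measure.restrict_apply_univ]; exact om_finite G hκ hκ1 hx hρ hρD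
  have i1 : IsFiniteMeasure s1 := ⟨hf1⟩
  have i2 : IsFiniteMeasure s2 := ⟨hf2⟩
  set μ := s1 + s2 with hμ
  have hrestr : ∀ φ, IsTest U φ → ∀ m : Measure (Euc n), ∫⁻ y, ENNReal.ofReal |φ y| ∂m =
      ∫⁻ y, ENNReal.ofReal |φ y| ∂(m.restrict U) := by
    intro φ hφ m
    refine (setLIntegral_eq_of_support_subset ?_).symm
    intro y hy
    refine hφ.supp (subset_tsupport _ ?_)
    intro h; apply hy; simp [h]
  obtain ⟨g, hgi, hg⟩ := exists_density (U := U) μ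
    { toFun := fun φ => T φ.1
      map_add' := fun φ ψ => hadd _ _ φ.2 ψ.2
      map_smul' := fun t φ => hsmul _ t φ.2 } K hK (fun φ => by
        have := hT φ.1 φ.2
        rw [hrestr _ φ.2, Measure.restrict_add] at this
        exact this)
  have hsing : s2 ⟂ₘ s1 := by
    refine ⟨frontier Ω, isClosed_frontier.measurableSet, ?_, ?_⟩
    · exact le_antisymm ((Measure.restrict_le_self _).trans (om_sing hΩ F κ).le) bot_le
    · exact le_antisymm ((Measure.restrict_le_self _).trans G.null.le) bot_le
  have hL1 := (Besicovitch.vitaliFamily μ).ae_tendsto_average_norm_sub hgi.locallyIntegrable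
  have hL2 := (Besicovitch.vitaliFamily s1).ae_eventually_measure_zero_of_singular hsing
  have hL1' : ∀ᵐ x ∂s1, Tendsto (fun a => ⨍ y in a, ‖g y - g x‖ ∂μ) ((Besicovitch.vitaliFamily μ).filterAt x) (𝓝 0) := by
    have : s1 ≪ μ := Measure.absolutelyContinuous_of_le (Measure.le_add_right le_rfl)
    exact this.ae_le hL1
  have hfr : ∀ᵐ x ∂s1, x ∈ frontier Ω := by
    rw [hs1]; exact ae_restrict_of_ae (by rw [ae_iff]; exact G.null)
  filter_upwards [hL1', hL2, hfr, ae_restrict_mem hUm] with x h1 h2 hxf hxU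
  refine ⟨g x, fun η hη => ?_⟩
  have h1 := h1.comp (Besicovitch.tendsto_filterAt μ x)
  have h2 := h2.comp (Besicovitch.tendsto_filterAt s1 x)
  set Q := C * 2 ^ (n - 1) * (2 + |g x|) with hQ
  have hQ0 : 0 < Q := by have := G.hC; positivity
  set η' := min (η / Q) 1 with hη'
  have hη'0 : 0 < η' := by positivity
  have hη'Q : η' * Q ≤ η := by
    calc η' * Q ≤ η / Q * Q := by gcongr; exact min_le_left _ _
      _ = η := by field_simp
  have e1 := h1.eventually (Iio_mem_nhds hη'0)
  have e2 := h2.eventually (Iio_mem_nhds (show (0:ℝ≥0∞) < ENNReal.ofReal η' by simpa using hη'0))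
  obtain ⟨r1, hr1, hr1'⟩ := mem_nhdsGT_iff_exists_Ioo_subset.1 (e1.and e2)
  obtain ⟨r2, hr2, hr2'⟩ := Metric.isOpen_iff.1 isOpen_ball x hxU
  refine ⟨min r1 (min (r2 / 2) (D / 2)), by have := G.hD; have : 0 < r1 := hr1; positivity, fun r hr hrr φ hφ B hB => ?_⟩
  have hrr1 : r < r1 := hrr.trans_le (min_le_left _ _)
  have hrr2 : r < r2 / 2 := hrr.trans_le ((min_le_right _ _).trans (min_le_left _ _))
  have hrr3 : r < D / 2 := hrr.trans_le ((min_le_right _ _).trans (min_le_right _ _))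
  obtain ⟨a1, a2⟩ := hr1' ⟨hr, hrr1⟩
  simp only [Function.comp, mem_Iio] at a1 a2
  have hB0 : 0 ≤ B := (abs_nonneg _).trans (hB x)
  have hcU : closedBall x r ⊆ U := (closedBall_subset_ball (by linarith)).trans hr2'
  have hφU : IsTest U φ := hφ.mono (ball_subset_closedBall.trans hcU)
  set A := closedBall x r with hA
  have hAm : MeasurableSet A := isClosed_closedBall.measurableSet
  have hs1A : s1 A ≤ ENNReal.ofReal (C * (2 * r) ^ (n - 1)) := by
    refine (Measure.restrict_le_self _).trans ((measure_mono (closedBall_subset_ball (by linarith))).trans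
      (G.hi x hxf (2 * r) (by linarith) (by linarith)))
  have hs1A' : s1.real A ≤ C * (2 * r) ^ (n - 1) := by
    refine ENNReal.toReal_le_of_le_ofReal ?_ hs1A
    have := G.hC; positivity
  have hs2A : s2.real A ≤ η' * s1.real A := by
    have : s2 A ≤ ENNReal.ofReal η' * s1 A := by
      have := a2.le
      rwa [ENNReal.div_le_iff_le_mul (Or.inr (by simp)) (Or.inl (measure_ne_top _ _))] at this
    have := ENNReal.toReal_mono (ENNReal.mul_ne_top ENNReal.ofReal_ne_top (measure_ne_top _ _)) this
    rwa [ENNReal.toReal_mul, ENNReal.toReal_ofReal hη'0.le] at this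
  have hμA : ∫ y in A, ‖g y - g x‖ ∂μ ≤ η' * μ.real A := by
    rw [setAverage_eq, smul_eq_mul] at a1
    by_cases h0 : μ.real A = 0
    · have : μ A = 0 := by
        rwa [Measure.real, ENNReal.toReal_eq_zero_iff, or_iff_left (measure_ne_top _ _)] at h0
      rw [Measure.restrict_eq_zero.2 this]; simp [h0]
    · have h0' : 0 < μ.real A := lt_of_le_of_ne measureReal_nonneg (Ne.symm h0)
      rw [inv_mul_lt_iff₀ h0'] at a1
      linarith
  have hμA2 : μ.real A = s1.real A + s2.real A := by
    rw [Measure.real, hμ, Measure.add_apply, ENNReal.toReal_add (measure_ne_top _ _) (measure_ne_top _ _)]; rfl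
  have hφz : ∀ y, y ∉ A → φ y = 0 := fun y hy => by
    by_contra h
    exact hy (ball_subset_closedBall (hφ.supp (subset_tsupport _ h)))
  have hφi : ∀ m : Measure (Euc n), IsFiniteMeasure m → Integrable φ m := fun m hm =>
    memLp_one_iff_integrable.1 (hφ.memLp m 1)
  have eT : T φ = ∫ y, g y * φ y ∂μ := hg ⟨φ, hφU⟩
  have eσ : ∫ y, φ y ∂σ = ∫ y, φ y ∂s1 := by
    rw [hs1, setIntegral_eq_integral_of_forall_compl_eq_zero]
    intro y hy; exact hφz y (fun h => hy (hcU h))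
  have eμ : ∫ y, φ y ∂μ = ∫ y, φ y ∂s1 + ∫ y, φ y ∂s2 := by
    rw [hμ, integral_add_measure (hφi _ i1) (hφi _ i2)]
  have hgφ : Integrable (fun y => g y * φ y) μ := by
    exact hgi.mul_bdd hφ.smooth.continuous.aestronglyMeasurable (Eventually.of_forall hB)
  have hsplit : T φ - g x * ∫ y, φ y ∂σ = (∫ y in A, (g y - g x) * φ y ∂μ) + g x * ∫ y in A, φ y ∂s2 := by
    rw [eT, eσ, setIntegral_eq_integral_of_forall_compl_eq_zero (s := A) (μ := μ) (fun y hy => by rw [hφz y hy, mul_zero]),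
      setIntegral_eq_integral_of_forall_compl_eq_zero (s := A) (μ := s2) (fun y hy => hφz y hy)]
    have : ∀ y, (g y - g x) * φ y = g y * φ y - g x * φ y := fun y => by ring
    simp only [this]
    rw [integral_sub hgφ ((hφi μ inferInstance).const_mul _), integral_const_mul, eμ]
    ring
  rw [hsplit]
  have b1 : |∫ y in A, (g y - g x) * φ y ∂μ| ≤ B * (η' * μ.real A) := by
    rw [← Real.norm_eq_abs]
    calc _ ≤ ∫ y in A, B * ‖g y - g x‖ ∂μ := by
          refine norm_integral_le_of_norm_le (((hgi.sub (integrable_const _)).norm.const_mul B).restrict) ?_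
          refine Eventually.of_forall fun y => ?_
          rw [norm_mul, mul_comm]
          exact mul_le_mul_of_nonneg_right (hB y) (norm_nonneg _)
      _ ≤ _ := by rw [integral_const_mul]; gcongr
  have b2 : |∫ y in A, φ y ∂s2| ≤ B * s2.real A := by
    rw [← Real.norm_eq_abs]
    exact norm_setIntegral_le_of_norm_le_const (measure_lt_top _ _) (fun y _ => hB y)
  refine (abs_add_le _ _).trans ?_
  rw [abs_mul]
  have hη'1 : η' ≤ 1 := min_le_right _ _
  have hs0 : 0 ≤ s1.real A := measureReal_nonneg
  calc _ ≤ B * (η' * μ.real A) + |g x| * (B * s2.real A) := by gcongr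
    _ ≤ B * (η' * (s1.real A + 1 * s1.real A)) + |g x| * (B * (η' * s1.real A)) := by
        rw [hμA2]
        gcongr
        exact hs2A.trans (by gcongr)
    _ = B * η' * (2 + |g x|) * s1.real A := by ring
    _ ≤ B * η' * (2 + |g x|) * (C * (2 * r) ^ (n - 1)) := by gcongr
    _ = (η' * Q) * B * r ^ (n - 1) := by rw [hQ, mul_pow]; ring
    _ ≤ _ := by gcongr
end

open MeasureTheory Metric Set Filter
open scoped ENNReal NNReal Topology

/-! ### Part 6: approximate normals and mollified densities -/
noncomputable section
variable {n : ℕ}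

theorem exists_bump (n : ℕ) : ∃ b : Euc n → ℝ, IsTest (ball 0 1) b ∧ (∀ x, 0 ≤ b x) ∧ ∫ x, b x = 1 ∧
    ∃ c > 0, ∀ x, ‖x‖ ≤ 1 / 2 → c ≤ b x := by
  let f : ContDiffBump (0 : Euc n) := ⟨1/2, 3/4, by norm_num, by norm_num⟩
  refine ⟨f.normed volume, ⟨f.contDiff_normed, f.hasCompactSupport_normed, ?_⟩, fun x => f.nonneg_normed x,
    f.integral_normed, (∫ x, f x)⁻¹, inv_pos.2 f.integral_pos, fun x hx => ?_⟩
  · rw [f.tsupport_normed_eq]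
    exact closedBall_subset_ball (by norm_num)
  · rw [f.normed_def, f.one_of_mem_closedBall (by
      show dist x 0 ≤ 1/2
      rwa [dist_zero_right])]
    simp

theorem fderiv_shift (Φ : Euc n → ℝ) (v y : Euc n) :
    fderiv ℝ (fun z => Φ (z - v)) y = fderiv ℝ Φ (y - v) := by
  simpa [sub_eq_add_neg] using fderiv_comp_add_right (𝕜 := ℝ) (f := Φ) (x := y) (-v)

theorem shift_mvt {U Ω : Set (Euc n)} {Φ : Euc n → ℝ} (hΦ : IsTest U Φ) (w : Euc n) :
    ∃ τ ∈ Ioo (0:ℝ) 1, (∫ y in Ω, Φ (y - w)) - ∫ y in Ω, Φ y =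
      -∫ y in Ω, fderiv ℝ (fun z => Φ (z - τ • w)) y w := by
  have hd : Differentiable ℝ Φ := hΦ.smooth.differentiable (by simp)
  have hdc : Continuous (fderiv ℝ Φ) := hΦ.smooth.continuous_fderiv (by simp)
  have hdcs : HasCompactSupport (fderiv ℝ Φ) := hΦ.cpt.fderiv ℝ
  obtain ⟨L, hL⟩ := hdc.bounded_above_of_compact_support hdcs
  obtain ⟨R, hR⟩ := hdcs.isCompact.isBounded.subset_closedBall (0 : Euc n)
  have hintg : ∀ τ : ℝ, Integrable (fun y => Φ (y - τ • w)) volume := fun τ =>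
    (hΦ.smooth.continuous.integrable_of_hasCompactSupport hΦ.cpt).comp_sub_right _
  have key : ∀ τ : ℝ, HasDerivAt (fun τ : ℝ => ∫ y in Ω, Φ (y - τ • w))
      (∫ y in Ω, -(fderiv ℝ Φ (y - τ • w) w)) τ := by
    intro τ
    refine (hasDerivAt_integral_of_dominated_loc_of_deriv_le
      (bound := (closedBall (0 : Euc n) (R + (|τ| + 1) * ‖w‖)).indicator (fun _ => L * ‖w‖))
      (F := fun τ y => Φ (y - τ • w)) (F' := fun τ y => -(fderiv ℝ Φ (y - τ • w) w))
      (μ := volume.restrict Ω) (ball_mem_nhds τ one_pos) ?_ ?_ ?_ ?_ ?_ ?_).2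
    · exact Eventually.of_forall fun t => ((hintg t).aestronglyMeasurable).restrict
    · exact (hintg τ).integrableOn
    · exact (Continuous.aestronglyMeasurable (by fun_prop)).restrict
    · refine Eventually.of_forall fun y t ht => ?_
      rw [mem_ball, Real.dist_eq] at ht
      by_cases hy : y ∈ closedBall (0 : Euc n) (R + (|τ| + 1) * ‖w‖)
      · rw [indicator_of_mem hy, norm_neg]
        exact ((fderiv ℝ Φ (y - t • w)).le_opNorm w).trans (by gcongr; exact hL _)
      · rw [indicator_of_notMem hy]
        have : y - t • w ∉ tsupport (fderiv ℝ Φ) := fun h => by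
          apply hy
          have h1 := hR h
          simp only [mem_closedBall, dist_zero_right] at h1 ⊢
          have h2 : ‖y‖ ≤ ‖y - t • w‖ + ‖t • w‖ := by simpa using norm_add_le (y - t • w) (t • w)
          rw [norm_smul, Real.norm_eq_abs] at h2
          have h3 : |t| ≤ |τ| + 1 := by
            have := abs_add_le (t - τ) τ; rw [sub_add_cancel] at this; linarith
          have := mul_le_mul_of_nonneg_right h3 (norm_nonneg w)
          linarith
        rw [image_eq_zero_of_notMem_tsupport this]; simp
    · refine Integrable.restrict ?_
      rw [integrable_indicator_iff measurableSet_closedBall]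
      exact integrableOn_const (isCompact_closedBall _ _).measure_lt_top.ne
    · refine Eventually.of_forall fun y t _ => ?_
      have h1 : HasDerivAt (fun t : ℝ => y - t • w) (-w) t := by
        simpa using ((hasDerivAt_id t).smul_const w).const_sub y
      have h2 := (hd (y - t • w)).hasFDerivAt.comp_hasDerivAt t h1
      rw [map_neg] at h2
      exact h2
  obtain ⟨τ, hτ, h⟩ := exists_hasDerivAt_eq_slope _ _ (zero_lt_one (α := ℝ))
    (fun τ _ => (key τ).continuousAt.continuousWithinAt) (fun τ _ => key τ)
  refine ⟨τ, hτ, ?_⟩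
  simp only [one_smul, zero_smul, sub_zero, div_one] at h
  rw [← h, integral_neg]
  simp only [fderiv_shift]

def IsNormal (σ : Measure (Euc n)) (Ω : Set (Euc n)) (x ν : Euc n) : Prop :=
  ∀ η > 0, ∃ r₀ > 0, ∀ r, 0 < r → r < r₀ → ∀ φ, IsTest (ball x r) φ → ∀ B, (∀ y, |φ y| ≤ B) →
    ∀ w : Euc n, |(∫ y in Ω, fderiv ℝ φ y w) - inner ℝ ν w * ∫ y, φ y ∂σ| ≤ η * ‖w‖ * B * r ^ (n - 1)

def mo (Ω : Set (Euc n)) (b : Euc n → ℝ) (s : ℝ) (y : Euc n) : ℝ := ∫ z in Ω, bmp b y s z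

theorem bmp_shift (b : Euc n → ℝ) (y w : Euc n) (s : ℝ) (z : Euc n) :
    bmp b (y + w) s z = bmp b y s (z - w) := by
  simp only [bmp]; congr 3; abel

theorem moll {σ : Measure (Euc n)} {Ω : Set (Euc n)} {x ν : Euc n} (hν : IsNormal σ Ω x ν)
    (hn : 1 ≤ n) {b : Euc n → ℝ} (hb : IsTest (ball 0 1) b) {θ δ : ℝ} (hθ : 0 < θ) (hθ1 : θ ≤ 1/4) (hδ : 0 < δ) :
    ∃ r₀ > 0, ∀ r, 0 < r → r < r₀ → ∀ y w, dist y x ≤ r / 4 → ‖w‖ ≤ r / 2 →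
      ∃ τ ∈ Ioo (0:ℝ) 1, |mo Ω b (θ * r) (y + w) - mo Ω b (θ * r) y +
        inner ℝ ν w * ∫ z, bmp b (y + τ • w) (θ * r) z ∂σ| ≤ δ := by
  obtain ⟨B, hB0, hB⟩ := hb.bdd
  obtain ⟨r₀, hr₀, H⟩ := hν (δ * θ ^ n / (B + 1)) (by positivity)
  refine ⟨r₀, hr₀, fun r hr hrr y w hy hw => ?_⟩
  have hs : 0 < θ * r := by positivity
  obtain ⟨τ, hτ, h⟩ := shift_mvt (Ω := Ω) (bmp_test hb y hs) w
  refine ⟨τ, hτ, ?_⟩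
  have e1 : mo Ω b (θ * r) (y + w) = ∫ z in Ω, bmp b y (θ * r) (z - w) := by
    simp only [mo, bmp_shift]
  have e2 : (fun z => bmp b y (θ * r) (z - τ • w)) = bmp b (y + τ • w) (θ * r) := by
    funext z; rw [bmp_shift]
  rw [e2] at h
  rw [e1, mo, h]
  have ht := (bmp_test hb (y + τ • w) hs).mono (V := ball x r) (by
    apply ball_subset_ball'
    have h1 : dist (y + τ • w) x ≤ dist y x + ‖τ • w‖ := by
      rw [dist_eq_norm, dist_eq_norm]
      have : y + τ • w - x = (y - x) + τ • w := by abel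
      rw [this]; exact norm_add_le _ _
    rw [norm_smul, Real.norm_eq_abs, abs_of_pos hτ.1] at h1
    have h2 : τ * ‖w‖ ≤ 1 * ‖w‖ := by gcongr; exact hτ.2.le
    have h3 : θ * r ≤ 1/4 * r := by gcongr
    linarith)
  have h4 := H r hr hrr _ ht (((θ * r)^n)⁻¹ * B) (fun z => by
    rw [bmp, abs_mul, abs_of_pos (by positivity)]; gcongr; exact hB _) w
  rw [← abs_neg]
  refine le_trans (le_of_eq (by congr 1; ring)) (h4.trans ?_)
  have h5 : r ^ n = r ^ (n-1) * r := by rw [← pow_succ]; congr 1; omega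
  calc δ * θ ^ n / (B + 1) * ‖w‖ * (((θ * r) ^ n)⁻¹ * B) * r ^ (n - 1)
      = δ * (B / (B + 1)) * (‖w‖ / r) := by rw [mul_pow, h5]; field_simp
    _ ≤ δ * 1 * 1 := by
        gcongr
        · rw [div_le_one (by positivity)]; linarith
        · rw [div_le_one hr]; linarith
    _ = δ := by ring

theorem bmp_integrable {b : Euc n → ℝ} (hb : IsTest (ball 0 1) b) (y : Euc n) {s : ℝ} (hs : 0 < s) :
    Integrable (bmp b y s) volume :=
  (bmp_test hb y hs).smooth.continuous.integrable_of_hasCompactSupport (bmp_test hb y hs).cpt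

theorem bmp_nonneg {b : Euc n → ℝ} (h0 : ∀ x, 0 ≤ b x) (y : Euc n) {s : ℝ} (hs : 0 < s) (z) :
    0 ≤ bmp b y s z := mul_nonneg (by positivity) (h0 _)

theorem bmp_int {b : Euc n → ℝ} (h1 : ∫ x, b x = 1) (y : Euc n) {s : ℝ} (hs : 0 < s) :
    ∫ z, bmp b y s z = 1 := by
  rw [integral_affine _ y hs, ← h1, smul_eq_mul, ← integral_const_mul]
  congr 1; funext z
  simp only [bmp, add_sub_cancel_left, smul_smul, inv_mul_cancel₀ hs.ne', one_smul]
  field_simp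

theorem mo_nonneg {Ω : Set (Euc n)} {b : Euc n → ℝ} (h0 : ∀ x, 0 ≤ b x) {s : ℝ} (hs : 0 < s) (y) :
    0 ≤ mo Ω b s y := integral_nonneg fun z => bmp_nonneg h0 y hs z

theorem mo_le_one {Ω : Set (Euc n)} {b : Euc n → ℝ} (hb : IsTest (ball 0 1) b) (h0 : ∀ x, 0 ≤ b x)
    (h1 : ∫ x, b x = 1) {s : ℝ} (hs : 0 < s) (y) : mo Ω b s y ≤ 1 := by
  rw [← bmp_int h1 y hs]
  exact setIntegral_le_integral (bmp_integrable hb y hs) (Eventually.of_forall fun z => bmp_nonneg h0 y hs z)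

theorem mo_zero {Ω : Set (Euc n)} (hΩ : IsOpen Ω) {b : Euc n → ℝ} (hb : IsTest (ball 0 1) b) {s : ℝ} (hs : 0 < s) (y : Euc n)
    (h : Disjoint (ball y s) Ω) : mo Ω b s y = 0 := by
  refine setIntegral_eq_zero_of_forall_eq_zero fun z hz => ?_
  exact image_eq_zero_of_notMem_tsupport fun h' => h.le_bot ⟨(bmp_test hb y hs).supp h', hz⟩

theorem mo_one {Ω : Set (Euc n)} {b : Euc n → ℝ} (hb : IsTest (ball 0 1) b)
    (h1 : ∫ x, b x = 1) {s : ℝ} (hs : 0 < s) (y) (h : ball y s ⊆ Ω) : mo Ω b s y = 1 := by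
  rw [← bmp_int h1 y hs]
  refine setIntegral_eq_integral_of_forall_compl_eq_zero fun z hz => ?_
  exact image_eq_zero_of_notMem_tsupport fun h' => hz (h ((bmp_test hb y hs).supp h'))

theorem mo_cases {Ω : Set (Euc n)} (hΩ : IsOpen Ω) {b : Euc n → ℝ} (hb : IsTest (ball 0 1) b)
    (h1 : ∫ x, b x = 1) {s : ℝ} (hs : 0 < s) (y) (h : Disjoint (ball y s) (frontier Ω)) :
    (mo Ω b s y = 0 ∧ Disjoint (ball y s) Ω) ∨ (mo Ω b s y = 1 ∧ ball y s ⊆ Ω) := by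
  by_cases hd : Disjoint (ball y s) Ω
  · exact Or.inl ⟨mo_zero hΩ hb hs y hd, hd⟩
  · by_cases hd' : ball y s ⊆ Ω
    · exact Or.inr ⟨mo_one hb h1 hs y hd', hd'⟩
    · exfalso
      have hp : IsPreconnected (ball y s) := (convex_ball y s).isPreconnected
      have h3 : ∀ z ∈ ball y s, z ∉ Ω → z ∉ closure Ω := fun z hz hzo hzc =>
        h.le_bot ⟨hz, by rw [hΩ.frontier_eq]; exact ⟨hzc, hzo⟩⟩
      obtain ⟨z, hz, hzo⟩ := not_subset.1 hd'
      obtain ⟨q, -, hq1, hq2⟩ := hp Ω (closure Ω)ᶜ hΩ isClosed_closure.isOpen_compl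
        (fun q hq => by
          by_cases hqo : q ∈ Ω
          · exact Or.inl hqo
          · exact Or.inr (h3 q hq hqo)) (not_disjoint_iff_nonempty_inter.1 hd) ⟨z, hz, h3 z hz hzo⟩
      exact hq2 (subset_closure hq1)
end

open MeasureTheory Metric Set Filter
open scoped ENNReal NNReal Topology

/-! ### Part 7: the approximate normal does not vanish on the measure theoretic boundary -/
noncomputable section
variable {n : ℕ}

theorem free_ball {Ω : Set (Euc n)} {σ : Measure (Euc n)} {D c C : ℝ} (G : Geo Ω σ D c C) :
    ∃ θ > 0, θ ≤ 1/4 ∧ ∀ x ∈ frontier Ω, ∀ r, 0 < r → r < D →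
      ∃ y ∈ ball x (r / 4), Disjoint (ball y (θ * r)) (frontier Ω) := by
  have hc := G.hc
  have hC := G.hC
  have hn := G.hn
  set θ := min (1/4) (c / (2 * 8 ^ n * C)) with hθ
  have hθ0 : 0 < θ := by rw [hθ]; positivity
  have hθ1 : θ ≤ 1/4 := min_le_left _ _
  refine ⟨θ, hθ0, hθ1, fun x hx r hr hrD => ?_⟩
  by_contra hcon
  push Not at hcon
  set s := θ * r with hs
  have hs0 : 0 < s := by positivity
  have hsr : s ≤ r / 4 := by rw [hs]; nlinarith
  have hfin : IsFiniteMeasure (σ.restrict (ball x r)) := ⟨by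
    rw [Measure.restrict_apply_univ]; exact (G.hi x hx r hr hrD).trans_lt ENNReal.ofReal_lt_top⟩
  have hlow : ∀ y ∈ ball x (r/4), ENNReal.ofReal (c * s ^ (n-1)) ≤ ∫⁻ z in ball x r, (ball (0:Euc n) (2*s)).indicator 1 (z - y) ∂σ := by
    intro y hy
    obtain ⟨z, hz1, hz2⟩ := not_disjoint_iff.1 (hcon y hy)
    refine (G.lo z hz2 s hs0 (by linarith)).trans ?_
    have : ∀ q, (ball (0:Euc n) (2*s)).indicator (1 : Euc n → ℝ≥0∞) (q - y) = (ball y (2*s)).indicator 1 q := by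
      intro q
      simp only [indicator, mem_ball, dist_eq_norm, Pi.one_apply, sub_zero]
    simp only [this]
    rw [lintegral_indicator_one measurableSet_ball, Measure.restrict_apply measurableSet_ball]
    refine measure_mono fun q hq => ?_
    rw [mem_ball] at *
    have h1 := dist_triangle q z y
    have h2 := dist_triangle q y x
    exact ⟨by rw [mem_ball]; linarith, by rw [mem_ball]; linarith⟩
  have hmeas : Measurable (fun p : Euc n × Euc n => (ball (0:Euc n) (2*s)).indicator (1 : Euc n → ℝ≥0∞) (p.2 - p.1)) :=
    (measurable_one.indicator measurableSet_ball).comp (by fun_prop)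
  have h1 : ENNReal.ofReal (c * s^(n-1)) * volume (ball x (r/4)) ≤
      ∫⁻ y in ball x (r/4), (∫⁻ z in ball x r, (ball (0:Euc n) (2*s)).indicator 1 (z - y) ∂σ) := by
    rw [← setLIntegral_const]
    exact setLIntegral_mono' measurableSet_ball hlow
  rw [lintegral_lintegral_swap hmeas.aemeasurable] at h1
  have h2 : ∫⁻ z in ball x r, (∫⁻ y in ball x (r/4), (ball (0:Euc n) (2*s)).indicator (1 : Euc n → ℝ≥0∞) (z - y)) ∂σ ≤
      ENNReal.ofReal ((2*s)^n) * volume (ball (0:Euc n) 1) * σ (ball x r) := by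
    rw [← setLIntegral_const]
    refine lintegral_mono fun z => ?_
    have : ∀ y, (ball (0:Euc n) (2*s)).indicator (1 : Euc n → ℝ≥0∞) (z - y) = (ball z (2*s)).indicator 1 y := by
      intro q
      simp only [indicator, mem_ball, dist_eq_norm, Pi.one_apply, sub_zero, norm_sub_rev z q]
    simp only [this]
    rw [lintegral_indicator_one measurableSet_ball, ← vol_ball z (by positivity)]
    exact Measure.restrict_apply_le _ _
  have h3 := h1.trans (h2.trans (mul_le_mul_right (G.hi x hx r hr hrD) _))
  rw [vol_ball x (by positivity)] at h3
  have hV0 : volume (ball (0:Euc n) 1) ≠ 0 := (measure_ball_pos _ _ one_pos).ne'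
  have hVt : volume (ball (0:Euc n) 1) ≠ ⊤ := measure_ball_lt_top.ne
  have h4 : ENNReal.ofReal (c * s^(n-1)) * ENNReal.ofReal ((r/4)^n) ≤
      ENNReal.ofReal ((2*s)^n) * ENNReal.ofReal (C * r^(n-1)) := by
    rw [← ENNReal.mul_le_mul_iff_left hV0 hVt]
    refine (le_of_eq ?_).trans (h3.trans (le_of_eq ?_)) <;> ring
  rw [← ENNReal.ofReal_mul (by positivity), ← ENNReal.ofReal_mul (by positivity),
    ENNReal.ofReal_le_ofReal_iff (by positivity)] at h4
  have e1 : s ^ n = s ^ (n-1) * s := by rw [← pow_succ]; congr 1; omega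
  have e2 : r ^ n = r ^ (n-1) * r := by rw [← pow_succ]; congr 1; omega
  have e3 : (8:ℝ)^n = 4^n * 2^n := by rw [← mul_pow]; norm_num
  rw [mul_pow 2 s, div_pow, e1, e2] at h4
  have h5 : c * 1 ≤ C * 8 ^ n * θ := by
    have hp : 0 < s^(n-1) * r^(n-1) * r / 4^n := by positivity
    refine le_of_mul_le_mul_right ?_ hp
    calc c * 1 * (s^(n-1) * r^(n-1) * r / 4^n) = c * s ^ (n - 1) * (r ^ (n - 1) * r / 4 ^ n) := by ring
      _ ≤ _ := h4
      _ = _ := by rw [hs, e3]; field_simp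
  have h6 : θ ≤ c / (2 * 8 ^ n * C) := min_le_right _ _
  rw [le_div_iff₀ (by positivity)] at h6
  nlinarith

theorem mo_cont (Ω : Set (Euc n)) {b : Euc n → ℝ} (hb : IsTest (ball 0 1) b) (x : Euc n) (s₀ : ℝ) :
    ContinuousOn (fun s => mo Ω b s x) (Ioo 0 s₀) := by
  refine continuousOn_integral_of_compact_support (k := closedBall x s₀) (f := fun s z => bmp b x s z)
    (isCompact_closedBall _ _) ?_ ?_
  · have hbc := hb.smooth.continuous
    unfold bmp Function.uncurry
    have h1 : ContinuousOn (fun p : ℝ × Euc n => p.1⁻¹) (Ioo 0 s₀ ×ˢ univ) :=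
      continuousOn_fst.inv₀ fun p hp => hp.1.1.ne'
    refine ContinuousOn.mul ?_ (hbc.comp_continuousOn (h1.smul (by fun_prop)))
    exact (continuousOn_fst.pow n).inv₀ fun p hp => pow_ne_zero _ hp.1.1.ne'
  · intro s z hs hz
    refine image_eq_zero_of_notMem_tsupport fun h' => hz ?_
    exact ball_subset_closedBall (ball_subset_ball hs.2.le ((bmp_test hb x hs.1).supp h'))

theorem mo_ge {A : Set (Euc n)} (hA : MeasurableSet A) {b : Euc n → ℝ} (hb : IsTest (ball 0 1) b) (h0 : ∀ x, 0 ≤ b x)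
    {cb : ℝ} (hcb : 0 < cb) (hbc : ∀ x, ‖x‖ ≤ 1/2 → cb ≤ b x) (x : Euc n) {r : ℝ} (hr : 0 < r) :
    volume (A ∩ ball x r) ≤ ENNReal.ofReal (mo A b (2*r) x * (2^n / cb)) * ENNReal.ofReal (r^n) := by
  have hs : 0 < 2 * r := by positivity
  have h1 : ∫ z in A ∩ ball x r, ((2*r)^n)⁻¹ * cb ≤ mo A b (2*r) x := by
    refine le_trans ?_ (setIntegral_mono_set (bmp_integrable hb x hs).integrableOn
      (Eventually.of_forall fun z => bmp_nonneg h0 x hs z) (inter_subset_left (t := ball x r)).eventuallyLE)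
    refine setIntegral_mono_on ?_ (bmp_integrable hb x hs).integrableOn (hA.inter measurableSet_ball) ?_
    · exact integrableOn_const ((measure_mono inter_subset_right).trans_lt measure_ball_lt_top).ne
    · intro z hz
      unfold bmp
      gcongr
      apply hbc
      rw [norm_smul, norm_inv, Real.norm_eq_abs, abs_of_pos hs, inv_mul_le_iff₀ hs]
      have := hz.2
      rw [mem_ball, dist_eq_norm] at this
      linarith
  have hf : volume (A ∩ ball x r) ≠ ⊤ := ((measure_mono inter_subset_right).trans_lt measure_ball_lt_top).ne
  rw [setIntegral_const, smul_eq_mul, measureReal_def] at h1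
  rw [← ENNReal.ofReal_mul (by have := mo_nonneg (Ω := A) h0 hs x; positivity), ← ENNReal.ofReal_toReal hf]
  apply ENNReal.ofReal_le_ofReal
  rw [mul_pow] at h1
  calc _ = ((volume (A ∩ ball x r)).toReal * ((2 ^ n * r ^ n)⁻¹ * cb)) * (2^n/cb) * r^n := by field_simp
    _ ≤ _ := by gcongr

theorem limsup_zero {A : Set (Euc n)} (hA : MeasurableSet A) {b : Euc n → ℝ} (hb : IsTest (ball 0 1) b) (h0 : ∀ x, 0 ≤ b x)
    {cb : ℝ} (hcb : 0 < cb) (hbc : ∀ x, ‖x‖ ≤ 1/2 → cb ≤ b x) (x : Euc n)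
    (h : ∀ δ > 0, ∃ s₀ > 0, ∀ s, 0 < s → s < s₀ → mo A b s x ≤ δ) :
    ¬ 0 < limsup (fun r : ℝ => volume (A ∩ ball x r) / ENNReal.ofReal (r ^ n)) (𝓝[>] 0) := by
  rw [not_lt]
  refine ENNReal.le_of_forall_pos_le_add fun ε hε _ => ?_
  rw [zero_add]
  have hε' : (0:ℝ) < ε := hε
  obtain ⟨s₀, hs₀, H⟩ := h (ε * (cb / 2^n)) (by positivity)
  refine limsup_le_of_le (h := ?_)
  filter_upwards [Ioo_mem_nhdsGT (show (0:ℝ) < s₀ / 2 by positivity)] with r hr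
  have hr0 := hr.1
  refine ENNReal.div_le_of_le_mul ((mo_ge hA hb h0 hcb hbc x hr0).trans ?_)
  gcongr
  rw [← ENNReal.ofReal_coe_nnreal]
  apply ENNReal.ofReal_le_ofReal
  have := H (2*r) (by positivity) (by linarith [hr.2])
  calc _ ≤ (ε * (cb / 2^n)) * (2^n/cb) := by gcongr
    _ = ε := by field_simp

theorem mo_compl {Ω : Set (Euc n)} (hΩ : MeasurableSet Ω) {b : Euc n → ℝ} (hb : IsTest (ball 0 1) b)
    (h1 : ∫ x, b x = 1) {s : ℝ} (hs : 0 < s) (y : Euc n) : mo Ωᶜ b s y = 1 - mo Ω b s y := by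
  have := integral_add_compl hΩ (bmp_integrable hb y hs)
  rw [bmp_int h1 y hs] at this
  simp only [mo]; linarith

theorem normal_ne_zero {Ω : Set (Euc n)} {σ : Measure (Euc n)} {D c C : ℝ} (G : Geo Ω σ D c C) {x ν : Euc n}
    (hx : x ∈ frontier Ω) (hm : x ∈ mtBoundary n Ω) (hν : IsNormal σ Ω x ν) : ν ≠ 0 := by
  rintro rfl
  have hΩm := G.op.measurableSet
  obtain ⟨b, hb, h0, h1, cb, hcb, hbc⟩ := exists_bump n
  obtain ⟨θ, hθ, hθ1, hfree⟩ := free_ball G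
  have key : ∀ δ > 0, ∃ s₀ > 0, ∀ s, 0 < s → s < s₀ → mo Ω b s x ≤ δ ∨ 1 - δ ≤ mo Ω b s x := by
    intro δ hδ
    obtain ⟨r₀, hr₀, H⟩ := moll hν (by linarith [G.hn]) hb hθ hθ1 hδ
    refine ⟨θ * min r₀ D, mul_pos hθ (lt_min hr₀ G.hD), fun s hs hss => ?_⟩
    set r := s / θ with hr
    have hsr : θ * r = s := by rw [hr]; field_simp
    have hr0 : 0 < r := by positivity
    have hr1 : r < min r₀ D := by rw [hr, div_lt_iff₀ hθ]; linarith
    obtain ⟨y, hy, hyd⟩ := hfree x hx r hr0 (hr1.trans_le (min_le_right _ _))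
    rw [mem_ball, dist_eq_norm] at hy
    obtain ⟨τ, -, hτ⟩ := H r hr0 (hr1.trans_le (min_le_left _ _)) x (y - x) (by simp; positivity) (by linarith)
    rw [inner_zero_left, zero_mul, add_zero, add_sub_cancel, hsr, abs_le] at hτ
    rw [hsr] at hyd
    rcases mo_cases G.op hb h1 hs y hyd with h | h
    · left; rw [h.1] at hτ; linarith
    · right; rw [h.1] at hτ; linarith
  obtain ⟨s₀, hs₀, H0⟩ := key (1/4) (by norm_num)
  have side : (∀ s, 0 < s → s < s₀ → mo Ω b s x ≤ 1/4) ∨ (∀ s, 0 < s → s < s₀ → 3/4 ≤ mo Ω b s x) := by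
    by_contra hcon
    push Not at hcon
    obtain ⟨⟨s, hs, hs', hs1⟩, t, ht, ht', ht1⟩ := hcon
    have himg : IsPreconnected ((fun s => mo Ω b s x) '' Ioo 0 s₀) :=
      isPreconnected_Ioo.image _ (mo_cont Ω hb x s₀)
    have h2 : 3/4 ≤ mo Ω b s x := by rcases H0 s hs hs' with h | h <;> linarith
    have h3 : mo Ω b t x ≤ 1/4 := by rcases H0 t ht ht' with h | h <;> linarith
    obtain ⟨q, hq, hq'⟩ := himg.Icc_subset ⟨t, ⟨ht, ht'⟩, rfl⟩ ⟨s, ⟨hs, hs'⟩, rfl⟩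
      (show (1/2:ℝ) ∈ _ from ⟨by dsimp only; linarith, by dsimp only; linarith⟩)
    dsimp only at hq'
    rcases H0 q hq.1 hq.2 with h | h <;> linarith
  rcases side with hs | hs
  · refine limsup_zero hΩm hb h0 hcb hbc x (fun δ hδ => ?_) hm.1
    obtain ⟨s₁, hs₁, H1⟩ := key (min δ (1/4)) (by positivity)
    refine ⟨min s₀ s₁, lt_min hs₀ hs₁, fun s hs0 hss => ?_⟩
    have h2 := hs s hs0 (hss.trans_le (min_le_left _ _))
    have h4 := min_le_right δ (1/4)
    have h5 := min_le_left δ (1/4)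
    rcases H1 s hs0 (hss.trans_le (min_le_right _ _)) with h | h <;> linarith
  · refine limsup_zero hΩm.compl hb h0 hcb hbc x (fun δ hδ => ?_) hm.2
    obtain ⟨s₁, hs₁, H1⟩ := key (min δ (1/4)) (by positivity)
    refine ⟨min s₀ s₁, lt_min hs₀ hs₁, fun s hs0 hss => ?_⟩
    have h2 := hs s hs0 (hss.trans_le (min_le_left _ _))
    have h4 := min_le_right δ (1/4)
    have h5 := min_le_left δ (1/4)
    rw [mo_compl hΩm hb h1 hs0]
    rcases H1 s hs0 (hss.trans_le (min_le_right _ _)) with h | h <;> linarith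
end

open MeasureTheory Metric Set Filter
open scoped ENNReal NNReal Topology

/-! ### Part 8: flatness of the boundary at points with a nonzero normal -/
noncomputable section
variable {n : ℕ}

theorem Geo.fin {Ω : Set (Euc n)} {σ : Measure (Euc n)} {D c C : ℝ} (G : Geo Ω σ D c C) {x : Euc n}
    (hx : x ∈ frontier Ω) {r : ℝ} (hr : 0 < r) (hrD : r < D) : IsFiniteMeasure (σ.restrict (ball x r)) := ⟨by
    rw [Measure.restrict_apply_univ]; exact (G.hi x hx r hr hrD).trans_lt ENNReal.ofReal_lt_top⟩

theorem Geo.integrable {Ω : Set (Euc n)} {σ : Measure (Euc n)} {D c C : ℝ} (G : Geo Ω σ D c C) {x : Euc n}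
    (hx : x ∈ frontier Ω) {r : ℝ} (hr : 0 < r) (hrD : r < D) {φ : Euc n → ℝ} (hφ : IsTest (ball x r) φ) :
    Integrable φ σ := by
  have := G.fin hx hr hrD
  rw [← integrableOn_iff_integrable_of_support_subset (subset_closure.trans hφ.supp)]
  exact (hφ.memLp (σ.restrict (ball x r)) 1).integrable le_rfl

theorem Geo.real_lo {Ω : Set (Euc n)} {σ : Measure (Euc n)} {D c C : ℝ} (G : Geo Ω σ D c C) {x : Euc n}
    (hx : x ∈ frontier Ω) {r : ℝ} (hr : 0 < r) (hrD : r < D) : c * r ^ (n-1) ≤ σ.real (ball x r) := by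
  rw [measureReal_def]
  refine (ENNReal.ofReal_le_iff_le_toReal ?_).1 (G.lo x hx r hr hrD)
  exact ((G.hi x hx r hr hrD).trans_lt ENNReal.ofReal_lt_top).ne

theorem Geo.real_hi {Ω : Set (Euc n)} {σ : Measure (Euc n)} {D c C : ℝ} (G : Geo Ω σ D c C) {x : Euc n}
    (hx : x ∈ frontier Ω) {r : ℝ} (hr : 0 < r) (hrD : r < D) : σ.real (ball x r) ≤ C * r ^ (n-1) := by
  rw [measureReal_def]
  exact ENNReal.toReal_le_of_le_ofReal (by have := G.hC; positivity) (G.hi x hx r hr hrD)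

/-- the (inner) unit normal -/
def unv (ν : Euc n) : Euc n := -(‖ν‖⁻¹ • ν)

theorem unv_norm {ν : Euc n} (h : ν ≠ 0) : ‖unv ν‖ = 1 := by
  rw [unv, norm_neg, norm_smul, norm_inv, norm_norm, inv_mul_cancel₀ (norm_ne_zero_iff.2 h)]

theorem unv_inner {ν : Euc n} (h : ν ≠ 0) (w : Euc n) : inner ℝ ν w = -(‖ν‖ * inner ℝ (unv ν) w) := by
  rw [unv, inner_neg_left, real_inner_smul_left]
  have := norm_ne_zero_iff.2 h
  field_simp

theorem moll2 {Ω : Set (Euc n)} {σ : Measure (Euc n)} {D c C : ℝ} (G : Geo Ω σ D c C) {x ν : Euc n}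
    (hx : x ∈ frontier Ω) (hν : IsNormal σ Ω x ν) (hν0 : ν ≠ 0)
    {b : Euc n → ℝ} (hb : IsTest (ball 0 1) b) (h0 : ∀ x, 0 ≤ b x)
    {cb : ℝ} (hcb : 0 < cb) (hbc : ∀ x, ‖x‖ ≤ 1/2 → cb ≤ b x) :
    ∃ k > 0, ∀ θ δ : ℝ, 0 < θ → θ ≤ 1/4 → 0 < δ → ∃ r₀ > 0, ∀ r, 0 < r → r < r₀ →
      (∀ y y', dist y x ≤ r/4 → dist y' x ≤ r/4 → inner ℝ (unv ν) y ≤ inner ℝ (unv ν) y' →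
        mo Ω b (θ * r) y - δ ≤ mo Ω b (θ * r) y') ∧
      (∀ p ∈ frontier Ω, dist p x ≤ r/8 → mo Ω b (θ * r) (p - (θ * r / 4) • unv ν) + k - δ ≤
        mo Ω b (θ * r) (p + (θ * r / 4) • unv ν)) := by
  have hn := G.hn
  have hc := G.hc
  have hνp := norm_pos_iff.2 hν0
  have he := unv_norm hν0
  set e := unv ν with hedef
  refine ⟨‖ν‖ / 2 * (cb * (c * (1/4)^(n-1))), by positivity, fun θ δ hθ hθ1 hδ => ?_⟩
  obtain ⟨r₀, hr₀, H⟩ := moll hν (by linarith) hb hθ hθ1 hδ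
  refine ⟨min r₀ D, lt_min hr₀ G.hD, fun r hr hrr => ?_⟩
  have hrr₀ := hrr.trans_le (min_le_left _ _)
  have hrD := hrr.trans_le (min_le_right _ _)
  set s := θ * r with hs
  have hs0 : 0 < s := by positivity
  have hsr : s ≤ r / 4 := by rw [hs]; nlinarith
  constructor
  · intro y y' hy hy' hyy
    obtain ⟨τ, hτ, h⟩ := H r hr hrr₀ y (y' - y) hy (by
      rw [← dist_eq_norm]; linarith [dist_triangle_right y' y x])
    rw [add_sub_cancel, unv_inner hν0, abs_le] at h
    have h1 : 0 ≤ ∫ z, bmp b (y + τ • (y' - y)) s z ∂σ := integral_nonneg fun z => bmp_nonneg h0 _ hs0 z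
    have h2 : 0 ≤ inner ℝ e (y' - y) := by rw [inner_sub_right]; linarith
    have := mul_nonneg (mul_nonneg hνp.le h2) h1
    linarith
  · intro p hp hpx
    have hd1 : ∀ t : ℝ, |t| ≤ s/4 → dist (p + t • e) p ≤ s/4 := fun t ht => by
      rw [dist_eq_norm, add_sub_cancel_left, norm_smul, he, mul_one]; exact ht
    have hd2 : ∀ t : ℝ, |t| ≤ s/4 → dist (p + t • e) x ≤ r/8 + s/4 := fun t ht => by
      linarith [dist_triangle (p + t • e) p x, hd1 t ht]
    obtain ⟨τ, hτ, h⟩ := H r hr hrr₀ (p + (-(s/4)) • e) ((s/2) • e) (by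
      have := hd2 (-(s/4)) (by rw [abs_neg, abs_of_pos (by positivity)]); linarith) (by
      rw [norm_smul, he, Real.norm_eq_abs, abs_of_pos (by positivity)]; linarith)
    have e1 : p + (-(s/4)) • e + (s/2) • e = p + (s/4) • e := by
      rw [add_assoc, ← add_smul]; congr 2; ring
    have e2 : p + (-(s/4)) • e + τ • (s/2) • e = p + (τ * (s/2) - s/4) • e := by
      rw [add_assoc, smul_smul, ← add_smul]; congr 2; ring
    have e3 : p + (-(s/4)) • e = p - (s/4) • e := by rw [neg_smul, sub_eq_add_neg]
    rw [e1, e2, e3, unv_inner hν0, real_inner_smul_right, real_inner_self_eq_norm_sq, he, abs_le] at h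
    have ht : |τ * (s/2) - s/4| ≤ s/4 := by
      rw [abs_le]; constructor <;> nlinarith [hτ.1, hτ.2]
    set q := p + (τ * (s/2) - s/4) • e with hq
    have hqp := hd1 _ ht
    have hqx := hd2 _ ht
    rw [← hq] at hqp hqx
    have htest : IsTest (ball x r) (bmp b q s) := (bmp_test hb q hs0).mono (ball_subset_ball' (by linarith))
    have hI : cb * (c * (1/4)^(n-1)) ≤ s * ∫ z, bmp b q s z ∂σ := by
      have hintg := G.integrable hx hr hrD htest
      have h3 : ∫ z in ball p (s/4), ((s^n)⁻¹ * cb) ∂σ ≤ ∫ z, bmp b q s z ∂σ := by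
        refine le_trans ?_ (setIntegral_le_integral (s := ball p (s/4)) hintg (Eventually.of_forall fun z => bmp_nonneg h0 _ hs0 z))
        have := G.fin hp (r := s/4) (by positivity) (by linarith)
        refine setIntegral_mono_on ?_ hintg.integrableOn measurableSet_ball ?_
        · exact integrable_const _
        · intro z hz
          unfold bmp
          gcongr
          apply hbc
          rw [norm_smul, norm_inv, Real.norm_eq_abs, abs_of_pos hs0, inv_mul_le_iff₀ hs0, ← dist_eq_norm]
          rw [mem_ball] at hz
          linarith [dist_triangle_right z q p]
      rw [setIntegral_const, smul_eq_mul] at h3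
      have h4 := G.real_lo hp (r := s/4) (by positivity) (by linarith)
      have h5 : s ^ n = s ^ (n-1) * s := by rw [← pow_succ]; congr 1; omega
      calc cb * (c * (1/4)^(n-1)) = s * ((c * (s/4)^(n-1)) * ((s^n)⁻¹ * cb)) := by
            rw [h5, div_pow, div_pow]; field_simp; simp
        _ ≤ s * (σ.real (ball p (s/4)) * ((s^n)⁻¹ * cb)) := by gcongr
        _ ≤ _ := by gcongr
    have := mul_le_mul_of_nonneg_left hI (show 0 ≤ ‖ν‖/2 by positivity)
    nlinarith [h.1]

theorem flat {Ω : Set (Euc n)} {σ : Measure (Euc n)} {D c C : ℝ} (G : Geo Ω σ D c C) {x ν : Euc n}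
    (hx : x ∈ frontier Ω) (hν : IsNormal σ Ω x ν) (hν0 : ν ≠ 0) {η : ℝ} (hη : 0 < η) (hη1 : η ≤ 1/16) :
    ∃ r₀ > 0, ∀ r, 0 < r → r < r₀ → ∀ p ∈ frontier Ω, ∀ q ∈ frontier Ω, dist p x ≤ r/16 → dist q x ≤ r/16 →
      inner ℝ (unv ν) q - inner ℝ (unv ν) p ≤ η * r := by
  obtain ⟨b, hb, h0, h1, cb, hcb, hbc⟩ := exists_bump n
  obtain ⟨k, hk, H⟩ := moll2 G hx hν hν0 hb h0 hcb hbc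
  obtain ⟨J, hJ⟩ := exists_nat_gt (2 / k)
  have hJ' : 2 < J * k := by rwa [div_lt_iff₀ hk] at hJ
  have he := unv_norm hν0
  set e := unv ν with hedef
  have hee : inner ℝ e e = (1:ℝ) := by rw [real_inner_self_eq_norm_sq, he]; norm_num
  set θ := η / (4 * J + 10) with hθ
  have hθ0 : 0 < θ := by positivity
  have hθ1 : θ ≤ 1/4 := by
    rw [hθ, div_le_iff₀ (by positivity)]
    have : (0:ℝ) ≤ J := by positivity
    linarith
  obtain ⟨r₀, hr₀, H1⟩ := H θ (k/16) hθ0 hθ1 (by positivity)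
  refine ⟨r₀, hr₀, fun r hr hrr p hp q hq hpx hqx => ?_⟩
  obtain ⟨mono, jump⟩ := H1 r hr hrr
  by_contra hcon
  push Not at hcon
  set s := θ * r with hs
  have hs0 : 0 < s := by positivity
  have hsJ : (4 * J + 10) * s = η * r := by rw [hs, hθ]; field_simp
  have hηr : η * r ≤ r / 16 := by nlinarith
  have hdist : ∀ (z : Euc n) (t : ℝ), dist (z + t • e) x ≤ dist z x + |t| := fun z t => by
    have : dist (z + t • e) z = |t| := by
      rw [dist_eq_norm, add_sub_cancel_left, norm_smul, he, mul_one, Real.norm_eq_abs]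
    linarith [dist_triangle (z + t • e) z x]
  have hinn : ∀ (z : Euc n) (t : ℝ), inner ℝ e (z + t • e) = inner ℝ e z + t := fun z t => by
    rw [inner_add_right, real_inner_smul_right, hee, mul_one]
  have hsub : ∀ z : Euc n, z - (s/4) • e = z + (-(s/4)) • e := fun z => by rw [neg_smul, sub_eq_add_neg]
  simp only [hsub] at jump
  have hs4 : |-(s/4)| = s/4 := by rw [abs_neg, abs_of_pos (by positivity)]
  have hs4' : |s/4| = s/4 := by rw [abs_of_pos (by positivity)]
  have hJ0 : (0:ℝ) ≤ J := by positivity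
  have hJs : (0:ℝ) ≤ J * s := by positivity
  have claim : ∀ i : ℕ, i ≤ J → (i + 1) * (k / 2) ≤ mo Ω b s (p + ((4 * i + 1) * s) • e) := by
    intro i
    induction i with
    | zero =>
      intro _
      have j1 := jump p hp (by linarith)
      have m0 := mo_nonneg (Ω := Ω) h0 hs0 (p + (-(s/4)) • e)
      have hz : |(4 * ((0:ℕ):ℝ) + 1) * s| = s := by rw [Nat.cast_zero, mul_zero, zero_add, one_mul, abs_of_pos hs0]
      have m1 := mono (p + (s/4) • e) (p + ((4 * ((0:ℕ):ℝ) + 1) * s) • e)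
        (by linarith [hdist p (s/4)]) (by have h9 := hdist p ((4 * ((0:ℕ):ℝ) + 1) * s); rw [hz] at h9; exact h9.trans (by linarith))
        (by rw [hinn, hinn, Nat.cast_zero]; linarith)
      rw [Nat.cast_zero] at m1 ⊢
      linarith
    | succ i ih =>
      intro hi
      have ih' := ih (by omega)
      have hiJ : ((i:ℝ) + 1) ≤ J := by exact_mod_cast hi
      have hi0 : (0:ℝ) ≤ i := by positivity
      have hiJs : ((i:ℝ) + 1) * s ≤ J * s := by gcongr
      have his : (0:ℝ) ≤ i * s := by positivity
      have a1 : |(4 * (i:ℝ) + 1) * s| = (4 * (i:ℝ) + 1) * s := abs_of_nonneg (by positivity)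
      have a3 : |(4 * (i:ℝ) + 3) * s| = (4 * (i:ℝ) + 3) * s := abs_of_nonneg (by positivity)
      have a5 : |(4 * ((i+1:ℕ):ℝ) + 1) * s| = (4 * (i:ℝ) + 5) * s := by
        rw [abs_of_nonneg (by positivity)]; push_cast; ring
      have d1 := hdist p ((4 * (i:ℝ) + 1) * s)
      have d3 := hdist p ((4 * (i:ℝ) + 3) * s)
      have d5 := hdist p ((4 * ((i+1:ℕ):ℝ) + 1) * s)
      rw [a1] at d1
      rw [a3] at d3
      rw [a5] at d5
      set y := p + ((4 * (i:ℝ) + 3) * s) • e with hy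
      have hyI : inner ℝ e y = inner ℝ e p + (4 * (i:ℝ) + 3) * s := by rw [hy, hinn]
      have m1 := mono (p + ((4 * (i:ℝ) + 1) * s) • e) y (by linarith) (by linarith)
        (by rw [hinn, hyI]; linarith)
      have ypos : 0 < mo Ω b s y := by
        have : (i:ℝ) * k ≥ 0 := by positivity
        linarith
      have j2 := jump q hq (by linarith)
      have m2 := mono y (q + (-(s/4)) • e) (by linarith) (by linarith [hdist q (-(s/4))])
        (by rw [hyI, hinn q]; linarith)
      have m3 := mo_le_one (Ω := Ω) hb h0 h1 hs0 (q + (s/4) • e)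
      have yone : mo Ω b s y < 1 := by linarith
      have hnd : ¬ Disjoint (ball y s) (frontier Ω) := fun hd => by
        rcases mo_cases G.op hb h1 hs0 y hd with h | h
        · linarith [h.1]
        · linarith [h.1]
      obtain ⟨z, hz, hzS⟩ := not_disjoint_iff.1 hnd
      rw [mem_ball] at hz
      have hzI : |inner ℝ e z - inner ℝ e y| ≤ s := by
        rw [← inner_sub_right]
        refine (abs_real_inner_le_norm _ _).trans ?_
        rw [he, one_mul, ← dist_eq_norm]; exact hz.le
      rw [abs_le] at hzI
      have hzx : dist z x ≤ r/8 := by linarith [dist_triangle z y x]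
      have j3 := jump z hzS hzx
      have m4 := mono (p + ((4 * (i:ℝ) + 1) * s) • e) (z + (-(s/4)) • e) (by linarith)
        (by linarith [hdist z (-(s/4))]) (by rw [hinn, hinn]; linarith)
      have m5 := mono (z + (s/4) • e) (p + ((4 * ((i+1:ℕ):ℝ) + 1) * s) • e)
        (by linarith [hdist z (s/4)]) (by linarith) (by rw [hinn, hinn]; push_cast; linarith)
      have : ((i+1:ℕ):ℝ) = i + 1 := by push_cast; ring
      rw [this] at m5 ⊢
      linarith
  have h2 := claim J le_rfl
  have h3 := mo_le_one (Ω := Ω) hb h0 h1 hs0 (p + ((4 * (J:ℝ) + 1) * s) • e)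
  linarith

def FlatAt (Ω : Set (Euc n)) (x e : Euc n) : Prop :=
  ∀ η > 0, ∃ r₀ > 0, ∀ y, 0 < dist y x → dist y x < r₀ →
    (η * dist y x ≤ inner ℝ e (y - x) → y ∈ Ω) ∧ (inner ℝ e (y - x) ≤ -(η * dist y x) → y ∉ Ω) ∧
    (y ∈ frontier Ω → |inner ℝ e (y - x)| ≤ η * dist y x)

theorem flatAt {Ω : Set (Euc n)} {σ : Measure (Euc n)} {D c C : ℝ} (G : Geo Ω σ D c C) {x ν : Euc n}
    (hx : x ∈ frontier Ω) (hν : IsNormal σ Ω x ν) (hν0 : ν ≠ 0) : FlatAt Ω x (unv ν) := by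
  obtain ⟨b, hb, h0, h1, cb, hcb, hbc⟩ := exists_bump n
  obtain ⟨k, hk, H⟩ := moll2 G hx hν hν0 hb h0 hcb hbc
  have he := unv_norm hν0
  set e := unv ν with hedef
  have hee : inner ℝ e e = (1:ℝ) := by rw [real_inner_self_eq_norm_sq, he]; norm_num
  have F : ∀ η > 0, ∃ r₀ > 0, ∀ y, 0 < dist y x → dist y x < r₀ →
    (y ∈ frontier Ω → |inner ℝ e (y - x)| ≤ η * dist y x) := by
    intro η hη
    obtain ⟨r₀, hr₀, hf⟩ := flat G hx hν hν0 (η := min (η/16) (1/16)) (by positivity) (min_le_right _ _)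
    refine ⟨r₀ / 16, by positivity, fun y hy0 hy hyS => ?_⟩
    have h2 := hf (16 * dist y x) (by positivity) (by linarith) x hx y hyS (by simp) (by linarith)
    have h3 := hf (16 * dist y x) (by positivity) (by linarith) y hyS x hx (by linarith) (by simp)
    have h4 := min_le_left (η/16) (1/16)
    have h5 : min (η/16) (1/16) * (16 * dist y x) ≤ η/16 * (16 * dist y x) := by gcongr
    rw [inner_sub_right, abs_le]
    constructor <;> linarith
  intro η' hη'
  obtain ⟨η, hη, hη1, hηη⟩ : ∃ η > 0, η ≤ 1 ∧ η ≤ η' := ⟨min 1 η', by positivity, min_le_left _ _, min_le_right _ _⟩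
  obtain ⟨ra, hra, Fa⟩ := F (η/2) (by positivity)
  obtain ⟨rb, hrb, Hb⟩ := H (η/64) (k/4) (by positivity) (by linarith) (by positivity)
  refine ⟨min (ra/2) (rb/16), by positivity, fun y hy0 hy => ?_⟩
  have hya := hy.trans_le (min_le_left _ _)
  have hyb := hy.trans_le (min_le_right _ _)
  set d := dist y x with hd
  obtain ⟨mono, jump⟩ := Hb (16 * d) (by positivity) (by linarith)
  have hse : η/64 * (16 * d) = η * d / 4 := by ring
  rw [hse] at mono jump
  set s := η * d / 4 with hs
  have hs0 : 0 < s := by positivity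
  have hηd : η * d ≤ d := by nlinarith
  have hηd' : η * d ≤ η' * d := by gcongr
  have hηs : η * s ≤ s := by nlinarith
  have hdist : ∀ (t : ℝ), dist (x + t • e) x = |t| := fun t => by
    rw [dist_eq_norm, add_sub_cancel_left, norm_smul, he, mul_one, Real.norm_eq_abs]
  have hinn : ∀ (z : Euc n) (t : ℝ), inner ℝ e (z + t • e) = inner ℝ e z + t := fun z t => by
    rw [inner_add_right, real_inner_smul_right, hee, mul_one]
  have hsub : ∀ z : Euc n, z - (s/4) • e = z + (-(s/4)) • e := fun z => by rw [neg_smul, sub_eq_add_neg]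
  simp only [hsub] at jump
  have hs4 : |-(s/4)| = s/4 := by rw [abs_neg, abs_of_pos (by positivity)]
  have hs4' : |s/4| = s/4 := by rw [abs_of_pos (by positivity)]
  have free : η * d ≤ |inner ℝ e (y - x)| → Disjoint (ball y s) (frontier Ω) := by
    intro hi
    rw [Set.disjoint_left]
    intro z hz hzS
    rw [mem_ball] at hz
    have hzd : dist z x < d + s := by linarith [dist_triangle z y x]
    have hzd' : d < dist z x + s := by linarith [dist_triangle_left y x z, dist_comm z y, dist_triangle y z x]
    have h2 := Fa z (by linarith) (by linarith) hzS
    have h3 : |inner ℝ e (y - x)| ≤ |inner ℝ e (z - x)| + s := by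
      have e1 : inner ℝ e (y - x) = inner ℝ e (z - x) + inner ℝ e (y - z) := by rw [← inner_add_right]; congr 1; abel
      rw [e1]
      refine (abs_add_le _ _).trans (add_le_add le_rfl ((abs_real_inner_le_norm _ _).trans ?_))
      rw [he, one_mul, ← dist_eq_norm, dist_comm]; exact hz.le
    have h4 : η / 2 * dist z x ≤ η/2 * (d + s) := by gcongr
    nlinarith
  have j := jump x hx (by simp; positivity)
  refine ⟨fun hi => ?_, fun hi hyO => ?_, fun hyS => ?_⟩
  · by_contra hyO
    have hd' := free ((hηd'.trans hi).trans (le_abs_self _))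
    rcases mo_cases G.op hb h1 hs0 y hd' with h | h
    · have m := mono (x + (s/4) • e) y (by rw [hdist]; linarith) (by linarith) (by
        rw [inner_sub_right] at hi; rw [hinn]; linarith)
      have m0 := mo_nonneg (Ω := Ω) h0 hs0 (x + (-(s/4)) • e)
      linarith [h.1]
    · exact hyO (h.2 (mem_ball_self hs0))
  · have hd' := free (by have := neg_abs_le (inner ℝ e (y - x)); linarith)
    rcases mo_cases G.op hb h1 hs0 y hd' with h | h
    · exact h.2.le_bot ⟨mem_ball_self hs0, hyO⟩
    · have m := mono y (x + (-(s/4)) • e) (by linarith) (by rw [hdist]; linarith) (by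
        rw [inner_sub_right] at hi; rw [hinn]; linarith)
      have m0 := mo_le_one (Ω := Ω) hb h0 h1 hs0 (x + (s/4) • e)
      linarith [h.1]
  · refine (Fa y hy0 (by linarith) hyS).trans ?_
    nlinarith
end

open MeasureTheory Metric Set Filter
open scoped ENNReal NNReal Topology

/-! ### Part 9: the boundary datum lies in the range of the symbol -/
noncomputable section
variable {n N M : ℕ}

theorem slab_vol {e : Euc n} (he : e ≠ 0) {ε : ℝ} (hε : 0 < ε) :
    ∃ η > 0, volume.real ({z : Euc n | |inner ℝ e z| ≤ η} ∩ closedBall 0 1) ≤ ε := by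
  set S : ℕ → Set (Euc n) := fun k => {z : Euc n | |inner ℝ e z| ≤ 1 / ((k:ℝ) + 1)} ∩ closedBall 0 1 with hS
  have hfin : ∀ k, volume (S k) ≠ ⊤ := fun k =>
    ((measure_mono inter_subset_right).trans_lt (isCompact_closedBall _ _).measure_lt_top).ne
  have hcl : ∀ k, IsClosed (S k) := fun k =>
    (isClosed_le (by fun_prop) (by fun_prop)).inter isClosed_closedBall
  have hanti : Antitone S := by
    intro k l hkl z hz
    have hkl' : (k:ℝ) ≤ l := by exact_mod_cast hkl
    have h1 : |inner ℝ e z| ≤ 1 / ((l:ℝ) + 1) := hz.1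
    have h2 : 1 / ((l:ℝ) + 1) ≤ 1 / ((k:ℝ) + 1) := by gcongr
    exact ⟨h1.trans h2, hz.2⟩
  have ht := tendsto_measure_iInter_atTop (μ := volume) (s := S) (fun k => (hcl k).measurableSet.nullMeasurableSet)
    hanti ⟨0, hfin 0⟩
  have h0 : volume (⋂ k, S k) = 0 := by
    refine measure_mono_null ?_ (Measure.addHaar_submodule volume (LinearMap.ker (innerSL ℝ e).toLinearMap) ?_)
    · intro z hz
      rw [mem_iInter] at hz
      have : |inner ℝ e z| ≤ 0 := by
        refine ge_of_tendsto' tendsto_one_div_add_atTop_nhds_zero_nat fun k => (hz k).1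
      simpa using abs_nonpos_iff.1 this
    · intro h
      have : e ∈ LinearMap.ker (innerSL ℝ e).toLinearMap := by rw [h]; trivial
      apply he
      simpa using this
  rw [h0] at ht
  obtain ⟨k, hk⟩ := ((tendsto_order.1 ht).2 (ENNReal.ofReal ε) (by simpa using hε)).exists
  refine ⟨1 / ((k:ℝ)+1), by positivity, ?_⟩
  exact ENNReal.toReal_le_of_le_ofReal hε.le hk.le

theorem slab_test {e : Euc n} (he : e ≠ 0) {ε : ℝ} (hε : 0 < ε) :
    ∃ (Ψ : Euc n → ℝ) (η : ℝ), 0 < η ∧ IsTest (ball 0 1) Ψ ∧ (∀ z, 0 ≤ Ψ z ∧ Ψ z ≤ 1) ∧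
      (∀ z, ‖z‖ ≤ 1/2 → |inner ℝ e z| ≤ η → Ψ z = 1) ∧
      ∀ q : Fin n → ℂ, ∑ j, q j * (e j : ℂ) = 0 → ∫ z, ‖∑ j, q j * (pd j Ψ z : ℂ)‖ ≤ ε * ∑ j, ‖q j‖ := by
  let f : ContDiffBump (0 : Euc n) := ⟨1/2, 3/4, by norm_num, by norm_num⟩
  let g : ContDiffBump (0 : ℝ) := ⟨1, 2, by norm_num, by norm_num⟩
  have hfs : ContDiff ℝ (⊤ : ℕ∞) f := f.contDiff
  have hgs : ContDiff ℝ (⊤ : ℕ∞) g := g.contDiff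
  have hf : IsTest (ball 0 1) f := ⟨hfs, f.hasCompactSupport, by
    rw [f.tsupport_eq]; exact closedBall_subset_ball (by norm_num)⟩
  obtain ⟨K, hK⟩ : ∃ K : ℝ, ∀ z, ‖fderiv ℝ f z‖ ≤ K :=
    (hfs.continuous_fderiv (by simp)).bounded_above_of_compact_support (f.hasCompactSupport.fderiv ℝ)
  have hK0 : 0 ≤ K := (norm_nonneg _).trans (hK 0)
  obtain ⟨η2, hη2, hV⟩ := slab_vol he (ε := ε / (K + 1)) (by positivity)
  set η := η2 / 2 with hη
  have hη0 : 0 < η := by positivity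
  set h : Euc n → ℝ := fun z => g (η⁻¹ * inner ℝ e z) with hh
  have hhs : ContDiff ℝ (⊤ : ℕ∞) h := hgs.comp (contDiff_const.mul (contDiff_const.inner ℝ contDiff_id))
  refine ⟨fun z => f z * h z, η, hη0, hf.mul_smooth hhs, fun z => ⟨mul_nonneg f.nonneg g.nonneg,
    mul_le_one₀ f.le_one g.nonneg g.le_one⟩, fun z hz hz' => ?_, fun q hq => ?_⟩
  · have h1 : f z = 1 := f.one_of_mem_closedBall (by show dist z 0 ≤ 1/2; rwa [dist_zero_right])
    have h2 : h z = 1 := g.one_of_mem_closedBall (by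
      show dist _ 0 ≤ (1:ℝ)
      rw [dist_zero_right, norm_mul, norm_inv, Real.norm_eq_abs, abs_of_pos hη0, inv_mul_le_iff₀ hη0, mul_one]
      exact hz')
    simp only [h1, h2, mul_one]
  · have hlin : ∀ z, HasFDerivAt (fun z : Euc n => η⁻¹ * inner ℝ e z) (η⁻¹ • (innerSL ℝ e)) z := fun z =>
      ((innerSL ℝ e).hasFDerivAt).const_mul η⁻¹
    have hhd : ∀ z, HasFDerivAt h (deriv g (η⁻¹ * inner ℝ e z) • (η⁻¹ • (innerSL ℝ e))) z := fun z =>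
      ((hgs.differentiable (by simp) _).hasDerivAt).comp_hasFDerivAt z (hlin z)
    have hpd : ∀ j z, pd j (fun z => f z * h z) z =
        pd j f z * h z + (f z * (deriv g (η⁻¹ * inner ℝ e z) * η⁻¹)) * e j := by
      intro j z
      unfold pd
      have h3 : fderiv ℝ (fun z => f z * h z) z = _ := ((hfs.differentiable (by simp) z).hasFDerivAt.mul (hhd z)).fderiv
      rw [h3]
      simp [EuclideanSpace.inner_single_right]
      ring
    have hpt : ∀ z, ∑ j, q j * (pd j (fun z => f z * h z) z : ℂ) = ∑ j, q j * (pd j f z * h z : ℝ) := by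
      intro z
      have : ∑ j, q j * (pd j (fun z => f z * h z) z : ℂ) = ∑ j, q j * (pd j f z * h z : ℝ) +
        (((f z * (deriv g (η⁻¹ * inner ℝ e z) * η⁻¹)) : ℝ) : ℂ) * ∑ j, q j * (e j : ℂ) := by
        rw [Finset.mul_sum, ← Finset.sum_add_distrib]
        refine Finset.sum_congr rfl fun j _ => ?_
        rw [hpd]; push_cast; ring
      rw [this, hq, mul_zero, add_zero]
    simp only [hpt]
    set A : Set (Euc n) := {z : Euc n | |inner ℝ e z| ≤ η2} ∩ closedBall 0 1 with hA
    have hAm : MeasurableSet A := ((isClosed_le (by fun_prop) (by fun_prop)).inter isClosed_closedBall).measurableSet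
    have hAf : volume A ≠ ⊤ :=
      ((measure_mono inter_subset_right).trans_lt (isCompact_closedBall _ _).measure_lt_top).ne
    have hpdK : ∀ j z, |pd j f z| ≤ K := fun j z => by
      refine ((fderiv ℝ f z).le_opNorm _).trans ?_
      rw [EuclideanSpace.norm_single, norm_one, mul_one]
      exact hK z
    have hle : ∀ z, ‖∑ j, q j * ((pd j f z * h z : ℝ) : ℂ)‖ ≤ A.indicator (fun _ => K * ∑ j, ‖q j‖) z := by
      intro z
      by_cases hz : z ∈ A
      · rw [indicator_of_mem hz, Finset.mul_sum]
        refine (norm_sum_le _ _).trans (Finset.sum_le_sum fun j _ => ?_)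
        rw [norm_mul, Complex.norm_real, mul_comm, norm_mul, Real.norm_eq_abs, Real.norm_eq_abs]
        have : |h z| ≤ 1 := by rw [abs_of_nonneg g.nonneg]; exact g.le_one
        have h3 := hpdK j z
        have : |pd j f z| * |h z| ≤ K * 1 := by gcongr
        rw [mul_one] at this
        gcongr
      · rw [indicator_of_notMem hz]
        have : ∀ j, pd j f z * h z = 0 := by
          intro j
          by_cases h1 : z ∈ closedBall (0 : Euc n) 1
          · have h2 : η2 < |inner ℝ e z| := by
              by_contra h3; exact hz ⟨not_lt.1 h3, h1⟩
            have : h z = 0 := g.zero_of_le_dist (by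
              show (2:ℝ) ≤ dist _ 0
              rw [dist_zero_right, norm_mul, norm_inv, Real.norm_eq_abs, abs_of_pos hη0, le_inv_mul_iff₀ hη0, Real.norm_eq_abs]
              rw [hη]; linarith)
            rw [this, mul_zero]
          · have : pd j f z = 0 := image_eq_zero_of_notMem_tsupport fun h4 =>
              h1 (ball_subset_closedBall ((hf.pd j).supp h4))
            rw [this, zero_mul]
        simp [this]
    have hintg : Integrable (A.indicator (fun _ => K * ∑ j, ‖q j‖)) volume := by
      rw [integrable_indicator_iff hAm]; exact integrableOn_const hAf
    refine (integral_mono_of_nonneg (Eventually.of_forall fun z => norm_nonneg _) hintg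
      (Eventually.of_forall hle)).trans ?_
    rw [integral_indicator hAm, setIntegral_const, smul_eq_mul]
    calc volume.real A * (K * ∑ j, ‖q j‖) ≤ (ε / (K+1)) * (K * ∑ j, ‖q j‖) := by gcongr
      _ = ε * (K / (K+1)) * ∑ j, ‖q j‖ := by ring
      _ ≤ ε * 1 * ∑ j, ‖q j‖ := by
        gcongr
        rw [div_le_one (by positivity)]; linarith
      _ = _ := by ring

def BdRep (σ : Measure (Euc n)) (a : Fin n → Fin N → Fin M → ℂ) (X : Fin M → Euc n → ℂ) (x : Euc n)
    (g : Fin N → ℂ) : Prop :=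
  ∀ η > 0, ∃ r₀ > 0, ∀ r, 0 < r → r < r₀ → ∀ φ, IsTest (ball x r) φ → ∀ B, (∀ y, |φ y| ≤ B) →
    ∀ α, ‖PD a X φ α - g α * (∫ y, φ y ∂σ : ℝ)‖ ≤ η * B * r ^ (n - 1)

theorem range_lemma {Ω : Set (Euc n)} {σ : Measure (Euc n)} {D c C : ℝ} (G : Geo Ω σ D c C) {x ν : Euc n}
    (hx : x ∈ frontier Ω) (hν0 : ν ≠ 0) (hF : FlatAt Ω x (unv ν))
    {a : Fin n → Fin N → Fin M → ℂ} {X : Fin M → Euc n → ℂ} {Λ : ℝ} (hΛ : 0 ≤ Λ)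
    (hXm : ∀ β, AEStronglyMeasurable (X β) volume) (hXb : ∀ β, ∀ᵐ y, ‖X β y‖ ≤ Λ) {g : Fin N → ℂ}
    (hg : BdRep σ a X x g) :
    ∃ cc : Fin M → ℂ, ∀ α, ∑ β, (∑ j, a j α β * (ν j : ℂ)) * cc β = g α := by
  classical
  let A : (Fin M → ℂ) →ₗ[ℂ] (Fin N → ℂ) := Matrix.toLin' (Matrix.of fun α β => ∑ j, a j α β * (ν j : ℂ))
  by_contra hcon
  have hgr : g ∉ LinearMap.range A := by
    rintro ⟨cc, hcc⟩
    refine hcon ⟨cc, fun α => ?_⟩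
    rw [← hcc]
    simp [A, Matrix.toLin'_apply, Matrix.mulVec, dotProduct]
  obtain ⟨ℓ, hℓg, hℓ⟩ := Submodule.exists_le_ker_of_notMem hgr
  set l : Fin N → ℂ := fun α => ℓ (Pi.single α 1) with hl
  have hℓs : ∀ w, ℓ w = ∑ α, l α * w α := by
    intro w
    conv_lhs => rw [pi_eq_sum_univ' w]
    rw [map_sum]
    refine Finset.sum_congr rfl fun α _ => ?_
    rw [map_smul, smul_eq_mul, mul_comm]
  set q : Fin M → Fin n → ℂ := fun β j => ∑ α, l α * a j α β with hq
  have he0 : unv ν ≠ 0 := by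
    intro h; have := unv_norm hν0; rw [h, norm_zero] at this; norm_num at this
  have hqe : ∀ β, ∑ j, q β j * (unv ν j : ℂ) = 0 := by
    intro β
    have h1 : ℓ (A (Pi.single β 1)) = 0 := hℓ ⟨_, rfl⟩
    rw [hℓs] at h1
    have h2 : ∀ α, A (Pi.single β 1) α = ∑ j, a j α β * (ν j : ℂ) := fun α => by
      simp [A, Matrix.toLin'_apply]
    simp only [h2] at h1
    have h3 : ∑ j, q β j * (unv ν j : ℂ) = -((‖ν‖⁻¹ : ℝ) : ℂ) * ∑ α, l α * ∑ j, a j α β * (ν j : ℂ) := by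
      simp only [hq, Finset.mul_sum, Finset.sum_mul]
      rw [Finset.sum_comm]
      refine Finset.sum_congr rfl fun α _ => Finset.sum_congr rfl fun j _ => ?_
      simp [unv]; ring
    rw [h3, h1, mul_zero]
  have hc := G.hc
  set Q := ∑ β, ∑ j, ‖q β j‖ with hQ
  have hQ0 : 0 ≤ Q := by positivity
  set L := ∑ α, ‖l α‖ with hL
  have hL0 : 0 ≤ L := by positivity
  have hgp : 0 < ‖ℓ g‖ := norm_pos_iff.2 hℓg
  set m := ‖ℓ g‖ * (c * (1/2)^(n-1)) with hm
  have hm0 : 0 < m := by positivity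
  obtain ⟨Ψ, η, hη, hΨ, hΨ01, hΨ1, hΨq⟩ := slab_test he0 (ε := m / (4 * (Λ * Q + 1))) (by positivity)
  obtain ⟨r₁, hr₁, H1⟩ := hg (m / (4 * (L + 1))) (by positivity)
  obtain ⟨r₂, hr₂, H2⟩ := hF η hη
  obtain ⟨r, hr, hrr⟩ := exists_between (show 0 < min (min r₁ r₂) D from lt_min (lt_min hr₁ hr₂) G.hD)
  have hrD := hrr.trans_le (min_le_right _ _)
  have hr1 := (hrr.trans_le (min_le_left _ _)).trans_le (min_le_left _ _)
  have hr2 := (hrr.trans_le (min_le_left _ _)).trans_le (min_le_right _ _)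
  set φ : Euc n → ℝ := fun y => Ψ (r⁻¹ • (y - x)) with hφ
  have hφt : IsTest (ball x r) φ := test_rescale hΨ x hr
  have h1 := H1 r hr hr1 φ hφt 1 (fun y => by rw [abs_of_nonneg (hΨ01 _).1]; exact (hΨ01 _).2)
  -- lower bound
  have hlow : c * (1/2)^(n-1) * r^(n-1) ≤ ∫ y, φ y ∂σ := by
    have hintg := G.integrable hx hr hrD hφt
    have hfin := G.fin hx (r := r/2) (by positivity) (by linarith)
    have h3 : ∫ y in ball x (r/2), (1:ℝ) ∂σ ≤ ∫ y, φ y ∂σ := by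
      refine le_trans ?_ (setIntegral_le_integral (s := ball x (r/2)) hintg (Eventually.of_forall fun z => (hΨ01 _).1))
      refine integral_mono_ae (integrable_const _) hintg.integrableOn ?_
      have hS : ∀ᵐ y ∂(σ.restrict (ball x (r/2))), y ∈ frontier Ω :=
        ae_restrict_of_ae (by rw [ae_iff]; exact G.null)
      filter_upwards [hS, ae_restrict_mem measurableSet_ball] with y hyS hyB
      rw [mem_ball] at hyB
      refine le_of_eq (hΨ1 _ ?_ ?_).symm
      · rw [norm_smul, norm_inv, Real.norm_eq_abs, abs_of_pos hr, inv_mul_le_iff₀ hr, ← dist_eq_norm]; linarith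
      · rw [real_inner_smul_right, abs_mul, abs_inv, abs_of_pos hr, inv_mul_le_iff₀ hr]
        rcases (dist_nonneg (x := y) (y := x)).eq_or_lt with h0 | h0
        · rw [eq_comm, dist_eq_zero] at h0
          simp [h0]; positivity
        · refine ((H2 y h0 (by linarith)).2.2 hyS).trans ?_
          nlinarith
    rw [setIntegral_const, smul_eq_mul, mul_one] at h3
    have h4 := G.real_lo hx (r := r/2) (by positivity) (by linarith)
    calc c * (1/2)^(n-1) * r^(n-1) = c * (r/2)^(n-1) := by rw [mul_assoc, ← mul_pow]; ring_nf
      _ ≤ _ := h4.trans h3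
  -- upper bound
  have hup : ‖∑ α, l α * PD a X φ α‖ ≤ Λ * (m / (4 * (Λ * Q + 1)) * Q) * r^(n-1) := by
    have hI : ∀ β j, Integrable (fun y => (pd j φ y : ℂ) * X β y) volume := fun β j => by
      have ht := hφt.pd j
      exact integrable_test_mul (Complex.continuous_ofReal.comp ht.smooth.continuous)
        (ht.cpt.comp_left (g := fun t : ℝ => (t:ℂ)) (by simp)) (hXm β) (hXb β)
    have e1 : ∑ α, l α * PD a X φ α = ∑ β, ∫ y, (∑ j, q β j * (pd j φ y : ℂ)) * X β y := by
      have : ∀ β, ∫ y, (∑ j, q β j * (pd j φ y : ℂ)) * X β y = ∑ j, q β j * ∫ y, (pd j φ y : ℂ) * X β y := by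
        intro β
        simp only [Finset.sum_mul, mul_assoc]
        rw [integral_finset_sum _ fun j _ => (hI β j).const_mul _]
        simp only [integral_const_mul]
      rw [Finset.sum_congr rfl fun β _ => this β]
      simp only [hq, PD, Finset.mul_sum, Finset.sum_mul]
      rw [Finset.sum_comm (s := (Finset.univ : Finset (Fin M)))]
      rw [Finset.sum_comm]
      refine Finset.sum_congr rfl fun j _ => ?_
      rw [Finset.sum_comm]
      refine Finset.sum_congr rfl fun β _ => Finset.sum_congr rfl fun α _ => ?_
      ring
    rw [e1]
    refine (norm_sum_le _ _).trans ?_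
    have hβ : ∀ β, ‖∫ y, (∑ j, q β j * (pd j φ y : ℂ)) * X β y‖ ≤
        Λ * (m / (4 * (Λ * Q + 1)) * ∑ j, ‖q β j‖) * r^(n-1) := by
      intro β
      have hIn : Integrable (fun y => ‖∑ j, q β j * (pd j φ y : ℂ)‖ * Λ) volume := by
        refine (Integrable.norm ?_).mul_const _
        refine integrable_finset_sum _ fun j _ => Integrable.const_mul ?_ _
        exact ((hφt.pd j).smooth.continuous.integrable_of_hasCompactSupport (hφt.pd j).cpt).ofReal
      have s1 : ‖∫ y, (∑ j, q β j * (pd j φ y : ℂ)) * X β y‖ ≤ ∫ y, ‖∑ j, q β j * (pd j φ y : ℂ)‖ * Λ := by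
        refine norm_integral_le_of_norm_le hIn ?_
        filter_upwards [hXb β] with y hy
        rw [norm_mul]; gcongr
      refine s1.trans ?_
      rw [integral_mul_const, integral_affine _ x hr]
      have s2 : ∀ z, ∑ j, q β j * (pd j φ (x + r • z) : ℂ) = ((r⁻¹ : ℝ) : ℂ) * ∑ j, q β j * (pd j Ψ z : ℂ) := by
        intro z
        rw [Finset.mul_sum]
        refine Finset.sum_congr rfl fun j _ => ?_
        rw [hφ, pd_comp_affine (hΨ.smooth.differentiable (by simp)), add_sub_cancel_left, smul_smul,
          inv_mul_cancel₀ hr.ne', one_smul]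
        push_cast; ring
      simp only [s2, norm_mul, Complex.norm_real, Real.norm_eq_abs, abs_of_pos (inv_pos.2 hr)]
      rw [integral_const_mul, smul_eq_mul]
      have h5 : r ^ n = r ^ (n-1) * r := by rw [← pow_succ]; congr 1; have := G.hn; omega
      calc r ^ n * (r⁻¹ * ∫ z, ‖∑ j, q β j * (pd j Ψ z : ℂ)‖) * Λ
          = Λ * (∫ z, ‖∑ j, q β j * (pd j Ψ z : ℂ)‖) * r^(n-1) := by rw [h5]; field_simp
        _ ≤ _ := by gcongr; exact hΨq (q β) (hqe β)
    refine (Finset.sum_le_sum fun β _ => hβ β).trans (le_of_eq ?_)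
    rw [← Finset.sum_mul, ← Finset.mul_sum, ← Finset.mul_sum]
  have hdiff : ‖∑ α, l α * PD a X φ α - ℓ g * (∫ y, φ y ∂σ : ℝ)‖ ≤ L * (m / (4 * (L + 1)) * 1 * r^(n-1)) := by
    rw [hℓs, Finset.sum_mul, ← Finset.sum_sub_distrib, hL, Finset.sum_mul]
    refine (norm_sum_le _ _).trans (Finset.sum_le_sum fun α _ => ?_)
    rw [mul_assoc, ← mul_sub, norm_mul]
    gcongr
    exact h1 α
  have hfinal : m * r^(n-1) ≤ ‖ℓ g * (∫ y, φ y ∂σ : ℝ)‖ := by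
    rw [norm_mul, Complex.norm_real, Real.norm_eq_abs, hm, mul_assoc]
    gcongr
    exact hlow.trans (le_abs_self _)
  have htri : ‖ℓ g * (∫ y, φ y ∂σ : ℝ)‖ ≤ ‖∑ α, l α * PD a X φ α‖ + ‖∑ α, l α * PD a X φ α - ℓ g * (∫ y, φ y ∂σ : ℝ)‖ := by
    rw [← norm_neg (∑ α, l α * PD a X φ α - _)]
    refine le_trans (le_of_eq ?_) (norm_add_le _ _)
    congr 1; ring
  have b1 : Λ * (m / (4 * (Λ * Q + 1)) * Q) ≤ m / 4 := by
    have : Λ * (m / (4 * (Λ * Q + 1)) * Q) = m / 4 * ((Λ * Q) / (Λ * Q + 1)) := by field_simp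
    rw [this]
    refine mul_le_of_le_one_right (by positivity) ?_
    rw [div_le_one (by positivity)]; linarith
  have b2 : L * (m / (4 * (L + 1)) * 1) ≤ m / 4 := by
    have : L * (m / (4 * (L + 1)) * 1) = m / 4 * (L / (L + 1)) := by field_simp
    rw [this]
    refine mul_le_of_le_one_right (by positivity) ?_
    rw [div_le_one (by positivity)]; linarith
  have hrp : 0 < r^(n-1) := by positivity
  have b1' := mul_le_mul_of_nonneg_right b1 hrp.le
  have b2' := mul_le_mul_of_nonneg_right b2 hrp.le
  have : m * r^(n-1) ≤ m / 4 * r^(n-1) + m / 4 * r^(n-1) := by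
    refine (hfinal.trans htri).trans (add_le_add (hup.trans b1') (hdiff.trans ?_))
    rw [← mul_assoc]; exact b2'
  have : 0 < m * r^(n-1) := by positivity
  linarith
end

open MeasureTheory Metric Set Filter
open scoped ENNReal NNReal Topology

/-! ### Part 10: convergence at a good boundary point -/
noncomputable section
variable {n N M : ℕ}

def DensAt (S F : Set (Euc n)) (x : Euc n) : Prop :=
  ∀ η > 0, ∃ r₀ > 0, ∀ z ∈ S, dist z x < r₀ → infDist z F ≤ η * dist z x

theorem chi_one {Ω F : Set (Euc n)} {κ : ℝ} (hκ : 0 < κ) {y : Euc n} (hy : 0 < dl Ω y)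
    (h : infDist y F ≤ (1 + κ / 2) * dl Ω y) : chi Ω F κ y = 1 := by
  have h1 : 0 < κ / 2 * dl Ω y := by positivity
  unfold chi
  rw [min_eq_right, div_self h1.ne']
  apply le_max_of_le_left
  nlinarith

theorem chi_near {Ω F : Set (Euc n)} (hΩ : IsOpen Ω) {κ : ℝ} (hκ : 0 < κ) {x₀ : Euc n} (hx : x₀ ∈ frontier Ω)
    (hd : DensAt (frontier Ω) F x₀) {κ' : ℝ} (hκ' : 0 < κ') :
    ∃ d₀ > 0, ∀ x ∈ ntRegion Ω κ' x₀, dist x x₀ < d₀ →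
      ball x (dl Ω x / 2) ⊆ Ω ∧ ∀ y ∈ ball x (dl Ω x / 2), chi Ω F κ y = 1 := by
  obtain ⟨r₀, hr₀, h⟩ := hd (κ / (16 * (1 + κ'))) (by positivity)
  refine ⟨r₀ / 4, by positivity, fun x hxr hxd => ?_⟩
  have hxΩ : x ∈ Ω := hxr.1
  have hx2 : dist x₀ x < (1 + κ') * dl Ω x := by
    have := hxr.2; rwa [dl_eq hΩ hx hxΩ] at this
  have hlip : ∀ y, |dl Ω y - dl Ω x| ≤ dist y x := fun y => by
    simpa [Real.dist_eq] using (dl_lip Ω).dist_le_mul y x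
  have hpos := dl_pos hΩ hx hxΩ
  have hlex : dl Ω x ≤ dist x x₀ := dl_le (frontier_not_mem hΩ hx)
  have hin : ball x (dl Ω x / 2) ⊆ Ω := by
    intro y hy
    by_contra hyn
    have h1 : dl Ω x ≤ dist x y := dl_le hyn
    rw [mem_ball, dist_comm] at hy
    linarith
  refine ⟨hin, fun y hy => ?_⟩
  rw [mem_ball] at hy
  have hyd : dl Ω x / 2 ≤ dl Ω y := by
    have := abs_le.1 (hlip y); linarith
  obtain ⟨z, hz, hzy⟩ := exists_near hΩ hx (hin hy)
  have hyx : dist y x₀ ≤ dist y x + dist x x₀ := dist_triangle _ _ _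
  have hzx : dist z x₀ ≤ dl Ω y + dist y x₀ := by
    have := dist_triangle z y x₀; rw [dist_comm z y, hzy] at this; exact this
  have hly : dl Ω y ≤ dist y x₀ := dl_le (frontier_not_mem hΩ hx)
  have h2 := h z hz (by linarith)
  refine chi_one hκ (by linarith) ?_
  have h3 : infDist y F ≤ infDist z F + dist y z := infDist_le_infDist_add_dist
  have h4 : dist z x₀ ≤ 8 * (1 + κ') * dl Ω y := by
    rw [dist_comm] at hx2
    have : dist z x₀ ≤ 2 * (dl Ω x / 2 + dist x x₀) := by linarith
    nlinarith
  have h5 : κ / (16 * (1 + κ')) * dist z x₀ ≤ κ / (16 * (1 + κ')) * (8 * (1 + κ') * dl Ω y) := by gcongr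
  have h6 : κ / (16 * (1 + κ')) * (8 * (1 + κ') * dl Ω y) = κ / 2 * dl Ω y := by
    field_simp; ring
  rw [hzy] at h3
  linarith

theorem small_X {Ω : Set (Euc n)} (hΩ : IsOpen Ω) {σ : Measure (Euc n)} {x ν : Euc n} (hν : IsNormal σ Ω x ν)
    {a : Fin n → Fin N → Fin M → ℂ} {v : Fin M → Euc n → ℂ} {Λ : ℝ}
    (hvm : ∀ β, AEStronglyMeasurable (v β) volume) (hvb : ∀ β, ∀ᵐ y, ‖v β y‖ ≤ Λ) {g : Fin N → ℂ}
    (hg : BdRep σ a v x g) {cc : Fin M → ℂ} (hcc : ∀ α, ∑ β, (∑ j, a j α β * (ν j : ℂ)) * cc β = g α)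
    {ε : ℝ} (hε : 0 < ε) :
    ∃ r₀ > 0, ∀ r, 0 < r → r < r₀ →
      SmallD a (fun β y => v β y - Ω.indicator (fun _ => cc β) y) x r (ε * r ^ (n - 1)) := by
  set S := ∑ α, ∑ j, ∑ β, ‖a j α β‖ * ‖cc β‖ with hS
  have hS0 : 0 ≤ S := by positivity
  obtain ⟨r1, hr1, h1⟩ := hg (ε / (1 + S)) (by positivity)
  obtain ⟨r2, hr2, h2⟩ := hν (ε / (1 + S)) (by positivity)
  refine ⟨min r1 r2, by positivity, fun r hr hrr φ hφ B hB α => ?_⟩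
  have h1' := h1 r hr (hrr.trans_le (min_le_left _ _)) φ hφ B hB α
  have h2' : ∀ j : Fin n, |(∫ y in Ω, pd j φ y) - ν j * ∫ y, φ y ∂σ| ≤ ε / (1 + S) * B * r ^ (n - 1) := by
    intro j
    have := h2 r hr (hrr.trans_le (min_le_right _ _)) φ hφ B hB (EuclideanSpace.single j 1)
    simpa [pd, EuclideanSpace.inner_single_right] using this
  set I := ∫ y, φ y ∂σ with hI
  have hintg : ∀ j β, ∫ y, (pd j φ y : ℂ) * (v β y - Ω.indicator (fun _ => cc β) y) =
      (∫ y, (pd j φ y : ℂ) * v β y) - ((∫ y in Ω, pd j φ y : ℝ) : ℂ) * cc β := by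
    intro j β
    have hp := hφ.pd j
    have i1 : Integrable (fun y => (pd j φ y : ℂ) * v β y) :=
      integrable_test_mul (Complex.continuous_ofReal.comp hp.smooth.continuous)
        (hp.cpt.comp_left (g := fun t : ℝ => (t:ℂ)) (by simp)) (hvm β) (hvb β)
    have i2 : Integrable (fun y => (pd j φ y : ℂ) * Ω.indicator (fun _ => cc β) y) :=
      integrable_test_mul (Complex.continuous_ofReal.comp hp.smooth.continuous)
        (hp.cpt.comp_left (g := fun t : ℝ => (t:ℂ)) (by simp))
        ((aestronglyMeasurable_const).indicator hΩ.measurableSet)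
        (Λ := ‖cc β‖) (Eventually.of_forall fun y => norm_indicator_le_norm_self _ _)
    simp only [mul_sub]
    rw [integral_sub i1 i2]
    congr 1
    rw [← integral_complex_ofReal, ← integral_mul_const, ← integral_indicator hΩ.measurableSet]
    refine integral_congr_ae (Eventually.of_forall fun y => ?_)
    by_cases hy : y ∈ Ω <;> simp [hy]
  have key : PD a (fun β y => v β y - Ω.indicator (fun _ => cc β) y) φ α =
      (PD a v φ α - g α * (I : ℝ)) - ∑ j, ∑ β, a j α β * cc β * (((∫ y in Ω, pd j φ y) - ν j * I : ℝ) : ℂ) := by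
    unfold PD
    rw [← hcc α, Finset.sum_mul, Finset.sum_congr rfl fun j _ => Finset.sum_congr rfl fun β _ => by rw [hintg j β]]
    have : ∑ β, (∑ j, a j α β * (ν j : ℂ)) * cc β * (I : ℂ) = ∑ j, ∑ β, a j α β * (ν j : ℂ) * cc β * (I : ℂ) := by
      rw [Finset.sum_comm]
      refine Finset.sum_congr rfl fun β _ => ?_
      rw [Finset.sum_mul, Finset.sum_mul]
    rw [this, ← Finset.sum_sub_distrib, ← Finset.sum_sub_distrib]
    refine Finset.sum_congr rfl fun j _ => ?_
    rw [← Finset.sum_sub_distrib, ← Finset.sum_sub_distrib]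
    refine Finset.sum_congr rfl fun β _ => ?_
    push_cast
    ring
  have hB0 : 0 ≤ B := (abs_nonneg _).trans (hB 0)
  set E := ε / (1 + S) * B * r ^ (n - 1) with hE
  have hE0 : 0 ≤ E := by positivity
  rw [key]
  have hs2 : ‖∑ j, ∑ β, a j α β * cc β * (((∫ y in Ω, pd j φ y) - ν j * I : ℝ) : ℂ)‖ ≤ S * E := by
    calc _ ≤ ∑ j, ∑ β, ‖a j α β‖ * ‖cc β‖ * E := by
          refine (norm_sum_le _ _).trans (Finset.sum_le_sum fun j _ => (norm_sum_le _ _).trans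
            (Finset.sum_le_sum fun β _ => ?_))
          rw [norm_mul, norm_mul, Complex.norm_real, Real.norm_eq_abs]
          exact mul_le_mul_of_nonneg_left (h2' j) (by positivity)
      _ = (∑ j, ∑ β, ‖a j α β‖ * ‖cc β‖) * E := by simp only [Finset.sum_mul]
      _ ≤ S * E := by
          refine mul_le_mul_of_nonneg_right ?_ hE0
          exact Finset.single_le_sum (f := fun α => ∑ j, ∑ β, ‖a j α β‖ * ‖cc β‖)
            (fun α _ => by positivity) (Finset.mem_univ α)
  calc _ ≤ E + S * E := (norm_sub_le _ _).trans (add_le_add h1' hs2)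
    _ = ε * r ^ (n - 1) * B := by rw [hE]; field_simp

/-- averages converge at a.e. point -/
theorem avg_lebesgue {b : Euc n → ℝ} (hb : IsTest (ball 0 1) b) (h1 : ∫ x, b x = 1) {w : Euc n → ℂ} {Λ : ℝ}
    (hw : AEStronglyMeasurable w volume) (hwb : ∀ᵐ y, ‖w y‖ ≤ Λ) :
    ∀ᵐ x, Tendsto (fun s => Avg b w x s) (𝓝[>] 0) (𝓝 (w x)) := by
  have hli : LocallyIntegrable w volume := by
    have : MemLp w ⊤ volume := memLp_top_of_bound hw Λ hwb
    exact this.locallyIntegrable le_top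
  obtain ⟨B, hB0, hB⟩ := hb.bdd
  filter_upwards [IsUnifLocDoublingMeasure.ae_tendsto_average_norm_sub (μ := (volume : Measure (Euc n))) hli 1] with x hx
  have h := hx (l := 𝓝[>] (0:ℝ)) (fun _ => x) (fun s => s) tendsto_id
    (by filter_upwards [self_mem_nhdsWithin] with s hs
        simp only [one_mul]; exact mem_closedBall_self (le_of_lt hs))
  rw [tendsto_iff_norm_sub_tendsto_zero]
  set V := (volume (closedBall (0 : Euc n) 1)).toReal with hV
  have hlim : Tendsto (fun s => B * V * ⨍ y in closedBall x s, ‖w y - w x‖) (𝓝[>] 0) (𝓝 0) := by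
    simpa using h.const_mul (B * V)
  refine squeeze_zero' (Eventually.of_forall fun s => norm_nonneg _) ?_ hlim
  filter_upwards [self_mem_nhdsWithin] with s hs
  have hs' : 0 < s := hs
  have hbt := bmp_test hb x hs'
  have i1 : Integrable (fun y => bmp b x s y • w y) := by
    have := integrable_test_mul (Complex.continuous_ofReal.comp hbt.smooth.continuous)
      (hbt.cpt.comp_left (g := fun t : ℝ => (t:ℂ)) (by simp)) hw hwb
    exact this.congr (Eventually.of_forall fun y => by simp [Complex.real_smul])
  have i2 : Integrable (fun y => bmp b x s y • w x) := (bmp_integrable hb x hs').smul_const _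
  have e1 : Avg b w x s - w x = ∫ y, bmp b x s y • (w y - w x) := by
    simp only [smul_sub]
    rw [integral_sub i1 i2, integral_smul_const, bmp_int h1 x hs', one_smul, Avg_eq b w x hs']
  have e2 : ∫ y, bmp b x s y • (w y - w x) = ∫ y in closedBall x s, bmp b x s y • (w y - w x) := by
    rw [setIntegral_eq_integral_of_forall_compl_eq_zero]
    intro y hy
    have : bmp b x s y = 0 := by
      by_contra hne
      exact hy (ball_subset_closedBall (hbt.supp (subset_tsupport _ hne)))
    rw [this, zero_smul]
  have hvol : volume.real (closedBall x s) = s ^ n * V := by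
    rw [Measure.real, Measure.addHaar_closedBall' _ _ hs'.le, ENNReal.toReal_mul, ENNReal.toReal_ofReal (by positivity)]
    simp [hV]
  have hV0 : 0 < V := ENNReal.toReal_pos (measure_closedBall_pos _ _ one_pos).ne'
    (isCompact_closedBall _ _).measure_lt_top.ne
  rw [e1, e2, setAverage_eq, hvol]
  have hI : IntegrableOn (fun y => ‖w y - w x‖) (closedBall x s) :=
    ((hli.integrableOn_isCompact (isCompact_closedBall x s)).sub
      (integrableOn_const (isCompact_closedBall x s).measure_lt_top.ne)).norm
  calc _ ≤ ∫ y in closedBall x s, (s ^ n)⁻¹ * B * ‖w y - w x‖ := by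
        refine norm_integral_le_of_norm_le (hI.const_mul _) (Eventually.of_forall fun y => ?_)
        rw [norm_smul]
        refine mul_le_mul_of_nonneg_right ?_ (norm_nonneg _)
        rw [bmp, Real.norm_eq_abs, abs_mul, abs_of_pos (by positivity : (0:ℝ) < (s ^ n)⁻¹)]
        exact mul_le_mul_of_nonneg_left (hB _) (by positivity)
    _ = _ := by
        rw [integral_const_mul, smul_eq_mul]
        field_simp

theorem flat_access {Ω : Set (Euc n)} (hΩ : IsOpen Ω) {x e : Euc n} (hx : x ∈ frontier Ω) (he : ‖e‖ = 1)
    (hF : FlatAt Ω x e) {κ : ℝ} (hκ : 0 < κ) : x ∈ closure (ntRegion Ω κ x) := by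
  rw [Metric.mem_closure_iff]
  intro ε hε
  set η := min (κ / (4 * (1 + κ))) (1/2) with hη
  have hη0 : 0 < η := by positivity
  have hη1 : η ≤ 1/2 := min_le_right _ _
  obtain ⟨r₀, hr₀, h⟩ := hF η hη0
  set t := min (r₀ / 4) (ε / 2) with ht
  have ht0 : 0 < t := by positivity
  have ht1 : t ≤ r₀ / 4 := min_le_left _ _
  have ht2 : t ≤ ε / 2 := min_le_right _ _
  have hee : inner ℝ e e = (1:ℝ) := by rw [real_inner_self_eq_norm_sq, he]; norm_num
  have hdist : dist (x + t • e) x = t := by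
    rw [dist_eq_norm, add_sub_cancel_left, norm_smul, he, Real.norm_eq_abs, abs_of_pos ht0, mul_one]
  have hin : x + t • e ∈ Ω := by
    refine (h _ (by rw [hdist]; exact ht0) (by rw [hdist]; linarith)).1 ?_
    rw [hdist, add_sub_cancel_left, inner_smul_right, hee]; nlinarith
  have hlow : t - η * (2 * t) ≤ infDist (x + t • e) (frontier Ω) := by
    rw [le_infDist ⟨x, hx⟩]
    intro z hz
    by_contra hcon
    push Not at hcon
    have hdz : dist z x < 2 * t := by
      have := dist_triangle z (x + t • e) x
      rw [hdist, dist_comm z (x + t • e)] at this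
      nlinarith
    rcases eq_or_ne z x with rfl | hzx
    · rw [hdist] at hcon; nlinarith
    have h3 := (h z (dist_pos.2 hzx) (by linarith)).2.2 hz
    have h4 : inner ℝ e ((x + t • e) - z) ≤ dist (x + t • e) z := by
      have := real_inner_le_norm e ((x + t • e) - z)
      rwa [he, one_mul, ← dist_eq_norm] at this
    have h5 : inner ℝ e ((x + t • e) - z) = t - inner ℝ e (z - x) := by
      have : (x + t • e) - z = t • e - (z - x) := by abel
      rw [this, inner_sub_right, inner_smul_right, hee, mul_one]
    have := (abs_le.1 h3).2
    nlinarith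
  refine ⟨x + t • e, ⟨hin, ?_⟩, by rw [dist_comm, hdist]; linarith⟩
  rw [dist_comm, hdist]
  have hη2 : η ≤ κ / (4 * (1 + κ)) := min_le_left _ _
  rw [le_div_iff₀ (by positivity)] at hη2
  have : (1 + κ) * (t - η * (2 * t)) ≤ (1 + κ) * infDist (x + t • e) (frontier Ω) := by gcongr
  nlinarith
end

open MeasureTheory Metric Set Filter
open scoped ENNReal NNReal Topology

noncomputable section
variable {n N M : ℕ}

theorem avg_congr_ball {b : Euc n → ℝ} (hb : IsTest (ball 0 1) b) {w w' : Euc n → ℂ} {x : Euc n} {s : ℝ}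
    (hs : 0 < s) (h : ∀ y ∈ ball x s, w y = w' y) : Avg b w x s = Avg b w' x s := by
  rw [Avg_eq b w x hs, Avg_eq b w' x hs]
  refine integral_congr_ae (Eventually.of_forall fun y => ?_)
  by_cases hy : y ∈ ball x s
  · simp only [h y hy]
  · have : bmp b x s y = 0 := by
      by_contra hne
      exact hy ((bmp_test hb x hs).supp (subset_tsupport _ hne))
    simp only [this, zero_smul]

set_option maxHeartbeats 2000000 in
theorem point_conv (hn : 1 ≤ n) {a : Fin n → Fin N → Fin M → ℂ}
    (hell : ∀ ξ : Euc n, ξ ≠ 0 → ∀ v : Fin M → ℂ,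
      (∀ α : Fin N, ∑ β : Fin M, (∑ j : Fin n, a j α β * (ξ j : ℂ)) * v β = 0) → v = 0)
    {b : Euc n → ℝ} (hb : IsTest (ball 0 1) b) (hb1 : ∫ x, b x = 1)
    {Ω F : Set (Euc n)} (hΩ : IsOpen Ω) {σ : Measure (Euc n)} {κ : ℝ} (hκ : 0 < κ) {x₀ ν : Euc n}
    (hx₀ : x₀ ∈ frontier Ω) (hν : IsNormal σ Ω x₀ ν) (hν0 : ν ≠ 0) (hF : FlatAt Ω x₀ (unv ν))
    (hd : DensAt (frontier Ω) F x₀)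
    {v : Fin M → Euc n → ℂ} {Λ : ℝ} (hΛ : 0 ≤ Λ)
    (hvm : ∀ β, AEStronglyMeasurable (v β) volume) (hvb : ∀ β, ∀ᵐ y, ‖v β y‖ ≤ Λ)
    (hvz : ∀ β, ∀ y ∉ Ω, v β y = 0)
    (hv0 : ∀ y r, ball y r ⊆ Ω → (∀ z ∈ ball y r, chi Ω F κ z = 1) → ∀ φ, IsTest (ball y r) φ → ∀ α, PD a v φ α = 0)
    {g : Fin N → ℂ} (hg : BdRep σ a v x₀ g) {cc : Fin M → ℂ}
    (hcc : ∀ α, ∑ β, (∑ j, a j α β * (ν j : ℂ)) * cc β = g α) {κ' : ℝ} (hκ' : 0 < κ') {δ : ℝ} (hδ : 0 < δ) :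
    ∃ d₀ > 0, ∀ x ∈ ntRegion Ω κ' x₀, dist x x₀ < d₀ →
      (∀ β, Tendsto (fun s => Avg b (v β) x s) (𝓝[>] 0) (𝓝 (v β x))) →
      chi Ω F κ x = 1 ∧ ∀ β, ‖v β x - cc β‖ ≤ δ := by
  obtain ⟨C, hC, hest⟩ := interior_est hn a hell hb
  set K := 1 + κ' with hK
  have hK0 : 0 < K := by positivity
  set Λ' := Λ + ∑ β, ‖cc β‖ with hΛ'
  have hΛ'0 : 0 ≤ Λ' := by positivity
  set e := unv ν with he
  have he1 : ‖e‖ = 1 := unv_norm hν0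
  set s := min (min (1/4) (1 / (4 * K))) (δ / (6 * (C * Λ * K + 1))) with hs
  have hs0 : 0 < s := by positivity
  have hs1 : s ≤ 1/4 := (min_le_left _ _).trans (min_le_left _ _)
  have hs2 : s ≤ 1 / (4 * K) := (min_le_left _ _).trans (min_le_right _ _)
  have hs3 : s ≤ δ / (6 * (C * Λ * K + 1)) := min_le_right _ _
  set R := max 4 (6 * (C * Λ' + 1) / δ) with hR
  have hR4 : 4 ≤ R := le_max_left _ _
  have hR0 : 0 < R := by linarith
  have hR2 : 6 * (C * Λ' + 1) / δ ≤ R := le_max_right _ _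
  set ε := δ / (6 * (C + 1) * (R / s) ^ n) with hε
  have hε0 : 0 < ε := by positivity
  obtain ⟨d1, hd1, hchi⟩ := chi_near hΩ hκ hx₀ hd hκ'
  obtain ⟨r0, hr0, hsm⟩ := small_X hΩ hν hvm hvb hg hcc hε0
  obtain ⟨r1, hr1, hfl⟩ := hF (1/4) (by norm_num)
  refine ⟨min d1 (min (r0 / R) (r1 / 2)), by positivity, fun x hx hxd hleb => ?_⟩
  have hxd1 : dist x x₀ < d1 := hxd.trans_le (min_le_left _ _)
  have hxd2 : dist x x₀ < r0 / R := hxd.trans_le ((min_le_right _ _).trans (min_le_left _ _))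
  have hxd3 : dist x x₀ < r1 / 2 := hxd.trans_le ((min_le_right _ _).trans (min_le_right _ _))
  rw [lt_div_iff₀ hR0] at hxd2
  have hxΩ : x ∈ Ω := hx.1
  have hpos := dl_pos hΩ hx₀ hxΩ
  have hx2 : dist x x₀ < K * dl Ω x := by
    have := hx.2; rwa [dl_eq hΩ hx₀ hxΩ, dist_comm] at this
  have hlex : dl Ω x ≤ dist x x₀ := dl_le (frontier_not_mem hΩ hx₀)
  obtain ⟨hball, hchi1⟩ := hchi x hx hxd1
  set d := dist x x₀ with hdd
  have hd0 : 0 < d := by linarith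
  have hsd : 0 < s * d := by positivity
  refine ⟨hchi1 x (mem_ball_self (by linarith)), fun β => ?_⟩
  have hsK : s * d ≤ dl Ω x / 4 := by
    have h1 : s * d ≤ 1 / (4 * K) * (K * dl Ω x) := by gcongr
    have h2 : 1 / (4 * K) * (K * dl Ω x) = dl Ω x / 4 := by field_simp
    linarith
  -- interior part
  have nn1 : NearNull a v Λ (0 * (dl Ω x / 2) ^ (n - 1)) x (dl Ω x / 2) := by
    refine ⟨hvm, hΛ, by simp, hvb, fun φ hφ B hB α => ?_⟩
    rw [hv0 x _ hball hchi1 φ hφ α]; simp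
  have hA : ‖Avg b (v β) x (s * d) - v β x‖ ≤ C * (Λ * (s * d / (dl Ω x / 2))) := by
    have ht : Tendsto (fun s' => ‖Avg b (v β) x (s * d) - Avg b (v β) x s'‖) (𝓝[>] 0)
        (𝓝 ‖Avg b (v β) x (s * d) - v β x‖) := (tendsto_const_nhds.sub (hleb β)).norm
    refine le_of_tendsto ht ?_
    filter_upwards [Ioo_mem_nhdsGT hsd] with s' hs'
    have := hest v Λ 0 x (dl Ω x / 2) (by linarith) nn1 x x (s * d) s' hsd hs'.1
      (by rw [dist_self]; linarith) (by rw [dist_self]; linarith [hs'.2]) β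
    refine this.trans ?_
    rw [zero_mul, add_zero, dist_self, zero_add]
    have h3 : |s * d - s'| ≤ s * d := by rw [abs_le]; constructor <;> linarith [hs'.1, hs'.2]
    gcongr
  have hA' : C * (Λ * (s * d / (dl Ω x / 2))) ≤ δ / 3 := by
    have h1 : s * d / (dl Ω x / 2) ≤ 2 * s * K := by
      rw [div_le_iff₀ (by positivity)]
      nlinarith
    calc C * (Λ * (s * d / (dl Ω x / 2))) ≤ C * (Λ * (2 * s * K)) := by gcongr
      _ = 2 * (C * Λ * K) * s := by ring
      _ ≤ 2 * (C * Λ * K + 1) * s := by nlinarith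
      _ ≤ 2 * (C * Λ * K + 1) * (δ / (6 * (C * Λ * K + 1))) := by gcongr
      _ = δ / 3 := by field_simp; norm_num
  -- big ball
  set X : Fin M → Euc n → ℂ := fun β y => v β y - Ω.indicator (fun _ => cc β) y with hX
  have nn2 : NearNull a X Λ' (ε * (R * d) ^ (n - 1)) x₀ (R * d) := by
    refine ⟨fun β => (hvm β).sub ((aestronglyMeasurable_const).indicator hΩ.measurableSet), hΛ'0, by positivity,
      fun β => ?_, hsm (R * d) (by positivity) (by linarith)⟩
    filter_upwards [hvb β] with y hy
    refine (norm_sub_le _ _).trans (add_le_add hy ((norm_indicator_le_norm_self _ _).trans ?_))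
    exact Finset.single_le_sum (f := fun β => ‖cc β‖) (fun β _ => norm_nonneg _) (Finset.mem_univ β)
  have hxs : dist (x₀ - d • e) x₀ = d := by
    rw [dist_eq_norm, sub_sub_cancel_left, norm_neg, norm_smul, he1, Real.norm_eq_abs, abs_of_pos hd0, mul_one]
  have hbig := hest X Λ' ε x₀ (R * d) (by positivity) nn2 x (x₀ - d • e) (s * d) (s * d) hsd hsd
    (by rw [← hdd]; nlinarith) (by rw [hxs]; nlinarith) β
  have hz : Avg b (X β) (x₀ - d • e) (s * d) = 0 := by
    rw [avg_congr_ball hb hsd (w' := fun _ => 0)]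
    · simp [Avg]
    intro y hy
    rw [mem_ball] at hy
    have h1 : dist y x₀ ≤ s * d + d := by
      have := dist_triangle y (x₀ - d • e) x₀; rw [hxs] at this; linarith
    have h2 : d - s * d ≤ dist y x₀ := by
      have := dist_triangle (x₀ - d • e) y x₀; rw [hxs, dist_comm _ y] at this; linarith
    have h3 : s * d ≤ d / 4 := by nlinarith
    have hyn : y ∉ Ω := by
      refine (hfl y (by linarith) (by linarith)).2.1 ?_
      have h4 : inner ℝ e (y - (x₀ - d • e)) ≤ dist y (x₀ - d • e) := by
        have := real_inner_le_norm e (y - (x₀ - d • e))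
        rwa [he1, one_mul, ← dist_eq_norm] at this
      have h5 : y - x₀ = (y - (x₀ - d • e)) - d • e := by abel
      rw [h5, inner_sub_right, inner_smul_right, real_inner_self_eq_norm_sq, he1]
      linarith
    simp [hX, hvz β y hyn, hyn]
  have hin : Avg b (X β) x (s * d) = Avg b (v β) x (s * d) - cc β := by
    have hsub : ball x (s * d) ⊆ Ω := (ball_subset_ball (by linarith)).trans hball
    rw [avg_congr_ball hb hsd (w' := fun y => v β y - cc β)]
    · rw [Avg_eq b _ x hsd, Avg_eq b _ x hsd]
      have hbt := bmp_test hb x hsd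
      have i1 : Integrable (fun y => bmp b x (s * d) y • v β y) := by
        have := integrable_test_mul (Complex.continuous_ofReal.comp hbt.smooth.continuous)
          (hbt.cpt.comp_left (g := fun t : ℝ => (t:ℂ)) (by simp)) (hvm β) (hvb β)
        exact this.congr (Eventually.of_forall fun y => by simp [Complex.real_smul])
      simp only [smul_sub]
      rw [integral_sub i1 ((bmp_integrable hb x hsd).smul_const _), integral_smul_const, bmp_int hb1 x hsd, one_smul]
    · intro y hy
      simp [hX, hsub hy]
  rw [hz, sub_zero, hin, sub_self, abs_zero, add_zero] at hbig
  have hB' : C * (Λ' * (dist x (x₀ - d • e) / (R * d)) + ε * ((R * d / (s * d)) ^ n + (R * d / (s * d)) ^ n)) ≤ 2 * (δ / 3) := by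
    have h1 : dist x (x₀ - d • e) ≤ 2 * d := by
      have := dist_triangle x x₀ (x₀ - d • e); rw [dist_comm x₀, hxs, ← hdd] at this; linarith
    have h2 : dist x (x₀ - d • e) / (R * d) ≤ 2 / R := by
      rw [div_le_div_iff₀ (by positivity) hR0]; nlinarith
    have h3 : R * d / (s * d) = R / s := by field_simp
    have h4 : C * (Λ' * (2 / R)) ≤ δ / 3 := by
      rw [div_le_iff₀ hδ] at hR2
      have : C * (Λ' * (2 / R)) = 2 * (C * Λ') / R := by ring
      rw [this, div_le_iff₀ hR0]
      nlinarith
    have h5 : C * (ε * ((R / s) ^ n + (R / s) ^ n)) ≤ δ / 3 := by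
      have hq : 0 < (R / s) ^ n := by positivity
      have : (C + 1) * (ε * ((R / s) ^ n + (R / s) ^ n)) = δ / 3 := by
        rw [hε]; field_simp; norm_num
      rw [← this]
      gcongr
      linarith
    rw [h3, mul_add]
    have h6 : C * (Λ' * (dist x (x₀ - d • e) / (R * d))) ≤ C * (Λ' * (2 / R)) := by gcongr
    linarith
  have h7 : v β x - cc β = (Avg b (v β) x (s * d) - cc β) - (Avg b (v β) x (s * d) - v β x) := by ring
  rw [h7]
  refine (norm_sub_le _ _).trans ?_
  linarith

/-- The nontangential trace at a good boundary point. -/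
theorem point_trace (hn : 1 ≤ n) {a : Fin n → Fin N → Fin M → ℂ}
    (hell : ∀ ξ : Euc n, ξ ≠ 0 → ∀ v : Fin M → ℂ,
      (∀ α : Fin N, ∑ β : Fin M, (∑ j : Fin n, a j α β * (ξ j : ℂ)) * v β = 0) → v = 0)
    {Ω F : Set (Euc n)} (hΩ : IsOpen Ω) {σ : Measure (Euc n)} {κ : ℝ} (hκ : 0 < κ) {x₀ ν : Euc n}
    (hx₀ : x₀ ∈ frontier Ω) (hν : IsNormal σ Ω x₀ ν) (hν0 : ν ≠ 0) (hF : FlatAt Ω x₀ (unv ν))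
    (hd : DensAt (frontier Ω) F x₀)
    {v : Fin M → Euc n → ℂ} {Λ : ℝ} (hΛ : 0 ≤ Λ)
    (hvm : ∀ β, AEStronglyMeasurable (v β) volume) (hvb : ∀ β, ∀ᵐ y, ‖v β y‖ ≤ Λ)
    (hvz : ∀ β, ∀ y ∉ Ω, v β y = 0)
    (hv0 : ∀ y r, ball y r ⊆ Ω → (∀ z ∈ ball y r, chi Ω F κ z = 1) → ∀ φ, IsTest (ball y r) φ → ∀ α, PD a v φ α = 0)
    {g : Fin N → ℂ} (hg : BdRep σ a v x₀ g) {cc : Fin M → ℂ}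
    (hcc : ∀ α, ∑ β, (∑ j, a j α β * (ν j : ℂ)) * cc β = g α)
    {u : Euc n → EuclideanSpace ℂ (Fin M)} (hu : ∀ y ∈ Ω, chi Ω F κ y = 1 → ∀ β, v β y = u y β)
    {κ' : ℝ} (hκ' : 0 < κ') : HasNTTrace Ω κ' u x₀ (WithLp.toLp 2 cc) := by
  refine ⟨flat_access hΩ hx₀ (unv_norm hν0) hF hκ', ?_⟩
  obtain ⟨b, hb, -, hb1, -⟩ := exists_bump n
  have hleb : ∀ᵐ x, ∀ β, Tendsto (fun s => Avg b (v β) x s) (𝓝[>] 0) (𝓝 (v β x)) :=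
    ae_all_iff.2 fun β => avg_lebesgue hb hb1 (hvm β) (hvb β)
  set N0 := {x : Euc n | ¬ ∀ β, Tendsto (fun s => Avg b (v β) x s) (𝓝[>] 0) (𝓝 (v β x))} with hN0
  refine ⟨ntRegion Ω κ' x₀ ∩ N0, inter_subset_left, measure_mono_null inter_subset_right hleb, ?_⟩
  have hpt : Tendsto (fun y => (WithLp.ofLp (u y) : Fin M → ℂ)) (𝓝[ntRegion Ω κ' x₀ \ (ntRegion Ω κ' x₀ ∩ N0)] x₀) (𝓝 cc) := by
    rw [tendsto_pi_nhds]
    intro β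
    rw [Metric.tendsto_nhdsWithin_nhds]
    intro δ hδ
    obtain ⟨d₀, hd₀, h⟩ := point_conv hn hell hb hb1 hΩ hκ hx₀ hν hν0 hF hd hΛ hvm hvb hvz hv0 hg hcc hκ' (half_pos hδ)
    refine ⟨d₀, hd₀, fun {x} hx hxd => ?_⟩
    have hx' : x ∉ N0 := fun hh => hx.2 ⟨hx.1, hh⟩
    have hx'' := not_not.1 hx'
    obtain ⟨h1, h2⟩ := h x hx.1 hxd hx''
    rw [← hu x hx.1.1 h1 β, dist_eq_norm]
    exact (h2 β).trans_lt (by linarith)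
  exact ((PiLp.continuous_toLp 2 _).tendsto cc).comp hpt
end

open MeasureTheory Metric Set Filter
open scoped ENNReal NNReal Topology

/-! ### Part 11: a.e. existence of boundary data and of normals -/
noncomputable section
variable {n N M : ℕ}

def saw (Ω F : Set (Euc n)) (κ : ℝ) (u : Euc n → EuclideanSpace ℂ (Fin M)) (β : Fin M) (y : Euc n) : ℂ :=
  Ω.indicator (fun y => (chi Ω F κ y : ℂ) * u y β) y

def NullSol (a : Fin n → Fin N → Fin M → ℂ) (Ω : Set (Euc n)) (u : Euc n → EuclideanSpace ℂ (Fin M)) : Prop :=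
  ∀ φ, IsTest Ω φ → ∀ α, ∑ j, ∑ β, a j α β * ∫ x in Ω, (pd j φ x : ℂ) * u x β = 0

theorem measurable_chi (Ω F : Set (Euc n)) (κ : ℝ) : Measurable (chi Ω F κ) := by
  have h1 : Measurable (dl Ω) := (continuous_dl Ω).measurable
  have h2 : Measurable (fun y => infDist y F) := (continuous_infDist_pt F).measurable
  unfold chi
  fun_prop

theorem chi_nonneg (Ω F : Set (Euc n)) {κ : ℝ} (hκ : 0 < κ) (y : Euc n) : 0 ≤ chi Ω F κ y := by
  have := dl_nonneg Ω y
  unfold chi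
  apply div_nonneg (le_min (le_max_right _ _) (by positivity)) (by positivity)

theorem chi_le_one (Ω F : Set (Euc n)) {κ : ℝ} (hκ : 0 < κ) (y : Euc n) : chi Ω F κ y ≤ 1 := by
  have := dl_nonneg Ω y
  unfold chi
  exact div_le_one_of_le₀ (min_le_right _ _) (by positivity)

theorem chi_supp {Ω F : Set (Euc n)} {κ : ℝ} {y : Euc n} (h : chi Ω F κ y ≠ 0) (hκ : 0 < κ) :
    infDist y F ≤ (1 + κ) * dl Ω y := by
  by_contra hcon
  push Not at hcon
  apply h
  have := dl_nonneg Ω y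
  unfold chi
  rw [max_eq_right (by linarith), min_eq_left (by positivity), zero_div]

theorem saw_meas {Ω : Set (Euc n)} (hΩ : IsOpen Ω) (F : Set (Euc n)) (κ : ℝ) {u : Euc n → EuclideanSpace ℂ (Fin M)}
    (hu : AEStronglyMeasurable u (volume.restrict Ω)) (β : Fin M) :
    AEStronglyMeasurable (saw Ω F κ u β) volume := by
  unfold saw
  rw [aestronglyMeasurable_indicator_iff hΩ.measurableSet]
  have h1 : AEStronglyMeasurable (fun y => (chi Ω F κ y : ℂ)) (volume.restrict Ω) :=
    (Complex.measurable_ofReal.comp (measurable_chi Ω F κ)).aestronglyMeasurable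
  have h2 : AEStronglyMeasurable (fun y => u y β) (volume.restrict Ω) :=
    (EuclideanSpace.proj (𝕜 := ℂ) β).continuous.comp_aestronglyMeasurable hu
  exact h1.mul h2

theorem saw_bound {Ω F : Set (Euc n)} {κ Λ : ℝ} (hκ : 0 < κ) (hΛ : 0 ≤ Λ) {u : Euc n → EuclideanSpace ℂ (Fin M)}
    (hb : ∀ᵐ y, y ∈ Ω → infDist y F ≤ (1 + κ) * dl Ω y → ‖u y‖ ≤ Λ) (β : Fin M) :
    ∀ᵐ y, ‖saw Ω F κ u β y‖ ≤ Λ := by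
  filter_upwards [hb] with y hy
  unfold saw
  by_cases h : y ∈ Ω
  · rw [indicator_of_mem h]
    by_cases h0 : chi Ω F κ y = 0
    · simp [h0, hΛ]
    · rw [norm_mul, Complex.norm_real, Real.norm_eq_abs, abs_of_nonneg (chi_nonneg Ω F hκ y)]
      have h1 := hy h (chi_supp h0 hκ)
      have h2 : ‖u y β‖ ≤ ‖u y‖ := PiLp.norm_apply_le _ _
      nlinarith [chi_le_one Ω F hκ y, chi_nonneg Ω F hκ y, norm_nonneg (u y β)]
  · rw [indicator_of_notMem h]; simpa

theorem int_test {Ω : Set (Euc n)} {u : Euc n → EuclideanSpace ℂ (Fin M)}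
    (hloc : LocallyIntegrableOn u Ω volume) {φ : Euc n → ℝ} (hφ : IsTest Ω φ) (β : Fin M) :
    Integrable (fun y => (φ y : ℂ) * u y β) (volume.restrict Ω) := by
  have hi : IntegrableOn u (tsupport φ) volume := hloc.integrableOn_compact_subset hφ.supp hφ.cpt
  have hi2 : IntegrableOn (fun y => u y β) (tsupport φ) volume :=
    (EuclideanSpace.proj (𝕜 := ℂ) β).integrable_comp hi
  have hi3 : IntegrableOn (fun y => (φ y : ℂ) * u y β) (tsupport φ) volume :=
    hi2.continuousOn_mul (Complex.continuous_ofReal.comp hφ.smooth.continuous).continuousOn hφ.cpt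
  have : Integrable (fun y => (φ y : ℂ) * u y β) volume := by
    refine (integrableOn_iff_integrable_of_support_subset ?_).1 hi3
    intro y hy
    refine subset_tsupport _ fun h0 => hy ?_
    have h0' : φ y = 0 := h0
    simp [h0']
  exact this.restrict

/-- the real field attached to a row of the system -/
def rowL (q : Fin n → Fin M → ℂ) : EuclideanSpace ℂ (Fin M) →L[ℝ] Euc n :=
  LinearMap.toContinuousLinearMap
    { toFun := fun w => WithLp.toLp 2 fun j => (∑ β, q j β * w β).re
      map_add' := fun w w' => by
        ext j; simp [mul_add, Finset.sum_add_distrib]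
      map_smul' := fun t w => by
        ext j
        simp only [PiLp.smul_apply, RingHom.id_apply, smul_eq_mul, Complex.real_smul, Complex.re_sum, Finset.mul_sum]
        refine Finset.sum_congr rfl fun β _ => ?_
        simp; ring }

theorem rowL_apply (q : Fin n → Fin M → ℂ) (w : EuclideanSpace ℂ (Fin M)) (j : Fin n) :
    rowL q w j = (∑ β, q j β * w β).re := rfl

theorem fderiv_row (q : Fin n → Fin M → ℂ) (w : EuclideanSpace ℂ (Fin M)) (φ : Euc n → ℝ) (y : Euc n) :
    fderiv ℝ φ y (rowL q w) = (∑ j, ∑ β, q j β * ((pd j φ y : ℂ) * w β)).re := by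
  rw [clm_eq_sum, Complex.re_sum]
  refine Finset.sum_congr rfl fun j _ => ?_
  rw [rowL_apply, Complex.re_sum, Complex.re_sum, Finset.sum_mul]
  refine Finset.sum_congr rfl fun β _ => ?_
  have : q j β * ((pd j φ y : ℂ) * w β) = (pd j φ y : ℂ) * (q j β * w β) := by ring
  rw [this, Complex.re_ofReal_mul, mul_comm]; rfl

theorem reCLM_apply_int {μ : Measure (Euc n)} {f : Euc n → ℂ} (hf : Integrable f μ) :
    ∫ x, (f x).re ∂μ = (∫ x, f x ∂μ).re := Complex.reCLM.integral_comp_comm hf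

theorem row_divFree {a : Fin n → Fin N → Fin M → ℂ} {Ω : Set (Euc n)} {u : Euc n → EuclideanSpace ℂ (Fin M)}
    (hloc : LocallyIntegrableOn u Ω volume) (hD : NullSol a Ω u) (α : Fin N) :
    DivFree Ω (fun y => rowL (fun j β => a j α β) (u y)) := by
  intro φ hφ
  have h := hD φ hφ α
  have hi : ∀ j β, Integrable (fun x => a j α β * ((pd j φ x : ℂ) * u x β)) (volume.restrict Ω) := fun j β =>
    (int_test hloc (hφ.pd j) β).const_mul _
  simp only [fderiv_row]
  have hi2 : Integrable (fun x => ∑ j, ∑ β, a j α β * ((pd j φ x : ℂ) * u x β)) (volume.restrict Ω) :=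
    integrable_finset_sum _ fun j _ => integrable_finset_sum _ fun β _ => hi j β
  have h3 := reCLM_apply_int hi2
  rw [h3, integral_finset_sum _ fun j _ => integrable_finset_sum _ fun β _ => hi j β]
  rw [Finset.sum_congr rfl fun j _ => integral_finset_sum _ fun β _ => hi j β]
  simp only [integral_const_mul]
  rw [h]; rfl

theorem pd_add {U : Set (Euc n)} {φ ψ : Euc n → ℝ} (hφ : IsTest U φ) (hψ : IsTest U ψ) (j : Fin n) (y : Euc n) :
    pd j (φ + ψ) y = pd j φ y + pd j ψ y := by
  unfold pd
  rw [fderiv_add (hφ.smooth.differentiable (by simp) y) (hψ.smooth.differentiable (by simp) y)]; rfl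

theorem pd_smul {U : Set (Euc n)} {φ : Euc n → ℝ} (hφ : IsTest U φ) (t : ℝ) (j : Fin n) (y : Euc n) :
    pd j (t • φ) y = t * pd j φ y := by
  unfold pd
  rw [fderiv_const_smul (hφ.smooth.differentiable (by simp) y)]; rfl
end

open MeasureTheory Metric Set Filter
open scoped ENNReal NNReal Topology

noncomputable section
variable {n N M : ℕ}

theorem pdint {U : Set (Euc n)} {φ : Euc n → ℝ} (hφ : IsTest U φ) {w : Euc n → ℂ} {Λ : ℝ}
    (hwm : AEStronglyMeasurable w volume) (hwb : ∀ᵐ y, ‖w y‖ ≤ Λ) (j : Fin n) :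
    Integrable (fun y => (pd j φ y : ℂ) * w y) volume :=
  integrable_test_mul (Complex.continuous_ofReal.comp (hφ.pd j).smooth.continuous)
    ((hφ.pd j).cpt.comp_left (g := fun t : ℝ => (t:ℂ)) (by simp)) hwm hwb

theorem PD_add {U : Set (Euc n)} {φ ψ : Euc n → ℝ} (hφ : IsTest U φ) (hψ : IsTest U ψ)
    (a : Fin n → Fin N → Fin M → ℂ) {w : Fin M → Euc n → ℂ} {Λ : ℝ}
    (hwm : ∀ β, AEStronglyMeasurable (w β) volume) (hwb : ∀ β, ∀ᵐ y, ‖w β y‖ ≤ Λ) (α : Fin N) :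
    PD a w (φ + ψ) α = PD a w φ α + PD a w ψ α := by
  unfold PD
  rw [← Finset.sum_add_distrib]
  refine Finset.sum_congr rfl fun j _ => ?_
  rw [← Finset.sum_add_distrib]
  refine Finset.sum_congr rfl fun β _ => ?_
  rw [← mul_add, ← integral_add (pdint hφ (hwm β) (hwb β) j) (pdint hψ (hwm β) (hwb β) j)]
  congr 1
  refine integral_congr_ae (Eventually.of_forall fun y => ?_)
  simp only [pd_add hφ hψ j y]; push_cast; ring

theorem PD_smul {U : Set (Euc n)} {φ : Euc n → ℝ} (hφ : IsTest U φ) (t : ℝ)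
    (a : Fin n → Fin N → Fin M → ℂ) (w : Fin M → Euc n → ℂ) (α : Fin N) :
    PD a w (t • φ) α = t * PD a w φ α := by
  unfold PD
  rw [Finset.mul_sum]
  refine Finset.sum_congr rfl fun j _ => ?_
  rw [Finset.mul_sum]
  refine Finset.sum_congr rfl fun β _ => ?_
  have : ∫ y, (pd j (t • φ) y : ℂ) * w β y = t * ∫ y, (pd j φ y : ℂ) * w β y := by
    rw [← integral_const_mul]
    refine integral_congr_ae (Eventually.of_forall fun y => ?_)
    simp only [pd_smul hφ t j y]; push_cast; ring
  rw [this]; ring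

theorem PD_coef (a : Fin n → Fin N → Fin M → ℂ) (w : Fin M → Euc n → ℂ) (t : ℂ) (φ : Euc n → ℝ) (α : Fin N) :
    PD (fun j α β => t * a j α β) w φ α = t * PD a w φ α := by
  unfold PD
  simp only [Finset.mul_sum, mul_assoc]

theorem NullSol.coef {a : Fin n → Fin N → Fin M → ℂ} {Ω : Set (Euc n)} {u : Euc n → EuclideanSpace ℂ (Fin M)}
    (h : NullSol a Ω u) (t : ℂ) : NullSol (fun j α β => t * a j α β) Ω u := by
  intro φ hφ α
  have := h φ hφ α
  simp only [mul_assoc]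
  simp only [← Finset.mul_sum]
  rw [this, mul_zero]

theorem row_rep {Ω : Set (Euc n)} {σ : Measure (Euc n)} {D c C : ℝ} (G : Geo Ω σ D c C)
    {F : Set (Euc n)} {κ : ℝ} (hκ : 0 < κ) (hκ1 : κ ≤ 1)
    {a : Fin n → Fin N → Fin M → ℂ} {u : Euc n → EuclideanSpace ℂ (Fin M)}
    (hloc : LocallyIntegrableOn u Ω volume) (hD : NullSol a Ω u) {Λ : ℝ} (hΛ : 0 ≤ Λ)
    (hb : ∀ᵐ y, y ∈ Ω → infDist y F ≤ (1 + κ) * dl Ω y → ‖u y‖ ≤ Λ)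
    {x₁ : Euc n} (hx : x₁ ∈ frontier Ω) {ρ : ℝ} (hρ : 0 < ρ) (hρD : 4 * ρ < D) (α : Fin N) :
    ∀ᵐ x ∂(σ.restrict (ball x₁ ρ)), ∃ γ, LocRep σ (fun φ => (PD a (saw Ω F κ u) φ α).re) x γ := by
  have hum := hloc.aestronglyMeasurable
  have hvm := saw_meas G.op F κ hum
  have hvb := saw_bound hκ hΛ hb
  set L := rowL (fun j β => a j α β) with hL
  have hWloc : LocallyIntegrableOn (fun y => L (u y)) Ω volume := by
    intro x hx
    obtain ⟨s, hs, hi⟩ := hloc x hx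
    exact ⟨s, hs, L.integrable_comp hi⟩
  obtain ⟨K, hK, hest⟩ := div_est G (F := F) hκ hκ1 hWloc (row_divFree hloc hD α) (Λ := ‖L‖ * Λ) (by positivity)
    (by filter_upwards [hb] with y hy h1 h2
        exact (L.le_opNorm _).trans (mul_le_mul_of_nonneg_left (hy h1 h2) (norm_nonneg _))) hx hρ hρD
  refine loc_rep G hκ hκ1 (F := F) hx hρ hρD _ (fun φ ψ hφ hψ => ?_) (fun φ t hφ => ?_) K hK (fun φ hφ => ?_)
  · rw [PD_add hφ hψ a hvm hvb, Complex.add_re]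
  · rw [PD_smul hφ t a, Complex.re_ofReal_mul]
  · have h := hest φ hφ
    have hi : ∀ j β, Integrable (fun y => a j α β * ((pd j φ y : ℂ) * saw Ω F κ u β y)) volume := fun j β =>
      (pdint hφ (hvm β) (hvb β) j).const_mul _
    have hi2 : Integrable (fun y => ∑ j, ∑ β, a j α β * ((pd j φ y : ℂ) * saw Ω F κ u β y)) volume :=
      integrable_finset_sum _ fun j _ => integrable_finset_sum _ fun β _ => hi j β
    have e : (PD a (saw Ω F κ u) φ α).re = ∫ y in Ω, chi Ω F κ y * fderiv ℝ φ y (L (u y)) := by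
      have e1 : PD a (saw Ω F κ u) φ α = ∫ y, ∑ j, ∑ β, a j α β * ((pd j φ y : ℂ) * saw Ω F κ u β y) := by
        rw [integral_finset_sum _ fun j _ => integrable_finset_sum _ fun β _ => hi j β]
        rw [Finset.sum_congr rfl fun j _ => integral_finset_sum _ fun β _ => hi j β]
        simp only [integral_const_mul]
        rfl
      rw [e1, ← reCLM_apply_int hi2, ← integral_indicator G.op.measurableSet]
      refine integral_congr_ae (Eventually.of_forall fun y => ?_)
      by_cases hy : y ∈ Ω
      · simp only [saw, indicator_of_mem hy, hL, fderiv_row]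
        rw [← Complex.re_ofReal_mul, Finset.mul_sum]
        congr 1
        refine Finset.sum_congr rfl fun j _ => ?_
        rw [Finset.mul_sum]
        refine Finset.sum_congr rfl fun β _ => ?_
        ring
      · simp [saw, indicator_of_notMem hy]
    rw [e]; exact h

theorem bd_rep {Ω : Set (Euc n)} {σ : Measure (Euc n)} {D c C : ℝ} (G : Geo Ω σ D c C)
    {F : Set (Euc n)} {κ : ℝ} (hκ : 0 < κ) (hκ1 : κ ≤ 1)
    {a : Fin n → Fin N → Fin M → ℂ} {u : Euc n → EuclideanSpace ℂ (Fin M)}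
    (hloc : LocallyIntegrableOn u Ω volume) (hD : NullSol a Ω u) {Λ : ℝ} (hΛ : 0 ≤ Λ)
    (hb : ∀ᵐ y, y ∈ Ω → infDist y F ≤ (1 + κ) * dl Ω y → ‖u y‖ ≤ Λ)
    {x₁ : Euc n} (hx : x₁ ∈ frontier Ω) {ρ : ℝ} (hρ : 0 < ρ) (hρD : 4 * ρ < D) :
    ∀ᵐ x ∂(σ.restrict (ball x₁ ρ)), ∃ g, BdRep σ a (saw Ω F κ u) x g := by
  have h1 := ae_all_iff.2 fun α => row_rep G hκ hκ1 hloc hD hΛ hb hx hρ hρD α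
  have h2 := ae_all_iff.2 fun α => row_rep G hκ hκ1 hloc (hD.coef (-Complex.I)) hΛ hb hx hρ hρD α
  filter_upwards [h1, h2] with x hx1 hx2
  choose γ1 hγ1 using hx1
  choose γ2 hγ2 using hx2
  refine ⟨fun α => γ1 α + Complex.I * γ2 α, fun η hη => ?_⟩
  choose r1 hr1 hh1 using fun α => hγ1 α (η / 2) (by positivity)
  choose r2 hr2 hh2 using fun α => hγ2 α (η / 2) (by positivity)
  have hev : ∀ᶠ r in 𝓝[>] (0:ℝ), ∀ α, r < r1 α ∧ r < r2 α := by
    rw [eventually_all]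
    intro α
    filter_upwards [Ioo_mem_nhdsGT (hr1 α), Ioo_mem_nhdsGT (hr2 α)] with r h1 h2
    exact ⟨h1.2, h2.2⟩
  obtain ⟨r₀, hr₀, hall⟩ := (mem_nhdsGT_iff_exists_Ioo_subset).1 hev
  refine ⟨r₀, hr₀, fun r hr hrr φ hφ B hB α => ?_⟩
  have hra := hall ⟨hr, hrr⟩ α
  have q1 := hh1 α r hr hra.1 φ hφ B hB
  have q2 := hh2 α r hr hra.2 φ hφ B hB
  simp only [PD_coef] at q2
  set Z := PD a (saw Ω F κ u) φ α with hZ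
  set I := ∫ y, φ y ∂σ with hI
  have e2 : (-Complex.I * Z).re = Z.im := by simp
  rw [e2] at q2
  refine (Complex.norm_le_abs_re_add_abs_im _).trans ?_
  have e3 : (Z - (γ1 α + Complex.I * γ2 α) * (I : ℝ)).re = Z.re - γ1 α * I := by simp
  have e4 : (Z - (γ1 α + Complex.I * γ2 α) * (I : ℝ)).im = Z.im - γ2 α * I := by simp
  rw [e3, e4]
  linarith

theorem integral_pd_zero {U : Set (Euc n)} {φ : Euc n → ℝ} (hφ : IsTest U φ) (j : Fin n) :
    ∫ y, fderiv ℝ φ y (EuclideanSpace.single j 1) = 0 := by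
  have i1 : Integrable (fun y => fderiv ℝ φ y (EuclideanSpace.single j 1)) volume :=
    (hφ.pd j).smooth.continuous.integrable_of_hasCompactSupport (hφ.pd j).cpt
  have i2 : Integrable φ volume := hφ.smooth.continuous.integrable_of_hasCompactSupport hφ.cpt
  have := integral_mul_fderiv_eq_neg_fderiv_mul_of_integrable (μ := (volume : Measure (Euc n))) (𝕜 := ℝ)
    (f := fun _ => (1:ℝ)) (g := φ) (v := EuclideanSpace.single j 1) (by simp) (by simpa using i1) (by simpa using i2)
    (fun x _ => differentiableAt_const _) (fun x _ => hφ.smooth.differentiable (by simp) x)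
  simpa using this

theorem normal_ae {Ω : Set (Euc n)} {σ : Measure (Euc n)} {D c C : ℝ} (G : Geo Ω σ D c C)
    {x₁ : Euc n} (hx : x₁ ∈ frontier Ω) {ρ : ℝ} (hρ : 0 < ρ) (hρD : 4 * ρ < D) :
    ∀ᵐ x ∂(σ.restrict (ball x₁ ρ)), ∃ ν, IsNormal σ Ω x ν := by
  have hintg : ∀ {U : Set (Euc n)} {φ : Euc n → ℝ}, IsTest U φ → ∀ j, Integrable (pd j φ) (volume.restrict Ω) :=
    fun hφ j => ((hφ.pd j).smooth.continuous.integrable_of_hasCompactSupport (hφ.pd j).cpt).restrict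
  have h1 : ∀ j : Fin n, ∀ᵐ x ∂(σ.restrict (ball x₁ ρ)), ∃ γ, LocRep σ (fun φ => ∫ y in Ω, pd j φ y) x γ := by
    intro j
    obtain ⟨K, hK, hest⟩ := div_est G (F := frontier Ω) one_pos le_rfl
      (W := fun _ => EuclideanSpace.single j 1) ((continuous_const.locallyIntegrable).locallyIntegrableOn _)
      (by
        intro φ hφ
        rw [setIntegral_eq_integral_of_forall_compl_eq_zero]
        · exact integral_pd_zero hφ j
        · intro y hy
          have := (hφ.pd j)
          by_contra hne
          exact hy (this.supp (subset_tsupport _ hne)))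
      (Λ := 1) zero_le_one (Eventually.of_forall fun y _ _ => by simp) hx hρ hρD
    refine loc_rep G one_pos le_rfl (F := frontier Ω) hx hρ hρD _ (fun φ ψ hφ hψ => ?_) (fun φ t hφ => ?_) K hK (fun φ hφ => ?_)
    · rw [← integral_add (hintg hφ j) (hintg hψ j)]
      exact integral_congr_ae (Eventually.of_forall fun y => pd_add hφ hψ j y)
    · rw [← integral_const_mul]
      exact integral_congr_ae (Eventually.of_forall fun y => pd_smul hφ t j y)
    · have h := hest φ hφ
      have e : ∫ y in Ω, chi Ω (frontier Ω) 1 y * fderiv ℝ φ y (EuclideanSpace.single j 1) = ∫ y in Ω, pd j φ y := by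
        refine setIntegral_congr_fun G.op.measurableSet fun y hy => ?_
        have hp := dl_pos G.op hx hy
        change chi Ω (frontier Ω) 1 y * fderiv ℝ φ y (EuclideanSpace.single j 1) = _
        rw [chi_one one_pos hp (by rw [dl_eq G.op hx hy]; nlinarith), one_mul]; rfl
      rw [e] at h; exact h
  filter_upwards [ae_all_iff.2 h1] with x hx1
  choose γ hγ using hx1
  refine ⟨WithLp.toLp 2 γ, fun η hη => ?_⟩
  have hn0 : (0:ℝ) < n := by have := G.hn; exact_mod_cast (by omega : 0 < n)
  choose r1 hr1 hh1 using fun j => hγ j (η / n) (by positivity)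
  have hev : ∀ᶠ r in 𝓝[>] (0:ℝ), ∀ j, r < r1 j := by
    rw [eventually_all]
    intro j
    filter_upwards [Ioo_mem_nhdsGT (hr1 j)] with r h1
    exact h1.2
  obtain ⟨r₀, hr₀, hall⟩ := (mem_nhdsGT_iff_exists_Ioo_subset).1 hev
  refine ⟨r₀, hr₀, fun r hr hrr φ hφ B hB w => ?_⟩
  have q := fun j => hh1 j r hr (hall ⟨hr, hrr⟩ j) φ hφ B hB
  simp only at q
  set I := ∫ y, φ y ∂σ with hI
  have hB0 : 0 ≤ B := (abs_nonneg _).trans (hB 0)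
  have e1 : ∫ y in Ω, fderiv ℝ φ y w = ∑ j, w j * ∫ y in Ω, pd j φ y := by
    have e0 : ∀ y, fderiv ℝ φ y w = ∑ j, w j * pd j φ y := fun y => clm_eq_sum _ w
    simp only [e0]
    rw [integral_finset_sum _ fun j _ => (hintg hφ j).const_mul (w j)]
    exact Finset.sum_congr rfl fun j _ => integral_const_mul _ _
  have e2 : inner ℝ (WithLp.toLp 2 γ) w = ∑ j, w j * γ j := by
    rw [PiLp.inner_apply]
    exact Finset.sum_congr rfl fun j _ => by simp
  rw [e1, e2, Finset.sum_mul, ← Finset.sum_sub_distrib]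
  calc _ ≤ ∑ j : Fin n, ‖w‖ * (η / n * B * r ^ (n - 1)) := by
        refine (Finset.abs_sum_le_sum_abs _ _).trans (Finset.sum_le_sum fun j _ => ?_)
        rw [mul_assoc, ← mul_sub, abs_mul]
        exact mul_le_mul (PiLp.norm_apply_le w j) (q j) (abs_nonneg _) (norm_nonneg _)
    _ = η * ‖w‖ * B * r ^ (n - 1) := by
        rw [Finset.sum_const, Finset.card_univ, Fintype.card_fin, nsmul_eq_mul]; field_simp
end

open MeasureTheory Metric Set Filter
open scoped ENNReal NNReal Topology

/-! ### Part 12: density points and sawtooth sets -/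
noncomputable section
variable {n N M : ℕ}

theorem dens_ae {Ω : Set (Euc n)} {σ : Measure (Euc n)} {D c C : ℝ} (G : Geo Ω σ D c C)
    {F : Set (Euc n)} (hF : IsClosed F) (hFS : F ⊆ frontier Ω)
    {x₁ : Euc n} (hx : x₁ ∈ frontier Ω) {ρ : ℝ} (hρ : 0 < ρ) (hρD : 4 * ρ < D) :
    ∀ᵐ x ∂(σ.restrict (ball x₁ ρ)), x ∈ F → DensAt (frontier Ω) F x := by
  have hfin := G.fin hx hρ (by linarith)
  set μ := σ.restrict (ball x₁ ρ) with hμ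
  have h := Besicovitch.ae_tendsto_measure_inter_div μ F
  rw [ae_restrict_iff' hF.measurableSet] at h
  have hin : ∀ᵐ x ∂μ, x ∈ ball x₁ ρ := ae_restrict_mem isOpen_ball.measurableSet
  filter_upwards [h, hin] with x hxl hxb hxF
  have hlim := (ENNReal.tendsto_toReal ENNReal.one_ne_top).comp (hxl hxF)
  intro η' hη'
  set η := min η' 1 with hη
  have hη0 : 0 < η := by positivity
  have hη1 : η ≤ 1 := min_le_right _ _
  have hc := G.hc
  have hC := G.hC
  set θ := c * η ^ (n - 1) / (C * 3 ^ (n - 1)) with hθ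
  have hθ0 : 0 < θ := by positivity
  have hev : ∀ᶠ r in 𝓝[>] (0:ℝ), 1 - θ < ((μ (F ∩ closedBall x r)) / μ (closedBall x r)).toReal :=
    hlim.eventually (lt_mem_nhds (by simpa using hθ0))
  obtain ⟨r₀, hr₀, hall⟩ := (mem_nhdsGT_iff_exists_Ioo_subset).1 hev
  have hr₀' : 0 < r₀ := hr₀
  obtain ⟨t, ht, htb⟩ := Metric.isOpen_iff.1 isOpen_ball x hxb
  refine ⟨min (r₀ / 2) (min (t / 3) (D / 3)), by have := G.hD; positivity, fun z hz hzd => ?_⟩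
  have hz1 : dist z x < r₀ / 2 := hzd.trans_le (min_le_left _ _)
  have hz2 : dist z x < t / 3 := hzd.trans_le ((min_le_right _ _).trans (min_le_left _ _))
  have hz3 : dist z x < D / 3 := hzd.trans_le ((min_le_right _ _).trans (min_le_right _ _))
  set d := dist z x with hd
  rcases (dist_nonneg : 0 ≤ dist z x).eq_or_lt with h0 | h0
  · have : z = x := dist_eq_zero.1 h0.symm
    rw [this, infDist_zero_of_mem hxF]; positivity
  rw [← hd] at h0
  by_contra hcon
  push Not at hcon
  have hcon' : η * d < infDist z F := lt_of_le_of_lt (by gcongr; exact min_le_left _ _) hcon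
  have hlt : 1 - θ < ((μ (F ∩ closedBall x (2 * d))) / μ (closedBall x (2 * d))).toReal :=
    hall ⟨by linarith, by linarith⟩
  rw [ENNReal.toReal_div] at hlt
  have hsub : closedBall x (2 * d) ⊆ ball x₁ ρ := (closedBall_subset_ball (by linarith)).trans htb
  have hbz : ball z (η * d) ⊆ closedBall x (2 * d) := by
    intro y hy
    rw [mem_ball] at hy
    rw [mem_closedBall]
    have := dist_triangle y z x
    nlinarith
  have hdisj : Disjoint (F ∩ closedBall x (2 * d)) (ball z (η * d)) := by
    rw [Set.disjoint_left]
    intro y hy hy'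
    have : infDist z F ≤ dist z y := infDist_le_dist_of_mem hy.1
    rw [mem_ball, dist_comm] at hy'
    linarith
  have hsum : μ.real (F ∩ closedBall x (2 * d)) + μ.real (ball z (η * d)) ≤ μ.real (closedBall x (2 * d)) := by
    rw [← measureReal_union hdisj isOpen_ball.measurableSet]
    exact measureReal_mono (union_subset inter_subset_right hbz)
  have heq : ∀ s ⊆ ball x₁ ρ, μ s = σ s := fun s hs => by
    rw [hμ, Measure.restrict_apply' isOpen_ball.measurableSet, inter_eq_left.2 hs]
  have hlo : c * (η * d) ^ (n - 1) ≤ μ.real (ball z (η * d)) := by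
    rw [Measure.real]
    refine (ENNReal.ofReal_le_iff_le_toReal (measure_ne_top _ _)).1 ?_
    rw [heq _ (hbz.trans hsub)]
    exact G.lo z hz _ (by positivity) (by nlinarith)
  have hhi : μ.real (closedBall x (2 * d)) ≤ C * (3 * d) ^ (n - 1) := by
    rw [Measure.real]
    refine ENNReal.toReal_le_of_le_ofReal (by positivity) ?_
    rw [heq _ hsub]
    exact (measure_mono (closedBall_subset_ball (by linarith))).trans (G.hi x (hFS hxF) _ (by positivity) (by linarith))
  have hlo0 : 0 < c * (η * d) ^ (n - 1) := by positivity
  have hm0 : 0 ≤ μ.real (F ∩ closedBall x (2 * d)) := measureReal_nonneg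
  set A := μ.real (closedBall x (2 * d)) with hA
  have hA0 : 0 < A := by linarith
  have e1 : c * (η * d) ^ (n - 1) = θ * (C * (3 * d) ^ (n - 1)) := by
    rw [hθ, mul_pow, mul_pow]; field_simp
  have hlt' : (1 - θ) * A < μ.real (F ∩ closedBall x (2 * d)) := by
    exact (lt_div_iff₀ hA0).1 hlt
  have : θ * A ≤ θ * (C * (3 * d) ^ (n - 1)) := by gcongr
  nlinarith

section saw
variable {Ω : Set (Euc n)} {κ : ℝ} {u : Euc n → EuclideanSpace ℂ (Fin M)}

theorem isOpen_ntRegion (hΩ : IsOpen Ω) (κ : ℝ) (x : Euc n) : IsOpen (ntRegion Ω κ x) := by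
  have h2 : Continuous (fun y => infDist y (frontier Ω)) := continuous_infDist_pt _
  have h3 : IsOpen {y | dist x y < (1 + κ) * infDist y (frontier Ω)} := isOpen_lt (by fun_prop) (by fun_prop)
  exact hΩ.inter h3

theorem nt_union_bound (hΩ : IsOpen Ω) (F : Set (Euc n)) (l : ℝ≥0∞) (hF : ∀ x ∈ F, ntMax Ω κ u x ≤ l) :
    ∀ᵐ y, (∃ x ∈ F, y ∈ ntRegion Ω κ x) → (‖u y‖₊ : ℝ≥0∞) ≤ l := by
  obtain ⟨T, hTF, hTc, hTU⟩ := TopologicalSpace.isOpen_biUnion_countable F (fun x => ntRegion Ω κ x)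
    (fun x _ => isOpen_ntRegion hΩ κ x)
  have h1 : ∀ x ∈ T, ∀ᵐ y, y ∈ ntRegion Ω κ x → (‖u y‖₊ : ℝ≥0∞) ≤ l := by
    intro x hx
    have := ENNReal.ae_le_essSup (μ := volume.restrict (ntRegion Ω κ x)) (fun y => (‖u y‖₊ : ℝ≥0∞))
    rw [ae_restrict_iff' (isOpen_ntRegion hΩ κ x).measurableSet] at this
    filter_upwards [this] with y hy h
    exact (hy h).trans (hF x (hTF hx))
  filter_upwards [(ae_ball_iff hTc).2 h1] with y hy hex
  have : y ∈ ⋃ x ∈ F, ntRegion Ω κ x := by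
    obtain ⟨x, hx, hyx⟩ := hex
    exact mem_biUnion hx hyx
  rw [← hTU] at this
  obtain ⟨x, hx, hyx⟩ := mem_iUnion₂.1 this
  exact hy x hx hyx

theorem ntMax_lsc (hΩ : IsOpen Ω) : LowerSemicontinuous (ntMax Ω κ u) := by
  rw [lowerSemicontinuous_iff_isClosed_preimage]
  intro l
  rw [← closure_subset_iff_isClosed]
  intro x hx
  have hb := nt_union_bound (κ := κ) (u := u) hΩ (ntMax Ω κ u ⁻¹' Iic l) l (fun x hx => hx)
  change essSup _ _ ≤ l
  refine essSup_le_of_ae_le l ?_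
  rw [EventuallyLE, ae_restrict_iff' (isOpen_ntRegion hΩ κ x).measurableSet]
  filter_upwards [hb] with y hy hyx
  apply hy
  have hop : IsOpen {x' : Euc n | dist x' y < (1 + κ) * infDist y (frontier Ω)} :=
    isOpen_lt (by fun_prop) (by fun_prop)
  obtain ⟨x', hx', hx''⟩ := mem_closure_iff.1 hx _ hop hyx.2
  exact ⟨x', hx'', hyx.1, hx'⟩

theorem saw_sol (hΩ : IsOpen Ω) {a : Fin n → Fin N → Fin M → ℂ} (hD : NullSol a Ω u) {F : Set (Euc n)} {κ : ℝ} :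
    ∀ y r, ball y r ⊆ Ω → (∀ z ∈ ball y r, chi Ω F κ z = 1) → ∀ φ, IsTest (ball y r) φ → ∀ α,
      PD a (saw Ω F κ u) φ α = 0 := by
  intro y r hb hchi φ hφ α
  rw [← hD φ (hφ.mono hb) α]
  unfold PD
  refine Finset.sum_congr rfl fun j _ => Finset.sum_congr rfl fun β _ => ?_
  rw [← integral_indicator hΩ.measurableSet]
  congr 1
  refine integral_congr_ae (Eventually.of_forall fun z => ?_)
  by_cases hz : z ∈ ball y r
  · simp [saw, indicator_of_mem (hb hz), hchi z hz]
  · have : pd j φ z = 0 := by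
      by_contra hne
      exact hz ((hφ.pd j).supp (subset_tsupport _ hne))
    by_cases hzΩ : z ∈ Ω <;> simp [hzΩ, this]
end saw

/-- a.e. existence of the traces, local version -/
theorem trace_local {Ω : Set (Euc n)} {σ : Measure (Euc n)} {D c C : ℝ} (G : Geo Ω σ D c C)
    (hmt : ∀ᵐ x ∂σ, x ∈ mtBoundary n Ω)
    {a : Fin n → Fin N → Fin M → ℂ}
    (hell : ∀ ξ : Euc n, ξ ≠ 0 → ∀ v : Fin M → ℂ,
      (∀ α : Fin N, ∑ β : Fin M, (∑ j : Fin n, a j α β * (ξ j : ℂ)) * v β = 0) → v = 0)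
    {κ : ℝ} (hκ : 0 < κ) {u : Euc n → EuclideanSpace ℂ (Fin M)}
    (hloc : LocallyIntegrableOn u Ω volume) (hD : NullSol a Ω u) (k : ℕ)
    {x₁ : Euc n} (hx : x₁ ∈ frontier Ω) {ρ : ℝ} (hρ : 0 < ρ) (hρD : 4 * ρ < D) :
    ∀ᵐ x ∂(σ.restrict (ball x₁ ρ)), x ∈ frontier Ω → ntMax Ω κ u x ≤ k →
      ∃ v, ∀ κ' : ℝ, 0 < κ' → HasNTTrace Ω κ' u x v := by
  have hn : 1 ≤ n := le_trans (by norm_num) G.hn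
  set F := frontier Ω ∩ ntMax Ω κ u ⁻¹' Iic (k : ℝ≥0∞) with hF
  have hFc : IsClosed F := isClosed_frontier.inter ((lowerSemicontinuous_iff_isClosed_preimage.1 (ntMax_lsc G.op)) _)
  rcases F.eq_empty_or_nonempty with hemp | hne
  · refine Eventually.of_forall fun x hx1 hx2 => ?_
    have : x ∈ F := ⟨hx1, hx2⟩
    rw [hemp] at this; exact this.elim
  set κ1 := min (κ / 2) 1 with hκ1
  have hκ10 : 0 < κ1 := by positivity
  have hκ11 : κ1 ≤ 1 := min_le_right _ _
  have hκ12 : κ1 ≤ κ / 2 := min_le_left _ _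
  have hb : ∀ᵐ y, y ∈ Ω → infDist y F ≤ (1 + κ1) * dl Ω y → ‖u y‖ ≤ (k:ℝ) := by
    filter_upwards [nt_union_bound (κ := κ) (u := u) G.op F k (fun x hx => hx.2)] with y hy h1 h2
    have hpos := dl_pos G.op hx h1
    have h3 : infDist y F < (1 + κ) * dl Ω y := by nlinarith
    obtain ⟨x, hxF, hxy⟩ := (infDist_lt_iff hne).1 h3
    have h4 := hy ⟨x, hxF, h1, by rw [dl_eq G.op hx h1, dist_comm]; exact hxy⟩
    have h5 : ‖u y‖₊ ≤ (k : ℝ≥0) := by exact_mod_cast h4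
    exact_mod_cast h5
  have hk : (0:ℝ) ≤ k := Nat.cast_nonneg k
  have hvm := saw_meas G.op F κ1 hloc.aestronglyMeasurable
  have hvb := saw_bound hκ10 hk hb
  filter_upwards [bd_rep G hκ10 hκ11 hloc hD hk hb hx hρ hρD, normal_ae G hx hρ hρD,
    dens_ae G hFc inter_subset_left hx hρ hρD, ae_restrict_of_ae hmt] with x h1 h2 h3 h4 hxS hxk
  obtain ⟨g, hg⟩ := h1
  obtain ⟨ν, hν⟩ := h2
  have hν0 := normal_ne_zero G hxS h4 hν
  have hfl := flatAt G hxS hν hν0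
  obtain ⟨cc, hcc⟩ := range_lemma G hxS hν0 hfl hk hvm hvb hg
  refine ⟨WithLp.toLp 2 cc, fun κ' hκ' => ?_⟩
  refine point_trace hn hell G.op hκ10 hxS hν hν0 hfl (h3 ⟨hxS, hxk⟩) hk hvm hvb ?_ (saw_sol G.op hD) hg hcc ?_ hκ'
  · intro β y hy
    simp [saw, hy]
  · intro y hy hchi β
    simp [saw, hy, hchi]

theorem trace_ae {Ω : Set (Euc n)} {σ : Measure (Euc n)} {D c C : ℝ} (G : Geo Ω σ D c C)
    (hmt : ∀ᵐ x ∂σ, x ∈ mtBoundary n Ω)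
    {a : Fin n → Fin N → Fin M → ℂ}
    (hell : ∀ ξ : Euc n, ξ ≠ 0 → ∀ v : Fin M → ℂ,
      (∀ α : Fin N, ∑ β : Fin M, (∑ j : Fin n, a j α β * (ξ j : ℂ)) * v β = 0) → v = 0)
    {κ : ℝ} (hκ : 0 < κ) {u : Euc n → EuclideanSpace ℂ (Fin M)}
    (hloc : LocallyIntegrableOn u Ω volume) (hD : NullSol a Ω u) (hfin : ∀ᵐ x ∂σ, ntMax Ω κ u x < ⊤) :
    ∀ᵐ x ∂σ, ∃ v, ∀ κ' : ℝ, 0 < κ' → HasNTTrace Ω κ' u x v := by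
  have hS : ∀ᵐ x ∂σ, x ∈ frontier Ω := by rw [ae_iff]; exact G.null
  have h1 : ∀ k : ℕ, ∀ᵐ x ∂σ, x ∈ frontier Ω → ntMax Ω κ u x ≤ k →
      ∃ v, ∀ κ' : ℝ, 0 < κ' → HasNTTrace Ω κ' u x v := by
    intro k
    rw [ae_iff]
    refine measure_null_of_locally_null _ fun x hx => ?_
    have hxS : x ∈ frontier Ω := by
      by_contra h; exact hx fun h' => (h h').elim
    have hD0 := G.hD
    have := trace_local G hmt hell hκ hloc hD k hxS (ρ := D / 5) (by positivity) (by linarith)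
    rw [ae_iff, Measure.restrict_apply' isOpen_ball.measurableSet] at this
    refine ⟨_, ?_, this⟩
    exact inter_mem_nhdsWithin _ (ball_mem_nhds x (by positivity))
  filter_upwards [ae_all_iff.2 h1, hS, hfin] with x h2 h3 h4
  obtain ⟨k, hk⟩ := ENNReal.exists_nat_gt h4.ne
  exact h2 k h3 hk.le
end

open MeasureTheory Metric Set Filter
open scoped ENNReal NNReal Topology

/-! ### Part 13: measurability and size of the trace -/
noncomputable section
variable {n N M : ℕ}

section fin
variable {Ω : Set (Euc n)} {κ : ℝ} {u : Euc n → EuclideanSpace ℂ (Fin M)}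

theorem nt_neBot (hΩ : IsOpen Ω) {x : Euc n} (hx : x ∈ closure (ntRegion Ω κ x)) {N0 : Set (Euc n)} (hN : volume N0 = 0) :
    NeBot (𝓝[ntRegion Ω κ x \ N0] x) := by
  rw [← mem_closure_iff_nhdsWithin_neBot, _root_.mem_closure_iff]
  intro o ho hxo
  obtain ⟨y, hy⟩ := _root_.mem_closure_iff.1 hx o ho hxo
  have hop : IsOpen (o ∩ ntRegion Ω κ x) := ho.inter (isOpen_ntRegion hΩ κ x)
  have hpos : 0 < volume (o ∩ ntRegion Ω κ x) := hop.measure_pos _ ⟨y, hy⟩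
  by_contra hcon
  rw [not_nonempty_iff_eq_empty] at hcon
  have hsub : o ∩ ntRegion Ω κ x ⊆ N0 := by
    intro z hz
    by_contra hzN
    have : z ∈ o ∩ (ntRegion Ω κ x \ N0) := ⟨hz.1, hz.2, hzN⟩
    rw [hcon] at this; exact this
  exact hpos.ne' (measure_mono_null hsub hN)

theorem trace_le (hΩ : IsOpen Ω) {x : Euc n} {v : EuclideanSpace ℂ (Fin M)} (h : HasNTTrace Ω κ u x v) :
    (‖v‖₊ : ℝ≥0∞) ≤ ntMax Ω κ u x := by
  obtain ⟨hcl, N0, -, hN0, ht⟩ := h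
  have hae := ENNReal.ae_le_essSup (μ := volume.restrict (ntRegion Ω κ x)) (fun y => (‖u y‖₊ : ℝ≥0∞))
  rw [ae_restrict_iff' (isOpen_ntRegion hΩ κ x).measurableSet, ae_iff] at hae
  set N1 := {y | ¬ (y ∈ ntRegion Ω κ x → (‖u y‖₊ : ℝ≥0∞) ≤ essSup (fun y => (‖u y‖₊ : ℝ≥0∞)) (volume.restrict (ntRegion Ω κ x)))} with hN1
  have hN : volume (N0 ∪ N1) = 0 := measure_union_null hN0 hae
  have := nt_neBot hΩ hcl hN
  have ht' : Tendsto (fun y => (‖u y‖₊ : ℝ≥0∞)) (𝓝[ntRegion Ω κ x \ (N0 ∪ N1)] x) (𝓝 (‖v‖₊ : ℝ≥0∞)) := by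
    refine (ENNReal.continuous_coe.tendsto _).comp ((continuous_nnnorm.tendsto _).comp (ht.mono_left ?_))
    exact nhdsWithin_mono _ (diff_subset_diff_right subset_union_left)
  refine le_of_tendsto ht' ?_
  filter_upwards [self_mem_nhdsWithin] with y hy
  have hy1 : y ∉ N1 := fun h => hy.2 (Or.inr h)
  exact (not_not.1 hy1) hy.1

/-- truncated cones, as a set in the product -/
def cone (Ω : Set (Euc n)) (κ : ℝ) (k : ℕ) : Set (Euc n × Euc n) :=
  {p | p.2 ∈ Ω ∧ dist p.1 p.2 < (1 + κ) * infDist p.2 (frontier Ω) ∧ dist p.2 p.1 < 1 / ((k:ℝ) + 1)}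

theorem isOpen_cone (hΩ : IsOpen Ω) (κ : ℝ) (k : ℕ) : IsOpen (cone Ω κ k) := by
  have h2 : Continuous (fun y => infDist y (frontier Ω)) := continuous_infDist_pt _
  have h3 : IsOpen {p : Euc n × Euc n | p.2 ∈ Ω} := hΩ.preimage continuous_snd
  have h4 : IsOpen {p : Euc n × Euc n | dist p.1 p.2 < (1 + κ) * infDist p.2 (frontier Ω)} :=
    isOpen_lt (by fun_prop) (continuous_const.mul (h2.comp continuous_snd))
  have h5 : IsOpen {p : Euc n × Euc n | dist p.2 p.1 < 1 / ((k:ℝ) + 1)} :=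
    isOpen_lt (by fun_prop) (by fun_prop)
  exact h3.inter (h4.inter h5)

theorem cone_slice (κ : ℝ) (k : ℕ) (x : Euc n) :
    Prod.mk x ⁻¹' cone Ω κ k = ntRegion Ω κ x ∩ ball x (1 / ((k:ℝ) + 1)) := by
  ext y
  simp only [cone, ntRegion, mem_preimage, mem_inter_iff, mem_setOf, mem_ball]
  exact and_assoc.symm

theorem avg_meas (hΩ : IsOpen Ω) (hum : AEStronglyMeasurable u (volume.restrict Ω)) (κ : ℝ) (k : ℕ) :
    StronglyMeasurable (fun x => ⨍ y in ntRegion Ω κ x ∩ ball x (1 / ((k:ℝ) + 1)), u y) := by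
  set w := hum.mk u with hw
  have hwm : StronglyMeasurable w := hum.stronglyMeasurable_mk
  have hE := (isOpen_cone hΩ κ k).measurableSet
  have h1 : StronglyMeasurable (fun x => ∫ y, (cone Ω κ k).indicator (fun p => w p.2) (x, y)) := by
    refine StronglyMeasurable.integral_prod_right (f := fun x y => (cone Ω κ k).indicator (fun p => w p.2) (x, y)) ?_
    exact (hwm.comp_measurable measurable_snd).indicator hE
  have h2 : Measurable (fun x => volume.real (Prod.mk x ⁻¹' cone Ω κ k)) :=
    (measurable_measure_prodMk_left hE).ennreal_toReal
  have h3 : StronglyMeasurable (fun x => (volume.real (Prod.mk x ⁻¹' cone Ω κ k))⁻¹ •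
      ∫ y, (cone Ω κ k).indicator (fun p => w p.2) (x, y)) :=
    (h2.inv.stronglyMeasurable).smul h1
  convert h3 using 2 with x
  rw [setAverage_eq, ← cone_slice]
  congr 1
  have hmE : MeasurableSet (Prod.mk x ⁻¹' cone Ω κ k) := measurable_prodMk_left hE
  have e1 : ∀ y, (cone Ω κ k).indicator (fun p => w p.2) (x, y) = (Prod.mk x ⁻¹' cone Ω κ k).indicator w y := fun y => rfl
  simp only [e1]
  rw [integral_indicator hmE]
  have hsub : Prod.mk x ⁻¹' cone Ω κ k ⊆ Ω := fun y hy => hy.1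
  exact integral_congr_ae (ae_mono (Measure.restrict_mono hsub le_rfl) hum.ae_eq_mk)

theorem avg_tendsto (hΩ : IsOpen Ω) (hum : AEStronglyMeasurable u (volume.restrict Ω)) {x : Euc n}
    {v : EuclideanSpace ℂ (Fin M)} (h : HasNTTrace Ω κ u x v) :
    Tendsto (fun k : ℕ => ⨍ y in ntRegion Ω κ x ∩ ball x (1 / ((k:ℝ) + 1)), u y) atTop (𝓝 v) := by
  obtain ⟨hcl, N0, -, hN0, ht⟩ := h
  rw [Metric.tendsto_nhds]
  intro ε hε
  rw [Metric.tendsto_nhdsWithin_nhds] at ht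
  obtain ⟨δ, hδ, hd⟩ := ht (ε / 2) (half_pos hε)
  have hev : ∀ᶠ k : ℕ in atTop, 1 / ((k:ℝ) + 1) < δ := tendsto_one_div_add_atTop_nhds_zero_nat.eventually (gt_mem_nhds hδ)
  filter_upwards [hev] with k hk
  have hk0 : (0:ℝ) < 1 / ((k:ℝ) + 1) := by positivity
  set E := ntRegion Ω κ x ∩ ball x (1 / ((k:ℝ) + 1)) with hE
  have hEo : IsOpen E := (isOpen_ntRegion hΩ κ x).inter isOpen_ball
  have hEne : E.Nonempty := by
    obtain ⟨y, hy⟩ := _root_.mem_closure_iff.1 hcl _ isOpen_ball (mem_ball_self hk0)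
    exact ⟨y, hy.2, hy.1⟩
  have hE0 : volume E ≠ 0 := (hEo.measure_pos _ hEne).ne'
  have hEt : volume E ≠ ⊤ := ((measure_mono inter_subset_right).trans_lt measure_ball_lt_top).ne
  have hEm : ∀ᵐ y ∂(volume.restrict E), u y ∈ closedBall v (ε / 2) := by
    rw [ae_restrict_iff' hEo.measurableSet]
    have : ∀ᵐ y, y ∉ N0 := by rw [ae_iff]; simpa using hN0
    filter_upwards [this] with y hy hyE
    exact (hd ⟨hyE.1, hy⟩ (lt_trans hyE.2 hk)).le
  have hEi : IntegrableOn u E volume := by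
    have hfin : IsFiniteMeasure (volume.restrict E) := ⟨by simpa using hEt.lt_top⟩
    refine Integrable.of_bound (hum.mono_measure (Measure.restrict_mono (fun y (hy : y ∈ E) => hy.1.1) le_rfl)) (‖v‖ + ε / 2) ?_
    filter_upwards [hEm] with y hy
    rw [mem_closedBall, dist_eq_norm] at hy
    have := norm_le_norm_add_norm_sub' (u y) v
    linarith
  have := (convex_closedBall v (ε / 2)).set_average_mem isClosed_closedBall hE0 hEt hEm hEi
  rw [mem_closedBall] at this
  linarith

theorem conclude (hΩ : IsOpen Ω) (hum : AEStronglyMeasurable u (volume.restrict Ω)) (hκ : 0 < κ)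
    {σ : Measure (Euc n)} {p : ℝ} (hp : 0 < p)
    (hae : ∀ᵐ x ∂σ, ∃ v, ∀ κ' : ℝ, 0 < κ' → HasNTTrace Ω κ' u x v) :
    ∃ f : Euc n → EuclideanSpace ℂ (Fin M),
      (∀ᵐ x ∂σ, HasNTTrace Ω κ u x (f x)) ∧
      AEStronglyMeasurable f σ ∧
      (∫⁻ x, (‖f x‖₊ : ℝ≥0∞) ^ p ∂σ) ^ (1 / p) ≤
        (∫⁻ x, (ntMax Ω κ u x) ^ p ∂σ) ^ (1 / p) ∧
      ∀ κ' : ℝ, 0 < κ' → ∀ᵐ x ∂σ, HasNTTrace Ω κ' u x (f x) := by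
  classical
  set f : Euc n → EuclideanSpace ℂ (Fin M) := fun x =>
    if h : ∃ v, ∀ κ' : ℝ, 0 < κ' → HasNTTrace Ω κ' u x v then h.choose else 0 with hf
  have hall : ∀ κ' : ℝ, 0 < κ' → ∀ᵐ x ∂σ, HasNTTrace Ω κ' u x (f x) := by
    intro κ' hκ'
    filter_upwards [hae] with x hx
    simp only [hf, dif_pos hx]
    exact hx.choose_spec κ' hκ'
  refine ⟨f, hall κ hκ, ?_, ?_, hall⟩
  · refine aestronglyMeasurable_of_tendsto_ae atTop
      (f := fun (k : ℕ) x => ⨍ y in ntRegion Ω κ x ∩ ball x (1 / ((k:ℝ) + 1)), u y)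
      (fun k => (avg_meas hΩ hum κ k).aestronglyMeasurable) ?_
    filter_upwards [hall κ hκ] with x hx
    exact avg_tendsto hΩ hum hx
  · refine ENNReal.rpow_le_rpow (lintegral_mono_ae ?_) (by positivity)
    filter_upwards [hall κ hκ] with x hx
    exact ENNReal.rpow_le_rpow (trace_le hΩ hx) hp.le
end fin

theorem geo_of_ahlfors (hn : 2 ≤ n) {Ω : Set (Euc n)} (hΩ : IsOpen Ω) {C : ℝ}
    (hA : AhlforsRegularWith n (frontier Ω) C) (hS : (frontier Ω).Nontrivial) :
    ∃ D, Geo Ω ((μH[(n : ℝ) - 1]).restrict (frontier Ω)) D C⁻¹ C := by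
  obtain ⟨h1, h2, h3⟩ := hA
  obtain ⟨x, hx, y, hy, hxy⟩ := hS
  have hd : 0 < dist x y := dist_pos.2 hxy
  have hmeas : MeasurableSet (frontier Ω) := isClosed_frontier.measurableSet
  have key : ∀ r, r < dist x y → ENNReal.ofReal r < 2 * EMetric.diam (frontier Ω) := by
    intro r hr
    have e1 : edist x y ≤ EMetric.diam (frontier Ω) := Metric.edist_le_ediam_of_mem hx hy
    have e2 : ENNReal.ofReal r < edist x y := by
      rw [edist_dist]; exact (ENNReal.ofReal_lt_ofReal_iff hd).2 hr
    refine e2.trans_le (e1.trans ?_)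
    rw [two_mul]; exact le_self_add
  refine ⟨dist x y, hn, hΩ, hd, by positivity, by positivity, ?_, ?_, ?_⟩
  · rw [Measure.restrict_apply' hmeas]; simp
  · intro z hz r hr hrD
    rw [Measure.restrict_apply' hmeas, inter_comm]
    exact (h3 z hz r hr (key r hrD)).1
  · intro z hz r hr hrD
    rw [Measure.restrict_apply' hmeas, inter_comm]
    exact (h3 z hz r hr (key r hrD)).2
end

/-- Fatou-type theorem for injectively elliptic first-order systems in UR
domains: null-solutions of an injectively elliptic homogeneous first-order system, whose
nontangential maximal function lies in `L^p(∂Ω,σ)` with `p > (n-1)/n`, admit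
nontangential boundary traces σ-a.e., the trace is σ-measurable, lies in `L^p(∂Ω,σ)`
with norm at most `‖N_κ u‖_{L^p}`, and is independent of the aperture. -/
theorem statement15 (n : ℕ) (hn : 2 ≤ n)
    (Ω : Set (Euc n)) (hΩo : IsOpen Ω)
    (hUR : IsURSet n (frontier Ω))
    (hmt : μH[(n : ℝ) - 1] (frontier Ω \ mtBoundary n Ω) = 0)
    (σ : Measure (Euc n)) (hσ : σ = (μH[(n : ℝ) - 1]).restrict (frontier Ω))
    (N M : ℕ) (hN : 0 < N) (hM : 0 < M)
    (a : Fin n → Fin N → Fin M → ℂ)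
    -- injective ellipticity of the principal symbol
    (hell : ∀ ξ : Euc n, ξ ≠ 0 → ∀ v : Fin M → ℂ,
      (∀ α : Fin N, ∑ β : Fin M, (∑ j : Fin n, a j α β * (ξ j : ℂ)) * v β = 0) → v = 0)
    (κ : ℝ) (hκ : 0 < κ) (p : ℝ) (hp : ((n : ℝ) - 1) / n < p)
    (u : Euc n → EuclideanSpace ℂ (Fin M))
    (hloc : LocallyIntegrableOn u Ω volume)
    (hNu : ∫⁻ x, (ntMax Ω κ u x) ^ p ∂σ < ⊤)
    -- Du = 0 in the sense of distributions in Ω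
    (hD : ∀ φ : Euc n → ℝ, ContDiff ℝ (⊤ : ℕ∞) φ → HasCompactSupport φ → tsupport φ ⊆ Ω →
      ∀ α : Fin N, ∑ j : Fin n, ∑ β : Fin M,
        a j α β * ∫ x in Ω, (fderiv ℝ φ x (EuclideanSpace.single j 1) : ℂ) * u x β = 0) :
    ∃ f : Euc n → EuclideanSpace ℂ (Fin M),
      (∀ᵐ x ∂σ, HasNTTrace Ω κ u x (f x)) ∧
      AEStronglyMeasurable f σ ∧
      (∫⁻ x, (‖f x‖₊ : ℝ≥0∞) ^ p ∂σ) ^ (1 / p) ≤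
        (∫⁻ x, (ntMax Ω κ u x) ^ p ∂σ) ^ (1 / p) ∧
      ∀ κ' : ℝ, 0 < κ' → ∀ᵐ x ∂σ, HasNTTrace Ω κ' u x (f x) := by
  have hn0 : (0:ℝ) < n := by exact_mod_cast (by omega : 0 < n)
  have hn1 : (0:ℝ) < (n:ℝ) - 1 := by
    have : (2:ℝ) ≤ n := by exact_mod_cast hn
    linarith
  have hp0 : 0 < p := lt_trans (by positivity) hp
  have hum := hloc.aestronglyMeasurable
  refine conclude hΩo hum hκ hp0 ?_
  rcases (frontier Ω).subsingleton_or_nontrivial with hS | hS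
  · have := MeasureTheory.Measure.noAtoms_hausdorff (X := Euc n) hn1
    have h0 : σ = 0 := by
      rw [hσ, Measure.restrict_eq_zero]
      exact hS.measure_zero _
    rw [h0]; simp
  · obtain ⟨-, ⟨C, hC⟩, -⟩ := hUR
    obtain ⟨D, G⟩ := geo_of_ahlfors hn hΩo hC hS
    rw [← hσ] at G
    have hmt' : ∀ᵐ x ∂σ, x ∈ mtBoundary n Ω := by
      rw [ae_iff, hσ, Measure.restrict_apply' isClosed_frontier.measurableSet]
      refine measure_mono_null ?_ hmt
      exact fun x hx => ⟨hx.2, hx.1⟩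
    have hfin : ∀ᵐ x ∂σ, ntMax Ω κ u x < ⊤ := by
      have hm : Measurable (fun x => (ntMax Ω κ u x) ^ p) := (ntMax_lsc hΩo).measurable.pow_const p
      filter_upwards [ae_lt_top hm hNu.ne] with x hx
      by_contra h
      have h' : ntMax Ω κ u x = ⊤ := by simpa using h
      rw [h', ENNReal.top_rpow_of_pos hp0] at hx
      exact lt_irrefl _ hx
    exact trace_ae G hmt' hell hκ hloc (fun φ hφ α => hD φ hφ.smooth hφ.cpt hφ.supp α) hfin
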